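/- Let f : X → X be a surjective self-morphism of a projective curve X defined over a number field K. Then there exists a non-negative integer s₀ such that for all x, y ∈ X(K), if f^{s}(x) = f^{s}(y) for some s ≥ 0, then f^{s₀}(x) = f^{s₀}(y). -/

import Mathlib

/-!
STATEMENT 2: Let `f : X → X` be a surjective self-morphism of a projective curve `X` over a
number field `K`.  Then there exists `s₀ ≥ 0` such that for all `x, y ∈ X(K)`, if
`f^s(x) = f^s(y)` for some `s ≥ 0`, then `f^{s₀}(x) = f^{s₀}(y)`.

Formalization notes.  A curve over `K` is a separated irreducible reduced scheme of finite
type over `K` of dimension one; separatedness and finite type follow from projectivity, which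
is encoded as the existence of a closed immersion over `K` into
`ℙⁿ_K = ℙⁿ_ℤ ×_{Spec ℤ} Spec K`.  Dimension one is expressed via the topological Krull
dimension.
-/

open AlgebraicGeometry CategoryTheory CategoryTheory.Limits

attribute [local instance] MvPolynomial.gradedAlgebra

noncomputable section

/-- Projective `n`-space over `ℤ`, as `Proj` of the graded polynomial ring. -/
def ProjZ (n : ℕ) : Scheme :=
  AlgebraicGeometry.Proj (MvPolynomial.homogeneousSubmodule (Fin (n + 1)) ℤ)

/-- Projective `n`-space over a commutative ring `R`. -/
def ProjOver (n : ℕ) (R : Type) [CommRing R] : Scheme :=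
  Limits.prod (ProjZ n) (Spec (CommRingCat.of R))

/-- The structure morphism of `ℙⁿ_R` over `Spec R`. -/
def ProjOver.structMap (n : ℕ) (R : Type) [CommRing R] :
    ProjOver n R ⟶ Spec (CommRingCat.of R) :=
  Limits.prod.snd

/-- Projectivity of `p : X ⟶ Spec R`. -/
def IsProjectiveOver {X : Scheme} {R : Type} [CommRing R]
    (p : X ⟶ Spec (CommRingCat.of R)) : Prop :=
  ∃ (n : ℕ) (ι : X ⟶ ProjOver n R),
    IsClosedImmersion ι ∧ ι ≫ ProjOver.structMap n R = p

/-- The `s`-th iterate of a self-morphism of a scheme. -/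
def Scheme.iter {X : Scheme} (f : X ⟶ X) : ℕ → (X ⟶ X)
  | 0 => 𝟙 X
  | s + 1 => Scheme.iter f s ≫ f

section NumberFieldValuations

open IsDedekindDomain NumberField WithZero
open scoped WithZero

variable {K : Type*} [Field K] [NumberField K]

theorem eventually_valuation_le_one (a : K) :
    ∀ᶠ v : HeightOneSpectrum (𝓞 K) in Filter.cofinite, v.valuation K a ≤ 1 := by
  have := HeightOneSpectrum.Support.finite (𝓞 K) a
  refine this.subset fun v hv => ?_
  simpa [HeightOneSpectrum.Support] using hv

instance infinite_heightOneSpectrum_ringOfIntegers : Infinite (HeightOneSpectrum (𝓞 K)) := by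
  have h (p : Nat.Primes) : ∃ v : HeightOneSpectrum (𝓞 K), ((p : ℕ) : 𝓞 K) ∈ v.asIdeal := by
    have hp : ¬ IsUnit ((p : ℕ) : 𝓞 K) := by
      intro hu
      have h1 := (isUnit_iff_norm.mp hu)
      have h2 : (Algebra.norm ℚ) (((p : ℕ) : 𝓞 K) : K) = (p : ℚ) ^ Module.finrank ℚ K := by
        have := Algebra.norm_algebraMap (S := K) (p : ℚ)
        simpa using this
      rw [RingOfIntegers.coe_norm, h2, abs_of_nonneg (by positivity)] at h1
      have h3 : (1 : ℚ) < p := by exact_mod_cast p.2.one_lt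
      exact absurd h1 (one_lt_pow₀ h3 Module.finrank_pos.ne').ne'
    obtain ⟨m, hm, hpm⟩ := exists_max_ideal_of_mem_nonunits hp
    refine ⟨⟨m, hm.isPrime, ?_⟩, hpm⟩
    rintro rfl
    simp [p.2.ne_zero] at hpm
  choose g hg using h
  refine Infinite.of_injective g fun p q hpq => ?_
  by_contra hne
  have hc : Nat.Coprime p q := (Nat.coprime_primes p.2 q.2).2 fun h => hne (Subtype.ext h)
  have hc' : IsCoprime ((p : ℕ) : 𝓞 K) ((q : ℕ) : 𝓞 K) := by
    have := (Nat.isCoprime_iff_coprime.mpr hc).map (Int.castRingHom (𝓞 K))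
    simpa using this
  obtain ⟨a, b, hab⟩ := hc'
  refine (g p).isPrime.ne_top ((Ideal.eq_top_iff_one _).2 ?_)
  rw [← hab]
  exact Ideal.add_mem _ (Ideal.mul_mem_left _ _ (hg p))
    (Ideal.mul_mem_left _ _ (hpq ▸ hg q))

theorem WithZero.le_exp_neg_one_of_lt_one {x : ℤᵐ⁰} (hx : x < 1) : x ≤ exp (-1 : ℤ) := by
  rcases eq_or_ne x 0 with rfl | h0
  · exact zero_le
  · rw [← exp_log h0] at hx ⊢
    rw [← exp_zero, exp_lt_exp] at hx
    rw [exp_le_exp]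
    omega

theorem WithZero.exists_exp_neg_le {x : ℤᵐ⁰} (hx : x ≠ 0) : ∃ n : ℕ, exp (-(n : ℤ)) ≤ x := by
  refine ⟨(-log x).toNat, ?_⟩
  conv_rhs => rw [← exp_log hx]
  rw [exp_le_exp]
  omega

/-- The valuation ring of `v` is finite modulo every nonzero ideal. -/
def HasFiniteQuotients {K : Type*} [Field K] (v : Valuation K ℤᵐ⁰) : Prop :=
  ∀ n : ℕ, ∃ (S : Type) (_ : Finite S) (r : K → S), ∀ a b : K, v a ≤ 1 → v b ≤ 1 →
    (r a = r b ↔ v (a - b) ≤ exp (-(n : ℤ)))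

theorem hasFiniteQuotients_valuation {K : Type} [Field K] [NumberField K]
    (v : HeightOneSpectrum (𝓞 K)) :
    HasFiniteQuotients (v.valuation K) := by
  intro n
  have key (x : K) (hx : v.valuation K x ≤ 1) :
      ∃ m : 𝓞 K, v.valuation K (algebraMap (𝓞 K) K m - x) ≤ exp (-(n : ℤ)) := by
    obtain ⟨m, hm⟩ := v.exists_valuation_sub_lt_of_integer hx
      (γ := Units.mk0 (exp (-(n : ℤ))) exp_ne_zero)
    exact ⟨m, hm.le⟩
  choose! m hm using key
  refine ⟨𝓞 K ⧸ v.asIdeal ^ n, ?_, fun x => Ideal.Quotient.mk _ (m x), fun a b ha hb => ?_⟩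
  · exact Ideal.finiteQuotientOfFreeOfNeBot _ (pow_ne_zero _ v.ne_bot)
  · have e : v.valuation K (algebraMap (𝓞 K) K (m a) - algebraMap (𝓞 K) K (m b)) =
        v.intValuation (m a - m b) := by
      rw [← map_sub, v.valuation_of_algebraMap]
    rw [Ideal.Quotient.eq, ← HeightOneSpectrum.intValuation_le_pow_iff_mem, ← e]
    set A := algebraMap (𝓞 K) K (m a)
    set B := algebraMap (𝓞 K) K (m b)
    constructor <;> intro h
    · have : a - b = (A - B) - (A - a) + (B - b) := by ring
      rw [this]
      exact Valuation.map_add_le _ (Valuation.map_sub_le _ h (hm a ha)) (hm b hb)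
    · have : A - B = (a - b) + (A - a) - (B - b) := by ring
      rw [this]
      exact Valuation.map_sub_le _ (Valuation.map_add_le _ h (hm a ha)) (hm b hb)

end NumberFieldValuations

section Uniformizer

open IsDedekindDomain TensorProduct

variable {B : Type*} [CommRing B]

/-- An element of `n` that generates `n` after localization away from `n`. -/
def IsLocalGenerator (n : Ideal B) (ϖ : B) : Prop :=
  ϖ ∈ n ∧ ∀ x ∈ n, ∃ s ∉ n, ∃ c, s * x = ϖ * c

theorem IsDedekindDomain.HeightOneSpectrum.exists_isLocalGenerator [IsDedekindDomain B]
    (v : HeightOneSpectrum B) :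
    ∃ ϖ, IsLocalGenerator v.asIdeal ϖ ∧ ϖ ≠ 0 ∧
      ∀ b ≠ 0, ∃ k : ℕ, ∃ s ∉ v.asIdeal, ∃ b₁ ∉ v.asIdeal, b * s = b₁ * ϖ ^ k := by
  obtain ⟨ϖ, hϖ⟩ := v.intValuation_exists_uniformizer
  have hϖ0 : ϖ ≠ 0 := by rintro rfl; rw [map_zero] at hϖ; exact WithZero.exp_ne_zero hϖ.symm
  have hϖm : ϖ ∈ v.asIdeal := by
    rw [← v.intValuation_lt_one_iff_mem, hϖ, ← WithZero.exp_zero, WithZero.exp_lt_exp]; simp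
  have key : ∀ b ≠ 0, ∃ k : ℕ, ∃ s ∉ v.asIdeal, ∃ b₁ ∉ v.asIdeal, b * s = b₁ * ϖ ^ k := by
    intro b hb
    obtain ⟨k, hk⟩ : ∃ k : ℕ, v.intValuation b = WithZero.exp (-(k : ℤ)) :=
      ⟨_, v.intValuation_if_neg hb⟩
    have hϖk : v.intValuation (ϖ ^ k) = WithZero.exp (-(k : ℤ)) := by
      rw [map_pow, hϖ, ← WithZero.exp_nsmul]; simp
    let L := FractionRing B
    have hL : algebraMap B L (ϖ ^ k) ≠ 0 := by
      simpa using fun h ↦ absurd h hϖ0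
    have hx : v.valuation L (algebraMap B L b / algebraMap B L (ϖ ^ k)) = 1 := by
      rw [map_div₀, v.valuation_of_algebraMap, v.valuation_of_algebraMap, hk, hϖk,
        div_self WithZero.exp_ne_zero]
    obtain ⟨b₁, s, hs⟩ := v.exists_primeCompl_mul_eq_of_integer _ hx.le
    have hs' : b * s = b₁ * ϖ ^ k := by
      apply IsFractionRing.injective B L
      rw [div_mul_eq_mul_div, div_eq_iff hL] at hs
      simpa using hs
    refine ⟨k, s, s.2, b₁, ?_, hs'⟩
    have h1 := congrArg v.intValuation hs'
    rw [map_mul, map_mul, hk, hϖk, (v.intValuation_eq_one_iff_mem_primeCompl _).2 s.2,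
      mul_one] at h1
    have := mul_right_cancel₀ WithZero.exp_ne_zero ((one_mul _).trans h1)
    exact (v.intValuation_eq_one_iff_mem_primeCompl _).1 this.symm
  refine ⟨ϖ, ⟨hϖm, fun x hx ↦ ?_⟩, hϖ0, key⟩
  by_cases hx0 : x = 0
  · exact ⟨1, v.isPrime.one_notMem, 0, by simp [hx0]⟩
  · obtain ⟨k, s, hs, b₁, hb₁, h⟩ := key x hx0
    rcases k with _ | k
    · exact absurd (by simpa [h] using v.asIdeal.mul_mem_right s hx) hb₁
    · exact ⟨s, hs, b₁ * ϖ ^ k, by rw [mul_comm, h]; ring⟩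

variable (K : Type*) [Field K] [Algebra K B]

theorem IsLocalGenerator.exists_lmul'_notMem [CharZero K] [Algebra.FiniteType K B]
    {n : Ideal B} [hn : n.IsMaximal] {ϖ : B} (hϖ : IsLocalGenerator n ϖ) :
    ∃ u : B ⊗[K] B, Algebra.TensorProduct.lmul' K (S := B) u ∉ n ∧
      ∀ b : B, ∃ w, u * (1 ⊗ₜ b - b ⊗ₜ 1) = w * (1 ⊗ₜ ϖ - ϖ ⊗ₜ 1) := by
  set μ := Algebra.TensorProduct.lmul' K (S := B)
  let d : B → B ⊗[K] B := fun b ↦ 1 ⊗ₜ b - b ⊗ₜ 1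
  let I := KaehlerDifferential.ideal K B
  let J := n.comap μ
  have hμ : Function.Surjective μ := fun b ↦ ⟨b ⊗ₜ 1, by simp [μ]⟩
  have hJ : J.IsMaximal := Ideal.comap_isMaximal_of_surjective μ hμ
  have hIJ : I ≤ J := fun x hx ↦ by
    have : μ x = 0 := hx
    simp [J, this]
  have hdI : ∀ b, d b ∈ I := KaehlerDifferential.one_smul_sub_smul_one_mem_ideal K
  let N : Ideal (B ⊗[K] B) := Ideal.span {d ϖ} ⊔ J • I
  have trick : ∀ e ∉ J, ∀ x ∈ I, e * x ∈ N → x ∈ N := by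
    intro e he x hx hex
    obtain ⟨r, hr⟩ := Ideal.IsMaximal.exists_inv hJ he
    obtain ⟨j, hj, hrj⟩ := hr
    have : x = r * (e * x) + j * x := by
      linear_combination (-x) * hrj
    rw [this]
    exact N.add_mem (N.mul_mem_left _ hex) (Submodule.mem_sup_right (Submodule.smul_mem_smul hj hx))
  have hmul : ∀ a b : B, d (a * b) = (a ⊗ₜ 1) * d b + d a * (1 ⊗ₜ b) := by
    intro a b
    simp only [d, mul_sub, sub_mul, Algebra.TensorProduct.tmul_mul_tmul, mul_one, one_mul]
    ring
  have hJI : ∀ {e x}, e ∈ J → x ∈ I → e * x ∈ N := fun he hx ↦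
    Submodule.mem_sup_right (Submodule.smul_mem_smul he hx)
  have hdn : ∀ x ∈ n, d x ∈ N := by
    intro x hx
    obtain ⟨s, hs, c, hsc⟩ := hϖ.2 x hx
    refine trick (s ⊗ₜ 1) (by simpa [J, μ] using hs) _ (hdI _) ?_
    have h1 : (s ⊗ₜ 1) * d x = (ϖ ⊗ₜ 1) * d c + d ϖ * (1 ⊗ₜ c) - (1 ⊗ₜ x) * d s := by
      have := hmul s x
      rw [hsc, hmul ϖ c] at this
      linear_combination -this
    rw [h1]
    refine N.sub_mem (N.add_mem (hJI (by simpa [J, μ] using hϖ.1) (hdI _)) ?_)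
      (hJI (by simpa [J, μ] using hx) (hdI _))
    exact N.mul_mem_right _ (Submodule.mem_sup_left (Ideal.mem_span_singleton_self _))
  have hd : ∀ b, d b ∈ N := by
    intro b
    let := Ideal.Quotient.field n
    have : Module.Finite K (B ⧸ n) := finite_of_finite_type_of_isJacobsonRing K (B ⧸ n)
    set q := minpoly K (Ideal.Quotient.mk n b)
    have hqi : IsIntegral K (Ideal.Quotient.mk n b) := Algebra.IsIntegral.isIntegral _
    have hq : Polynomial.aeval b q ∈ n := by
      rw [← Ideal.Quotient.eq_zero_iff_mem]
      have := minpoly.aeval K (Ideal.Quotient.mk n b)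
      rwa [← Ideal.Quotient.mkₐ_eq_mk K, Polynomial.aeval_algHom_apply] at this
    have hq' : Polynomial.aeval b (Polynomial.derivative q) ∉ n := by
      rw [← Ideal.Quotient.eq_zero_iff_mem, ← Ideal.Quotient.mkₐ_eq_mk K,
        ← Polynomial.aeval_algHom_apply]
      exact (minpoly.irreducible hqi).separable.aeval_derivative_ne_zero (minpoly.aeval K _)
    have hl : ∀ p : Polynomial K, Polynomial.aeval (b ⊗ₜ[K] (1 : B)) p =
        (Polynomial.aeval b p) ⊗ₜ 1 := fun p ↦
      Polynomial.aeval_algHom_apply (Algebra.TensorProduct.includeLeft (R := K) (S := K)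
        (A := B) (B := B)) b p
    have hr : ∀ p : Polynomial K, Polynomial.aeval ((1 : B) ⊗ₜ[K] b) p =
        1 ⊗ₜ (Polynomial.aeval b p) := fun p ↦
      Polynomial.aeval_algHom_apply (Algebra.TensorProduct.includeRight (R := K)
        (A := B) (B := B)) b p
    obtain ⟨k, hk⟩ := (q.map (algebraMap K (B ⊗[K] B))).binomExpansion (b ⊗ₜ 1) (d b)
    rw [Polynomial.derivative_map, Polynomial.eval_map_algebraMap, Polynomial.eval_map_algebraMap,
      Polynomial.eval_map_algebraMap, show b ⊗ₜ 1 + d b = 1 ⊗ₜ[K] b by simp [d], hl, hr, hl] at hk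
    refine trick _ (?_ : (Polynomial.aeval b (Polynomial.derivative q)) ⊗ₜ 1 ∉ J) _ (hdI b) ?_
    · simpa [J, μ] using hq'
    · have : (Polynomial.aeval b (Polynomial.derivative q)) ⊗ₜ 1 * d b =
          d (Polynomial.aeval b q) - k * d b * d b := by
        simp only [d] at hk ⊢
        linear_combination -hk
      rw [this]
      refine N.sub_mem (hdn _ hq) (hJI (J.mul_mem_left _ (hIJ (hdI b))) (hdI b))
  have hIN : I ≤ Ideal.span {d ϖ} ⊔ J • I := by
    refine (KaehlerDifferential.span_range_eq_ideal K B).symm.le.trans (Ideal.span_le.2 ?_)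
    rintro _ ⟨b, rfl⟩
    exact hd b
  have : IsNoetherianRing B := Algebra.FiniteType.isNoetherianRing K _
  have : IsNoetherianRing (B ⊗[K] B) := Algebra.FiniteType.isNoetherianRing B _
  obtain ⟨r, hrJ, hr⟩ := Submodule.exists_sub_one_mem_and_smul_le_of_fg_of_le_sup
    (IsNoetherian.noetherian I) le_rfl hIN
  refine ⟨r, fun h ↦ ?_, fun b ↦ ?_⟩
  · have : (1 : B ⊗[K] B) ∈ J := by simpa using J.sub_mem (show r ∈ J from h) hrJ
    exact hJ.ne_top ((Ideal.eq_top_iff_one _).2 this)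
  · have := hr (Submodule.smul_mem_pointwise_smul _ r _ (hdI b))
    obtain ⟨w, hw⟩ := Ideal.mem_span_singleton'.1 this
    exact ⟨w, hw.symm⟩

theorem exists_finite_family_lmul'_eq_one [CharZero K] [IsDedekindDomain B]
    [Algebra.FiniteType K B] (hB : ¬ IsField B) :
    ∃ (ι : Type) (_ : Fintype ι) (c z : ι → B) (u : ι → B ⊗[K] B),
      ∑ j, c j * Algebra.TensorProduct.lmul' K (S := B) (u j) = 1 ∧
      ∀ j, ∀ b : B, ∃ w, u j * (1 ⊗ₜ b - b ⊗ₜ 1) = w * (1 ⊗ₜ z j - z j ⊗ₜ 1) := by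
  let T : Set (B ⊗[K] B) :=
    {u | ∃ z, ∀ b : B, ∃ w, u * (1 ⊗ₜ b - b ⊗ₜ 1) = w * (1 ⊗ₜ z - z ⊗ₜ 1)}
  have htop : Ideal.span (Algebra.TensorProduct.lmul' K (S := B) '' T) = ⊤ := by
    by_contra h
    obtain ⟨n, hn, hle⟩ := Ideal.exists_le_maximal _ h
    have hn0 : n ≠ ⊥ := fun h0 ↦ hB (Ring.isField_iff_maximal_bot.2 (h0 ▸ hn))
    obtain ⟨ϖ, hϖ, -⟩ := HeightOneSpectrum.exists_isLocalGenerator ⟨n, hn.isPrime, hn0⟩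
    obtain ⟨u, hu, huT⟩ := hϖ.exists_lmul'_notMem K (n := n)
    exact hu (hle (Ideal.subset_span ⟨u, ⟨ϖ, huT⟩, rfl⟩))
  have h1 : (1 : B) ∈ Ideal.span (Algebra.TensorProduct.lmul' K (S := B) '' T) := by simp [htop]
  rw [Ideal.span, Finsupp.mem_span_image_iff_linearCombination] at h1
  obtain ⟨l, hl, hl1⟩ := h1
  have hmem : ∀ j : Fin l.support.card, (l.support.equivFin.symm j : B ⊗[K] B) ∈ T := fun j ↦
    hl (l.support.equivFin.symm j).2
  choose z hz using hmem
  refine ⟨Fin l.support.card, inferInstance, fun j ↦ l (l.support.equivFin.symm j), z,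
    fun j ↦ l.support.equivFin.symm j, ?_, hz⟩
  rw [← hl1, Finsupp.linearCombination_apply, Finsupp.sum, ← Finset.sum_coe_sort l.support]
  exact Fintype.sum_equiv l.support.equivFin.symm _ _ fun _ ↦ rfl

end Uniformizer

section Contraction

open WithZero
open scoped WithZero

/-- In a sequence in a finite set whose every term determines the next one, an eventually constant
tail begins after at most as many steps as the set has elements. -/
theorem eq_of_eventually_eq_of_deterministic {S : Type*} [Finite S] {σ : ℕ → S} {e : S}
    (hdet : ∀ i j, σ i = σ j → σ (i + 1) = σ (j + 1)) {s : ℕ} (hs : ∀ n ≥ s, σ n = e) :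
    σ (Nat.card S) = e := by
  obtain ⟨i, j, hij, hj, hσ⟩ : ∃ i j, i < j ∧ j ≤ Nat.card S ∧ σ i = σ j := by
    have : Fintype S := Fintype.ofFinite S
    have := Fintype.exists_ne_map_eq_of_card_lt (fun m : Fin (Nat.card S + 1) ↦ σ m)
      (by simp [Nat.card_eq_fintype_card])
    obtain ⟨a, b, hab, h⟩ := this
    rcases lt_or_gt_of_ne hab with h' | h'
    · exact ⟨a, b, h', by omega, h⟩
    · exact ⟨b, a, h', by omega, h.symm⟩
  have h1 : ∀ t, σ (i + t) = σ (j + t) := by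
    intro t
    induction t with
    | zero => exact hσ
    | succ t ih => exact hdet _ _ ih
  have h2 : ∀ m t, σ (i + m) = σ (i + m + t * (j - i)) := by
    intro m t
    induction t with
    | zero => simp
    | succ t ih =>
      rw [ih, show i + m + t * (j - i) = i + (m + t * (j - i)) by ring, h1]
      congr 1
      rw [Nat.succ_mul]
      omega
  obtain ⟨m, hm⟩ := Nat.exists_eq_add_of_le (hij.le.trans hj)
  rw [hm, h2 m s]
  refine hs _ ?_
  have : s * 1 ≤ s * (j - i) := Nat.mul_le_mul_left _ (by omega)
  omega

variable {K : Type*} [Field K]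

theorem Valuation.map_natCast_le_one (v : Valuation K ℤᵐ⁰) (k : ℕ) : v k ≤ 1 := by
  induction k with
  | zero => simp
  | succ k ih => rw [Nat.cast_succ]; exact (v.map_add _ _).trans (max_le ih (by simp))

theorem Valuation.map_pow_sub_pow_le (v : Valuation K ℤᵐ⁰) {a b : K} (ha : v a ≤ 1) (hb : v b ≤ 1)
    (k : ℕ) : v (a ^ k - b ^ k) ≤ v (a - b) := by
  obtain ⟨q, hq⟩ := sub_dvd_pow_sub_pow (⟨a, ha⟩ : v.integer) ⟨b, hb⟩ k
  have := congrArg (algebraMap v.integer K) hq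
  have hq' : a ^ k - b ^ k = (a - b) * q := this
  rw [hq', map_mul]
  exact mul_le_of_le_one_right' q.2

theorem Valuation.map_pow_sub_one (v : Valuation K ℤᵐ⁰) {a : K} {k : ℕ}
    (ha : v (a - 1) < v k) : v (a ^ k - 1) = v k * v (a - 1) := by
  have hk := v.map_natCast_le_one k
  obtain ⟨q, hq⟩ := Polynomial.powAddExpansion (1 : v.integer) ⟨a - 1, (ha.le.trans hk)⟩ k
  have := congrArg (algebraMap v.integer K) hq
  have hq' : (1 + (a - 1)) ^ k = 1 ^ k + k * 1 ^ (k - 1) * (a - 1) + q * (a - 1) ^ 2 := by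
    simp only [map_add, map_mul, map_pow, map_one, map_natCast] at this
    exact this
  have h : a ^ k - 1 = k * (a - 1) + q * (a - 1) ^ 2 := by
    simp only [one_pow, add_sub_cancel] at hq'
    linear_combination hq'
  by_cases h0 : v (a - 1) = 0
  · have : a = 1 := sub_eq_zero.1 (v.zero_iff.1 h0)
    simp [this]
  rw [h, ← map_mul]
  refine Valuation.map_add_eq_of_lt_left _ ?_
  rw [map_mul, map_mul, map_pow, pow_two, ← mul_assoc]
  refine mul_lt_mul_of_pos_right ?_ (zero_lt_iff.2 h0)
  exact (mul_le_of_le_one_left' q.2).trans_lt ha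

/-- Sequences `ρ (n + 1) = ρ n ^ k * l n` of units, with `l n` close to `1`, which are eventually
`1` become `1` after a number of steps that does not depend on the sequence. -/
theorem HasFiniteQuotients.exists_forall_eq_one [CharZero K] {v : Valuation K ℤᵐ⁰}
    (hv : HasFiniteQuotients v) {k : ℕ} (hk : k ≠ 0) :
    ∃ c, ∀ ρ l : ℕ → K, (∀ n, v (ρ n) = 1) → (∀ n, ρ (n + 1) = ρ n ^ k * l n) →
      (∀ n, v (l n - 1) ≤ exp (-1) * (v k * v (ρ n - 1))) → (∃ s, ∀ n ≥ s, ρ n = 1) →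
      ρ c = 1 := by
  have hk0 : v k ≠ 0 := by simpa using hk
  obtain ⟨e, he⟩ : ∃ e : ℕ, v k = exp (-(e : ℤ)) := by
    obtain ⟨m, hm⟩ : ∃ m : ℤ, v k = exp m := ⟨_, (exp_log hk0).symm⟩
    have : m ≤ 0 := by
      have := v.map_natCast_le_one k
      rwa [hm, ← exp_zero, exp_le_exp] at this
    exact ⟨m.natAbs, by rw [hm]; congr 1; omega⟩
  have hlt : ∀ {x : ℤᵐ⁰}, x ≤ exp (-((e + 1 : ℕ) : ℤ)) ↔ x < v k := by
    intro x
    rw [he]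
    rcases eq_or_ne x 0 with rfl | hx
    · simp
    · obtain ⟨m, rfl⟩ : ∃ m : ℤ, x = exp m := ⟨_, (exp_log hx).symm⟩
      rw [exp_le_exp, exp_lt_exp]
      push_cast
      omega
  obtain ⟨S, _, r, hr⟩ := hv (e + 1)
  refine ⟨Nat.card S, fun ρ l hρ hρl hl ⟨s, hs⟩ ↦ ?_⟩
  have hexp : (exp (-1) : ℤᵐ⁰) < 1 := by rw [← exp_zero, exp_lt_exp]; simp
  have hsub : ∀ n, v (ρ n - 1) ≤ 1 := fun n ↦
    (v.map_sub _ _).trans (max_le (hρ n).le (by simp))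
  have hk1 := v.map_natCast_le_one k
  have hlk : ∀ n, v (l n - 1) < v k := fun n ↦ by
    refine (hl n).trans_lt ?_
    calc exp (-1) * (v k * v (ρ n - 1)) ≤ exp (-1) * v k := by
          gcongr; exact mul_le_of_le_one_right' (hsub n)
      _ < 1 * v k := mul_lt_mul_of_pos_right hexp (zero_lt_iff.2 hk0)
      _ = v k := one_mul _
  have hl1 : ∀ n, v (l n) = 1 := fun n ↦ by
    have h := hρ (n + 1)
    rwa [hρl, map_mul, map_pow, hρ, one_pow, one_mul] at h
  have hstep : ∀ n, v (ρ (n + 1) - ρ n ^ k) < v k := fun n ↦ by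
    rw [hρl, show ρ n ^ k * l n - ρ n ^ k = ρ n ^ k * (l n - 1) by ring, map_mul, map_pow, hρ,
      one_pow, one_mul]
    exact hlk n
  have hlast : v (ρ (Nat.card S) - 1) < v k := by
    have := eq_of_eventually_eq_of_deterministic (σ := fun n ↦ r (ρ n)) (e := r 1)
      (fun i j hij ↦ ?_) (s := s) (fun n hn ↦ by rw [hs n hn])
    · exact hlt.1 ((hr _ _ (hρ _).le (by simp)).1 this)
    · refine (hr _ _ (hρ _).le (hρ _).le).2 (hlt.2 ?_)
      have hij' := hlt.1 ((hr _ _ (hρ _).le (hρ _).le).1 hij)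
      rw [show ρ (i + 1) - ρ (j + 1) = (ρ (i + 1) - ρ i ^ k) + (ρ i ^ k - ρ j ^ k) -
        (ρ (j + 1) - ρ j ^ k) by ring]
      refine (v.map_sub _ _).trans_lt (max_lt ((v.map_add _ _).trans_lt (max_lt (hstep i) ?_))
        (hstep j))
      exact (v.map_pow_sub_pow_le (hρ i).le (hρ j).le k).trans_lt hij'
  by_contra hne
  have hnever : ∀ t, v (ρ (Nat.card S + t) - 1) < v k ∧ ρ (Nat.card S + t) ≠ 1 := by
    intro t
    induction t with
    | zero => exact ⟨hlast, hne⟩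
    | succ t ih =>
      set n := Nat.card S + t
      have h0 : v (ρ n - 1) ≠ 0 := by
        rw [Ne, v.zero_iff, sub_eq_zero]; exact ih.2
      have hpow := v.map_pow_sub_one ih.1
      have hval : v (ρ (n + 1) - 1) = v k * v (ρ n - 1) := by
        rw [hρl, show ρ n ^ k * l n - 1 = (ρ n ^ k - 1) * l n + (l n - 1) by ring]
        have : v ((ρ n ^ k - 1) * l n) = v k * v (ρ n - 1) := by rw [map_mul, hpow, hl1, mul_one]
        rw [← this]
        refine Valuation.map_add_eq_of_lt_left _ ?_
        rw [this]
        refine (hl n).trans_lt ?_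
        conv_rhs => rw [← one_mul (v k * _)]
        exact mul_lt_mul_of_pos_right hexp (zero_lt_iff.2 (mul_ne_zero hk0 h0))
      change v (ρ (n + 1) - 1) < v k ∧ ρ (n + 1) ≠ 1
      refine ⟨?_, fun h1 ↦ ?_⟩
      · rw [hval]
        exact (mul_le_of_le_one_left' hk1).trans_lt ih.1
      rw [h1, sub_self, map_zero] at hval
      exact mul_ne_zero hk0 h0 hval.symm
  exact (hnever s).2 (hs _ (by omega))

end Contraction

section ContractingFamily

open WithZero IsDedekindDomain TensorProduct
open scoped WithZero

variable {K B D : Type*} [Field K] [CommRing B] [Algebra K B]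

/-- A family of `K`-points of `B` on which `z` is a coordinate that dominates all functions, with a
self-map given by quotients of functions which contracts the coordinate. -/
structure IsContractingFamily (v : Valuation K ℤᵐ⁰) (χ : D → B →ₐ[K] K) (F : D → D) (z : B) :
    Prop where
  sub_le_one : ∀ Q Q', v (χ Q z - χ Q' z) ≤ 1
  lipschitz : ∀ b, ∃ C, ∀ Q Q', v (χ Q b - χ Q' b) ≤ C * v (χ Q z - χ Q' z)
  contract : ∀ Q Q', v (χ (F Q) z - χ (F Q') z) ≤ exp (-1) * v (χ Q z - χ Q' z)
  inj : ∀ Q Q', χ Q z = χ Q' z → Q = Q'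
  pullback : ∀ b, ∃ b' s, ∀ Q, v (χ Q s) = 1 ∧ χ (F Q) b * χ Q s = χ Q b'

namespace IsContractingFamily

variable {v : Valuation K ℤᵐ⁰} {χ : D → B →ₐ[K] K} {F : D → D} {z : B}

section

variable (h : IsContractingFamily v χ F z)
include h

theorem sub_iterate_le (n : ℕ) (Q Q' : D) :
    v (χ (F^[n] Q) z - χ (F^[n] Q') z) ≤ exp (-(n : ℤ)) := by
  induction n with
  | zero => simpa using h.sub_le_one Q Q'
  | succ n ih =>
    rw [Function.iterate_succ_apply', Function.iterate_succ_apply']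
    refine (h.contract _ _).trans ?_
    calc _ ≤ exp (-1) * exp (-(n : ℤ)) := by gcongr
      _ = _ := by rw [← exp_add]; congr 1; push_cast; ring

theorem exists_ne_zero_lipschitz (b : B) :
    ∃ C ≠ 0, ∀ Q Q', v (χ Q b - χ Q' b) ≤ C * v (χ Q z - χ Q' z) := by
  obtain ⟨C, hC⟩ := h.lipschitz b
  refine ⟨max C 1, (lt_max_of_lt_right one_pos).ne', fun Q Q' ↦ (hC Q Q').trans ?_⟩
  gcongr
  exact le_max_left _ _

theorem exists_bound (b : B) : ∃ C ≠ 0, ∀ Q, v (χ Q b) ≤ C := by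
  obtain ⟨C, hC0, hC⟩ := h.exists_ne_zero_lipschitz b
  rcases isEmpty_or_nonempty D with _ | ⟨⟨P⟩⟩
  · exact ⟨1, one_ne_zero, fun Q ↦ isEmptyElim Q⟩
  · refine ⟨max C (v (χ P b)), (lt_max_of_lt_left (zero_lt_iff.2 hC0)).ne', fun Q ↦ ?_⟩
    rw [show χ Q b = (χ Q b - χ P b) + χ P b by ring]
    refine (v.map_add _ _).trans (max_le_max ((hC Q P).trans ?_) le_rfl)
    exact mul_le_of_le_one_right' (h.sub_le_one _ _)

theorem exists_bound_productMap (w : B ⊗[K] B) :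
    ∃ C ≠ 0, ∀ Q Q', v (Algebra.TensorProduct.productMap (χ Q) (χ Q') w) ≤ C := by
  induction w with
  | zero => exact ⟨1, one_ne_zero, by simp⟩
  | tmul a b =>
    obtain ⟨C, hC0, hC⟩ := h.exists_bound a
    obtain ⟨C', hC0', hC'⟩ := h.exists_bound b
    refine ⟨C * C', mul_ne_zero hC0 hC0', fun Q Q' ↦ ?_⟩
    rw [Algebra.TensorProduct.productMap_apply_tmul, map_mul]
    exact mul_le_mul' (hC _) (hC' _)
  | add a b ha hb =>
    obtain ⟨C, hC0, hC⟩ := ha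
    obtain ⟨C', hC0', hC'⟩ := hb
    refine ⟨max C C', (lt_max_of_lt_left (zero_lt_iff.2 hC0)).ne', fun Q Q' ↦ ?_⟩
    rw [map_add]
    exact (v.map_add _ _).trans (max_le_max (hC _ _) (hC' _ _))

theorem exists_productMap_sub_le (w : B ⊗[K] B) :
    ∃ C ≠ 0, ∀ Q Q', v (Algebra.TensorProduct.productMap (χ Q) (χ Q') w -
      χ Q (Algebra.TensorProduct.lmul' K w)) ≤ C * v (χ Q z - χ Q' z) := by
  induction w with
  | zero => exact ⟨1, one_ne_zero, by simp⟩
  | tmul a b =>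
    obtain ⟨C, hC0, hC⟩ := h.exists_bound a
    obtain ⟨C', hC0', hC'⟩ := h.exists_ne_zero_lipschitz b
    refine ⟨C * C', mul_ne_zero hC0 hC0', fun Q Q' ↦ ?_⟩
    rw [Algebra.TensorProduct.productMap_apply_tmul, Algebra.TensorProduct.lmul'_apply_tmul,
      map_mul, ← mul_sub, map_mul, mul_assoc, v.map_sub_swap]
    exact mul_le_mul' (hC _) (hC' _ _)
  | add a b ha hb =>
    obtain ⟨C, hC0, hC⟩ := ha
    obtain ⟨C', hC0', hC'⟩ := hb
    refine ⟨max C C', (lt_max_of_lt_left (zero_lt_iff.2 hC0)).ne', fun Q Q' ↦ ?_⟩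
    rw [map_add, map_add, map_add, add_sub_add_comm]
    refine (v.map_add _ _).trans (max_le ((hC _ _).trans ?_) ((hC' _ _).trans ?_)) <;> gcongr
    exacts [le_max_left _ _, le_max_right _ _]

end

/-- `b` tends to zero along the iterates of `F`. -/
def TendsToZero (v : Valuation K ℤᵐ⁰) (χ : D → B →ₐ[K] K) (F : D → D) (b : B) : Prop :=
  ∀ ε ≠ 0, ∃ N, ∀ n ≥ N, ∀ Q, v (χ (F^[n] Q) b) ≤ ε

theorem tendsToZero_of_exists {b : B}
    (hb : ∀ ε ≠ 0, ∃ N, ∀ Q, v (χ (F^[N] Q) b) ≤ ε) : TendsToZero v χ F b := by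
  intro ε hε
  obtain ⟨N, hN⟩ := hb ε hε
  refine ⟨N, fun n hn Q ↦ ?_⟩
  obtain ⟨m, rfl⟩ := Nat.exists_eq_add_of_le hn
  rw [Function.iterate_add_apply]
  exact hN _

theorem _root_.WithZero.exists_mul_exp_neg_le (C : ℤᵐ⁰) {ε : ℤᵐ⁰} (hε : ε ≠ 0) :
    ∃ n : ℕ, C * exp (-(n : ℤ)) ≤ ε := by
  rcases eq_or_ne C 0 with rfl | hC
  · simp
  · obtain ⟨n, hn⟩ := exists_exp_neg_le (div_ne_zero hε hC)
    exact ⟨n, by rwa [le_div_iff₀ (zero_lt_iff.2 hC), mul_comm] at hn⟩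

variable (h : IsContractingFamily v χ F z)
include h

/-- A function that does not tend to zero along the iterates eventually has constant valuation. -/
theorem exists_valuation_eq {b : B} (hb : ¬ TendsToZero v χ F b) :
    ∃ r ≠ 0, ∃ N, ∀ n ≥ N, ∀ Q, v (χ (F^[n] Q) b) = r := by
  have : ¬ ∀ ε ≠ 0, ∃ N, ∀ Q, v (χ (F^[N] Q) b) ≤ ε := fun hb' ↦ hb (tendsToZero_of_exists hb')
  push Not at this
  obtain ⟨ε, hε, hbε⟩ := this
  obtain ⟨C, hC0, hC⟩ := h.exists_ne_zero_lipschitz b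
  obtain ⟨N, hN⟩ := exists_mul_exp_neg_le C hε
  obtain ⟨Q₀, hQ₀⟩ := hbε N
  refine ⟨_, (zero_le.trans_lt hQ₀).ne', N, fun n hn Q ↦ ?_⟩
  obtain ⟨m, rfl⟩ := Nat.exists_eq_add_of_le hn
  rw [Function.iterate_add_apply]
  refine v.map_eq_of_sub_lt (lt_of_le_of_lt ((hC _ _).trans ?_) hQ₀)
  exact le_trans (by gcongr; exact h.sub_iterate_le N _ _) hN

theorem tendsToZero_mul_left {b : B} (c : B) (hb : TendsToZero v χ F b) :
    TendsToZero v χ F (c * b) := by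
  intro ε hε
  obtain ⟨C, hC0, hC⟩ := h.exists_bound c
  obtain ⟨N, hN⟩ := hb (C⁻¹ * ε) (mul_ne_zero (inv_ne_zero hC0) hε)
  refine ⟨N, fun n hn Q ↦ ?_⟩
  rw [map_mul, map_mul]
  calc _ ≤ C * (C⁻¹ * ε) := mul_le_mul' (hC _) (hN n hn Q)
    _ = ε := by rw [← mul_assoc, mul_inv_cancel₀ hC0, one_mul]

/-- The ideal of functions that tend to zero along the iterates of `F`. -/
def limitIdeal : Ideal B where
  carrier := {b | TendsToZero v χ F b}
  zero_mem' := fun ε _ ↦ ⟨0, by simp⟩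
  add_mem' := by
    intro a b ha hb ε hε
    obtain ⟨N, hN⟩ := ha ε hε
    obtain ⟨N', hN'⟩ := hb ε hε
    refine ⟨max N N', fun n hn Q ↦ ?_⟩
    rw [map_add]
    exact (v.map_add _ _).trans (max_le (hN n (le_of_max_le_left hn) Q)
      (hN' n (le_of_max_le_right hn) Q))
  smul_mem' := fun c b hb ↦ h.tendsToZero_mul_left c hb

theorem isPrime_limitIdeal [Nonempty D] : h.limitIdeal.IsPrime := by
  rw [Ideal.isPrime_iff]
  refine ⟨fun htop ↦ ?_, fun {a b} hab ↦ ?_⟩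
  · have : (1 : B) ∈ h.limitIdeal := by simp [htop]
    obtain ⟨N, hN⟩ := this (exp (-1)) exp_ne_zero
    have := hN N le_rfl (Classical.arbitrary D)
    rw [map_one, map_one, ← exp_zero, exp_le_exp] at this
    omega
  · by_contra! hne
    obtain ⟨r, hr, N, hN⟩ := h.exists_valuation_eq hne.1
    obtain ⟨r', hr', N', hN'⟩ := h.exists_valuation_eq hne.2
    have hrr := mul_ne_zero hr hr'
    obtain ⟨M, hM⟩ := hab (exp (-1) * (r * r')) (mul_ne_zero exp_ne_zero hrr)
    have := hM (max M (max N N')) (le_max_left _ _) (Classical.arbitrary D)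
    rw [map_mul, map_mul, hN _ (by simp), hN' _ (by simp)] at this
    refine absurd this (not_le_of_gt ?_)
    conv_rhs => rw [← one_mul (r * r')]
    refine mul_lt_mul_of_pos_right ?_ (zero_lt_iff.2 hrr)
    rw [← exp_zero, exp_lt_exp]; simp

theorem limitIdeal_ne_bot (hF : ∃ Q, F Q ≠ Q) : h.limitIdeal ≠ ⊥ := by
  obtain ⟨P, hP⟩ := hF
  obtain ⟨b', s, hs⟩ := h.pullback z
  intro hbot
  have hmem : b' - s * z ∈ h.limitIdeal := by
    refine tendsToZero_of_exists fun ε hε ↦ ?_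
    obtain ⟨N, hN⟩ := exists_exp_neg_le hε
    refine ⟨N, fun Q ↦ ?_⟩
    rw [map_sub, map_mul, ← (hs _).2, mul_comm, ← mul_sub, map_mul, (hs _).1, one_mul,
      ← Function.iterate_succ_apply' F, Function.iterate_succ_apply]
    exact (h.sub_iterate_le N _ _).trans hN
  rw [hbot, Ideal.mem_bot, sub_eq_zero] at hmem
  apply hP
  apply h.inj
  have h1 := (hs P).2
  rw [hmem, map_mul, mul_comm] at h1
  refine mul_left_cancel₀ (fun h0 ↦ ?_) h1
  have := (hs P).1
  rw [h0, map_zero] at this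
  exact zero_ne_one this

/-- A local generator of the limit ideal is a coordinate close to the limit. -/
theorem exists_sub_le_of_isLocalGenerator [CharZero K] [Algebra.FiniteType K B]
    (hmax : h.limitIdeal.IsMaximal) {ϖ : B} (hϖ : IsLocalGenerator h.limitIdeal ϖ) :
    ∃ C ≠ 0, ∃ N, ∀ n ≥ N, ∀ Q Q', v (χ (F^[n] Q) z - χ (F^[n] Q') z) ≤
      C * v (χ (F^[n] Q) ϖ - χ (F^[n] Q') ϖ) := by
  obtain ⟨u, hu, hw⟩ := hϖ.exists_lmul'_notMem K
  obtain ⟨w, hw⟩ := hw z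
  obtain ⟨r, hr, N₁, hN₁⟩ := h.exists_valuation_eq hu
  obtain ⟨C₁, hC₁, hu₁⟩ := h.exists_productMap_sub_le u
  obtain ⟨C₂, hC₂, hw₂⟩ := h.exists_bound_productMap w
  obtain ⟨N₂, hN₂⟩ := exists_mul_exp_neg_le C₁ (mul_ne_zero (exp_ne_zero (a := (-1 : ℤ))) hr)
  refine ⟨r⁻¹ * C₂, mul_ne_zero (inv_ne_zero hr) hC₂, max N₁ N₂, fun n hn Q Q' ↦ ?_⟩
  set P := F^[n] Q
  set P' := F^[n] Q'
  have hval : v (Algebra.TensorProduct.productMap (χ P) (χ P') u) = r := by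
    have h1 := hN₁ n (le_of_max_le_left hn) Q
    rw [← h1]
    refine v.map_eq_of_sub_lt ?_
    rw [h1]
    refine (hu₁ P P').trans_lt ?_
    have h2 : v (χ P z - χ P' z) ≤ exp (-(N₂ : ℤ)) := (h.sub_iterate_le n Q Q').trans <| by
      rw [exp_le_exp]; have := le_of_max_le_right hn; omega
    refine (mul_le_mul_right h2 C₁).trans_lt (hN₂.trans_lt ?_)
    conv_rhs => rw [← one_mul r]
    refine mul_lt_mul_of_pos_right ?_ (zero_lt_iff.2 hr)
    rw [← exp_zero, exp_lt_exp]; simp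
  have heq := congrArg (fun x ↦ v (Algebra.TensorProduct.productMap (χ P) (χ P') x)) hw
  simp only [map_mul, map_sub, Algebra.TensorProduct.productMap_apply_tmul, map_one, one_mul,
    mul_one, hval] at heq
  rw [v.map_sub_swap (χ P z), v.map_sub_swap (χ P ϖ), mul_assoc, le_inv_mul_iff₀
    (zero_lt_iff.2 hr), heq]
  gcongr
  exact hw₂ _ _

/-- If the pulled back local generator is, up to units, a power of the local generator, then two
points with the same image under some iterate have the same image under a fixed one. -/
theorem exists_iterate_eq_of_pow [CharZero K] (hv : HasFiniteQuotients v)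
    {ϖ b g : B} {k : ℕ} (hk : k ≠ 0) (hϖ : TendsToZero v χ F ϖ) (hb : ¬ TendsToZero v χ F b)
    (hg : ¬ TendsToZero v χ F g)
    (hpow : ∀ Q, χ (F Q) ϖ * χ Q g = χ Q b * χ Q ϖ ^ k)
    (hsub : ∃ C ≠ 0, ∃ N, ∀ n ≥ N, ∀ Q Q', v (χ (F^[n] Q) z - χ (F^[n] Q') z) ≤
      C * v (χ (F^[n] Q) ϖ - χ (F^[n] Q') ϖ)) :
    ∃ N, ∀ Q Q', (∃ s, F^[s] Q = F^[s] Q') → F^[N] Q = F^[N] Q' := by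
  obtain ⟨C, hC0, N₀, hC⟩ := hsub
  obtain ⟨c, hc⟩ := hv.exists_forall_eq_one hk
  obtain ⟨rb, hrb, N₁, hN₁⟩ := h.exists_valuation_eq hb
  obtain ⟨rg, hrg, N₂, hN₂⟩ := h.exists_valuation_eq hg
  obtain ⟨Cb, hCb, hb'⟩ := h.exists_ne_zero_lipschitz b
  obtain ⟨Cg, hCg, hg'⟩ := h.exists_ne_zero_lipschitz g
  have hk0 : v k ≠ 0 := by simpa using hk
  set E : ℤᵐ⁰ := (rb * rg)⁻¹ * max (Cb * rg) (rb * Cg) * C with hE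
  have hE0 : E ≠ 0 := mul_ne_zero (mul_ne_zero (inv_ne_zero (mul_ne_zero hrb hrg))
    (lt_max_of_lt_left (zero_lt_iff.2 (mul_ne_zero hCb hrg))).ne') hC0
  obtain ⟨N₃, hN₃⟩ := hϖ (E⁻¹ * (exp (-1) * v k))
    (mul_ne_zero (inv_ne_zero hE0) (mul_ne_zero exp_ne_zero hk0))
  set N := max (max N₀ N₁) (max N₂ N₃)
  have hinj : ∀ n ≥ N, ∀ Q Q', χ (F^[n] Q) ϖ = χ (F^[n] Q') ϖ → F^[n] Q = F^[n] Q' := by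
    intro n hn Q Q' heq
    refine h.inj _ _ (sub_eq_zero.1 (v.zero_iff.1 (le_zero_iff.1 ?_)))
    simpa [heq] using hC n (by omega) Q Q'
  have hne : ∀ {r : ℤᵐ⁰} {a : K}, r ≠ 0 → v a = r → a ≠ 0 := by
    rintro r a hr hva rfl
    exact hr (by rw [← hva, map_zero])
  refine ⟨N + c, fun Q Q' ⟨s, hs⟩ ↦ ?_⟩
  have hs' : ∀ n ≥ s, F^[n] Q = F^[n] Q' := by
    intro n hn
    obtain ⟨m, rfl⟩ := Nat.exists_eq_add_of_le hn
    rw [add_comm, Function.iterate_add_apply, hs, ← Function.iterate_add_apply]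
  set x : ℕ → K := fun n ↦ χ (F^[N + n] Q) ϖ with hx
  set y : ℕ → K := fun n ↦ χ (F^[N + n] Q') ϖ with hy
  have hbP : ∀ n P, v (χ (F^[N + n] P) b) = rb := fun n P ↦ hN₁ _ (by omega) P
  have hgP : ∀ n P, v (χ (F^[N + n] P) g) = rg := fun n P ↦ hN₂ _ (by omega) P
  have hrec : ∀ n P, χ (F^[N + (n + 1)] P) ϖ * χ (F^[N + n] P) g =
      χ (F^[N + n] P) b * χ (F^[N + n] P) ϖ ^ k := by
    intro n P
    rw [← add_assoc, Function.iterate_succ_apply']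
    exact hpow _
  have hzero : ∀ n P, χ (F^[N + (n + 1)] P) ϖ = 0 ↔ χ (F^[N + n] P) ϖ = 0 := by
    intro n P
    have h1 := hrec n P
    constructor
    · intro h0
      rw [h0, zero_mul] at h1
      exact eq_zero_of_pow_eq_zero ((mul_eq_zero.1 h1.symm).resolve_left (hne hrb (hbP n P)))
    · intro h0
      rw [h0, zero_pow hk, mul_zero] at h1
      exact (mul_eq_zero.1 h1).resolve_right (hne hrg (hgP n P))
  have hzero' : ∀ n P, χ (F^[N + n] P) ϖ = 0 ↔ χ (F^[N] P) ϖ = 0 := by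
    intro n P
    induction n with
    | zero => rfl
    | succ n ih => rw [hzero, ih]
  have hxs : ∀ n ≥ s, x n = y n := fun n hn ↦ by
    simp only [hx, hy, hs' (N + n) (by omega)]
  refine hinj _ (by omega) _ _ ?_
  by_cases hx0 : χ (F^[N] Q) ϖ = 0
  · have hy0 : χ (F^[N] Q') ϖ = 0 := by
      rw [← hzero' s, ← show χ (F^[N + s] Q) ϖ = χ (F^[N + s] Q') ϖ from hxs s le_rfl]
      exact (hzero' s Q).2 hx0
    rw [(hzero' c Q).2 hx0, (hzero' c Q').2 hy0]
  have hy0 : χ (F^[N] Q') ϖ ≠ 0 := by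
    intro hy0
    apply hx0
    rw [← hzero' s, show χ (F^[N + s] Q) ϖ = χ (F^[N + s] Q') ϖ from hxs s le_rfl]
    exact (hzero' s Q').2 hy0
  have hxn : ∀ n, x n ≠ 0 := fun n h0 ↦ hx0 ((hzero' n Q).1 h0)
  have hyn : ∀ n, y n ≠ 0 := fun n h0 ↦ hy0 ((hzero' n Q').1 h0)
  set bx : ℕ → K := fun n ↦ χ (F^[N + n] Q) b
  set by' : ℕ → K := fun n ↦ χ (F^[N + n] Q') b
  set gx : ℕ → K := fun n ↦ χ (F^[N + n] Q) g
  set gy : ℕ → K := fun n ↦ χ (F^[N + n] Q') g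
  have hbx : ∀ n, v (bx n) = rb := fun n ↦ hbP n Q
  have hby : ∀ n, v (by' n) = rb := fun n ↦ hbP n Q'
  have hgx : ∀ n, v (gx n) = rg := fun n ↦ hgP n Q
  have hgy : ∀ n, v (gy n) = rg := fun n ↦ hgP n Q'
  have hbx0 := fun n ↦ hne hrb (hbx n)
  have hby0 := fun n ↦ hne hrb (hby n)
  have hgx0 := fun n ↦ hne hrg (hgx n)
  have hgy0 := fun n ↦ hne hrg (hgy n)
  set ρ : ℕ → K := fun n ↦ y n / x n with hρ
  set l : ℕ → K := fun n ↦ by' n * gx n / (bx n * gy n) with hl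
  have hρs : ∀ n ≥ s, ρ n = 1 := fun n hn ↦ by
    simp only [hρ, hxs n hn]; exact div_self (hyn n)
  have hρl : ∀ n, ρ (n + 1) = ρ n ^ k * l n := by
    intro n
    have h1 : x (n + 1) = bx n * x n ^ k / gx n := eq_div_of_mul_eq (hgx0 n) (hrec n Q)
    have h2 : y (n + 1) = by' n * y n ^ k / gy n := eq_div_of_mul_eq (hgy0 n) (hrec n Q')
    have := hxn n
    have := hgx0 n
    have := hgy0 n
    have := hbx0 n
    simp only [hρ, hl, h1, h2, div_pow]
    field_simp
  have hl1 : ∀ n, v (l n) = 1 := by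
    intro n
    simp only [hl, map_div₀, map_mul, hbx, hby, hgx, hgy]
    exact div_self (mul_ne_zero hrb hrg)
  have hρ1 : ∀ n, v (ρ n) = 1 := by
    have hback : ∀ n, v (ρ (n + 1)) = 1 → v (ρ n) = 1 := by
      intro n hn
      rw [hρl, map_mul, map_pow, hl1, mul_one] at hn
      exact (pow_eq_one_iff_of_nonneg zero_le hk).1 hn
    intro n
    have hds : ∀ d, v (ρ (s + n - d)) = 1 := by
      intro d
      induction d with
      | zero => rw [Nat.sub_zero, hρs _ (by omega), map_one]
      | succ d ih =>
        rcases Nat.lt_or_ge d (s + n) with hd | hd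
        · refine hback _ ?_
          rwa [show s + n - (d + 1) + 1 = s + n - d by omega]
        · rwa [show s + n - (d + 1) = s + n - d by omega]
    simpa using hds s
  have hbound : ∀ n, v (l n - 1) ≤ exp (-1) * (v k * v (ρ n - 1)) := by
    intro n
    have hdz := hC (N + n) (by omega) Q Q'
    have hl' : l n - 1 = ((by' n - bx n) * gx n + bx n * (gx n - gy n)) / (bx n * gy n) := by
      have := hbx0 n
      have := hgy0 n
      simp only [hl]
      field_simp
      ring
    have hxy : v (x n - y n) = v (x n) * v (ρ n - 1) := by
      rw [v.map_sub_swap, ← map_mul]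
      congr 1
      have := hxn n
      simp only [hρ]
      field_simp
    have hxsmall : E * v (x n) ≤ exp (-1) * v k := by
      have := hN₃ (N + n) (by omega) Q
      rwa [le_inv_mul_iff₀ (zero_lt_iff.2 hE0)] at this
    set δ := v (χ (F^[N + n] Q) z - χ (F^[N + n] Q') z)
    have hnum : v ((by' n - bx n) * gx n + bx n * (gx n - gy n)) ≤ max (Cb * rg) (rb * Cg) * δ := by
      refine (v.map_add _ _).trans (max_le ?_ ?_)
      · rw [map_mul, hgx, v.map_sub_swap]
        calc _ ≤ (Cb * δ) * rg := by gcongr; exact hb' _ _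
          _ = (Cb * rg) * δ := by ac_rfl
          _ ≤ _ := mul_le_mul_left (le_max_left _ _) _
      · rw [map_mul, hbx]
        calc _ ≤ rb * (Cg * δ) := by gcongr; exact hg' _ _
          _ = (rb * Cg) * δ := by ac_rfl
          _ ≤ _ := mul_le_mul_left (le_max_right _ _) _
    rw [hl', map_div₀, map_mul v (bx n), hbx, hgy, div_eq_inv_mul]
    calc _ ≤ (rb * rg)⁻¹ * (max (Cb * rg) (rb * Cg) * (C * v (x n - y n))) := by
            gcongr
            exact hnum.trans (mul_le_mul_right hdz _)
      _ = (E * v (x n)) * v (ρ n - 1) := by rw [hxy, hE]; ac_rfl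
      _ ≤ (exp (-1) * v k) * v (ρ n - 1) := by gcongr
      _ = _ := mul_assoc _ _ _
  have := hc ρ l hρ1 hρl hbound ⟨s, hρs⟩
  exact ((div_eq_one_iff_eq (hxn c)).1 this).symm

theorem exists_iterate_eq [CharZero K] [IsDedekindDomain B] [Algebra.FiniteType K B]
    (hv : HasFiniteQuotients v) :
    ∃ N, ∀ Q Q', (∃ s, F^[s] Q = F^[s] Q') → F^[N] Q = F^[N] Q' := by
  by_cases hF : ∀ Q, F Q = Q
  · refine ⟨0, fun Q Q' ⟨s, hs⟩ ↦ ?_⟩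
    rwa [Function.iterate_fixed (hF Q), Function.iterate_fixed (hF Q')] at hs
  push Not at hF
  have : Nonempty D := hF.nonempty
  have hp := h.isPrime_limitIdeal
  let p : HeightOneSpectrum B := ⟨h.limitIdeal, hp, h.limitIdeal_ne_bot hF⟩
  obtain ⟨ϖ, hϖ, -, hpow⟩ := p.exists_isLocalGenerator
  have hsub := h.exists_sub_le_of_isLocalGenerator p.isMaximal hϖ
  obtain ⟨b', s, hs⟩ := h.pullback ϖ
  have hϖ0 : TendsToZero v χ F ϖ := hϖ.1
  by_cases hb'0 : b' = 0
  · obtain ⟨C, -, N, hN⟩ := hsub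
    refine ⟨N + 1, fun Q Q' _ ↦ h.inj _ _ (sub_eq_zero.1 (v.zero_iff.1 (le_zero_iff.1 ?_)))⟩
    have hz : ∀ P, χ (F^[N + 1] P) ϖ = 0 := by
      intro P
      rw [Function.iterate_succ_apply']
      have h1 := (hs (F^[N] P)).2
      rw [hb'0, map_zero] at h1
      refine (mul_eq_zero.1 h1).resolve_right fun h0 ↦ ?_
      have := (hs (F^[N] P)).1
      rw [h0, map_zero] at this
      exact zero_ne_one this
    have := hN (N + 1) (by omega) Q Q'
    rwa [hz, hz, sub_zero, map_zero, mul_zero] at this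
  · obtain ⟨k, s₁, hs₁, b₁, hb₁, hk⟩ := hpow b' hb'0
    have hs0 : s ∉ p.asIdeal := by
      intro hs'
      obtain ⟨N, hN⟩ := (show TendsToZero v χ F s from hs') (exp (-1)) exp_ne_zero
      have := hN N le_rfl (Classical.arbitrary D)
      rw [(hs _).1, ← exp_zero, exp_le_exp] at this
      omega
    have hb' : b' ∈ p.asIdeal := by
      refine tendsToZero_of_exists fun ε hε ↦ ?_
      obtain ⟨N, hN⟩ := hϖ0 ε hε
      refine ⟨N, fun Q ↦ ?_⟩
      rw [← (hs _).2, map_mul, (hs _).1, mul_one, ← Function.iterate_succ_apply' F]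
      exact hN _ (by omega) Q
    have hk0 : k ≠ 0 := by
      rintro rfl
      rw [pow_zero, mul_one] at hk
      exact hb₁ (hk ▸ p.asIdeal.mul_mem_right _ hb')
    refine h.exists_iterate_eq_of_pow hv (b := b₁) (g := s * s₁) hk0 hϖ0 hb₁
      (fun hg ↦ (p.isPrime.mem_or_mem (show s * s₁ ∈ p.asIdeal from hg)).elim hs0 hs₁)
      (fun Q ↦ ?_) hsub
    have := congrArg (χ Q) hk
    simp only [map_mul, map_pow] at this ⊢
    rw [← this, ← (hs Q).2, mul_assoc]

end IsContractingFamily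

end ContractingFamily

section RatPlaces

/-- A rational place of a field extension `L / K`: a valuation ring of `L` containing `K` with
residue field `K`. -/
@[ext]
structure RatPlace (K L : Type*) [Field K] [Field L] [Algebra K L] where
  /-- the valuation ring of a rational place -/
  ring : ValuationSubring L
  algebraMap_mem : ∀ k : K, algebraMap K L k ∈ ring
  exists_sub_mem : ∀ a ∈ ring, ∃ k : K, a - algebraMap K L k ∈ ring.nonunits

namespace RatPlace

variable {K L : Type*} [Field K] [Field L] [Algebra K L] (P : RatPlace K L)

open Classical in
/-- The value of a function at a rational place, with value zero at poles. -/
def ev (a : L) : K := if h : a ∈ P.ring then (P.exists_sub_mem a h).choose else 0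

variable {P} {a b : L}

theorem sub_ev_mem (ha : a ∈ P.ring) : a - algebraMap K L (P.ev a) ∈ P.ring.nonunits := by
  rw [ev, dif_pos ha]
  exact (P.exists_sub_mem a ha).choose_spec

theorem eq_zero_of_algebraMap_mem_nonunits {k : K} (hk : algebraMap K L k ∈ P.ring.nonunits) :
    k = 0 := by
  by_contra h
  rw [ValuationSubring.mem_nonunits_iff_or] at hk
  rcases hk with hk | hk
  · exact h (by simpa using hk)
  · exact hk (by rw [← map_inv₀]; exact P.algebraMap_mem _)

theorem mem_ring_of_mem_nonunits (ha : a ∈ P.ring.nonunits) : a ∈ P.ring :=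
  P.ring.nonunits_le ha

theorem mul_mem_nonunits (ha : a ∈ P.ring) (hb : b ∈ P.ring.nonunits) :
    a * b ∈ P.ring.nonunits := by
  rw [ValuationSubring.mem_nonunits_iff] at hb ⊢
  rw [map_mul]
  exact mul_lt_one_of_nonneg_of_lt_one_right ((P.ring.valuation_le_one_iff a).2 ha) zero_le hb

theorem ev_eq_of_sub_mem {k : K} (h : a - algebraMap K L k ∈ P.ring.nonunits) : P.ev a = k := by
  have ha : a ∈ P.ring := by
    simpa using add_mem (mem_ring_of_mem_nonunits h) (P.algebraMap_mem k)
  rw [← sub_eq_zero]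
  refine eq_zero_of_algebraMap_mem_nonunits (P := P) ?_
  rw [map_sub]
  simpa using sub_mem h (sub_ev_mem ha)

@[simp]
theorem ev_algebraMap (k : K) : P.ev (algebraMap K L k) = k :=
  ev_eq_of_sub_mem (by simp)

theorem ev_add (ha : a ∈ P.ring) (hb : b ∈ P.ring) : P.ev (a + b) = P.ev a + P.ev b := by
  refine ev_eq_of_sub_mem ?_
  rw [map_add, add_sub_add_comm]
  exact add_mem (sub_ev_mem ha) (sub_ev_mem hb)

theorem ev_mul (ha : a ∈ P.ring) (hb : b ∈ P.ring) : P.ev (a * b) = P.ev a * P.ev b := by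
  refine ev_eq_of_sub_mem ?_
  rw [map_mul, show a * b - algebraMap K L (P.ev a) * algebraMap K L (P.ev b) =
    a * (b - algebraMap K L (P.ev b)) + algebraMap K L (P.ev b) * (a - algebraMap K L (P.ev a)) by
      ring]
  exact add_mem (mul_mem_nonunits ha (sub_ev_mem hb))
    (mul_mem_nonunits (P.algebraMap_mem _) (sub_ev_mem ha))

theorem ev_neg (ha : a ∈ P.ring) : P.ev (-a) = -P.ev a := by
  refine ev_eq_of_sub_mem ?_
  rw [map_neg, ← neg_sub', neg_mem_iff]
  exact sub_ev_mem ha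

@[simp]
theorem ev_one : P.ev 1 = 1 := by simpa using P.ev_algebraMap (K := K) (1 : K)

@[simp]
theorem ev_zero : P.ev 0 = 0 := by simpa using P.ev_algebraMap (K := K) (0 : K)

theorem ev_eq_zero_iff (ha : a ∈ P.ring) : P.ev a = 0 ↔ a ∈ P.ring.nonunits := by
  refine ⟨fun h ↦ ?_, fun h ↦ ev_eq_of_sub_mem (by simpa using h)⟩
  simpa [h] using sub_ev_mem ha

theorem inv_mem (h : P.ev a ≠ 0) : a⁻¹ ∈ P.ring := by
  by_contra hinv
  have ha : a ∈ P.ring := (P.ring.mem_or_inv_mem a).resolve_right hinv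
  exact h ((ev_eq_zero_iff ha).2 (P.ring.mem_nonunits_iff_or.2 (Or.inr hinv)))

theorem mem_of_mul_mem {s : L} (hs : P.ev s ≠ 0) (h : a * s ∈ P.ring) : a ∈ P.ring := by
  have hs0 : s ≠ 0 := by rintro rfl; simp at hs
  simpa [mul_assoc, hs0] using mul_mem h (inv_mem hs)

theorem ev_ne_zero_mem (h : P.ev a ≠ 0) : a ∈ P.ring := by
  by_contra ha
  exact h (by rw [ev, dif_neg ha])

theorem ev_inv (h : P.ev a ≠ 0) : P.ev a⁻¹ = (P.ev a)⁻¹ := by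
  have ha0 : a ≠ 0 := by rintro rfl; simp at h
  refine eq_inv_of_mul_eq_one_left ?_
  rw [← ev_mul (inv_mem h) (ev_ne_zero_mem h), inv_mul_cancel₀ ha0,
    ev_one]

variable (P) in
/-- The `K`-point of an affine chart on which all functions are regular at the place. -/
def evAlgHom (B : Subalgebra K L) (hB : ∀ b ∈ B, b ∈ P.ring) : B →ₐ[K] K where
  toFun b := P.ev b
  map_one' := ev_one
  map_mul' a b := ev_mul (hB _ a.2) (hB _ b.2)
  map_zero' := ev_zero
  map_add' a b := ev_add (hB _ a.2) (hB _ b.2)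
  commutes' k := ev_algebraMap k

@[simp]
theorem evAlgHom_apply {B : Subalgebra K L} (hB : ∀ b ∈ B, b ∈ P.ring) (b : B) :
    P.evAlgHom B hB b = P.ev b := rfl

theorem mem_comap_nonunits {A : ValuationSubring L} (φ : L →+* L) :
    a ∈ (A.comap φ).nonunits ↔ φ a ∈ A.nonunits := by
  simp [ValuationSubring.mem_nonunits_iff_or, ValuationSubring.mem_comap]

/-- The image of a rational place under the map of curves dual to `φ`. -/
def comap (φ : L →ₐ[K] L) (P : RatPlace K L) : RatPlace K L where
  ring := P.ring.comap φ
  algebraMap_mem k := by simpa [ValuationSubring.mem_comap] using P.algebraMap_mem k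
  exists_sub_mem a ha := by
    obtain ⟨k, hk⟩ := P.exists_sub_mem (φ a) ha
    exact ⟨k, by rw [mem_comap_nonunits]; simpa using hk⟩

theorem mem_comap_ring {φ : L →ₐ[K] L} : a ∈ (P.comap φ).ring ↔ φ a ∈ P.ring := Iff.rfl

theorem ev_comap {φ : L →ₐ[K] L} : (P.comap φ).ev a = P.ev (φ a) := by
  by_cases ha : φ a ∈ P.ring
  · refine ev_eq_of_sub_mem ?_
    rw [comap, mem_comap_nonunits]
    simpa using sub_ev_mem ha
  · rw [ev, ev, dif_neg ha, dif_neg (by rwa [mem_comap_ring])]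

theorem ext_of_le {P Q : RatPlace K L} (h : P.ring ≤ Q.ring) : P = Q := by
  refine RatPlace.ext (le_antisymm h fun a ha ↦ ?_)
  have := ValuationSubring.nonunits_le_nonunits.2 h (sub_ev_mem ha)
  simpa using add_mem (mem_ring_of_mem_nonunits this) (P.algebraMap_mem (Q.ev a))

/-- A place is determined by the values of the functions on a Dedekind chart. -/
theorem ext_of_isDedekindDomain {P Q : RatPlace K L} (B : Subalgebra K L) [IsDedekindDomain B]
    [IsFractionRing B L] (hP : ∀ b ∈ B, b ∈ P.ring) (hQ : ∀ b ∈ B, b ∈ Q.ring)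
    (h : ∀ b ∈ B, P.ev b = Q.ev b) : P = Q := by
  have hdiv : ∀ (a : L) (n d : B), P.ev d ≠ 0 → a * d = n → a ∈ Q.ring := by
    intro a n d hd had
    exact mem_of_mul_mem (s := d) (by rwa [← h _ d.2]) (had ▸ hQ _ n.2)
  refine ext_of_le fun a ha ↦ ?_
  let I : Ideal B := RingHom.ker (P.evAlgHom B hP)
  have hI : I.IsPrime := RingHom.ker_isPrime _
  by_cases hI0 : I = ⊥
  · obtain ⟨n, d, hd, rfl⟩ := IsFractionRing.div_surjective (A := B) a
    have hd0 : d ≠ 0 := nonZeroDivisors.ne_zero hd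
    have hdL : (d : L) ≠ 0 := by simpa using hd0
    refine hdiv _ n d (fun h0 ↦ hd0 ?_) (div_mul_cancel₀ _ hdL)
    have : d ∈ I := h0
    rwa [hI0] at this
  · let p : IsDedekindDomain.HeightOneSpectrum B := ⟨I, hI, hI0⟩
    obtain ⟨n, d, h1 | h1⟩ := p.exists_primeCompl_mul_eq_or_mul_eq a
    · exact hdiv _ n d d.2 h1
    · refine hdiv _ d n (fun h0 ↦ d.2 ?_) h1
      have : P.ev (a * n) = P.ev (d : B) := congrArg P.ev h1
      rw [ev_mul ha (hP _ n.2), h0, mul_zero] at this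
      exact this.symm

end RatPlace

end RatPlaces

section GoodReduction

open WithZero IsDedekindDomain
open scoped WithZero

theorem Valuation.map_eq_one_of_sub_lt {K : Type*} [Field K] {v : Valuation K ℤᵐ⁰} {a b : K}
    (ha : v a = 1) (h : v (a - b) < 1) : v b = 1 := by
  rw [show b = a - (a - b) by ring, ← ha]
  exact v.map_sub_eq_of_lt_left (ha ▸ h)

theorem Valuation.map_mul_sub_mul_lt_one {K : Type*} [Field K] {v : Valuation K ℤᵐ⁰}
    {a a' b b' : K} (ha : v a ≤ 1) (hb : v b' ≤ 1) (haa : v (a - a') < 1) (hbb : v (b - b') < 1) :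
    v (a * b - a' * b') < 1 := by
  rw [show a * b - a' * b' = a * (b - b') + (a - a') * b' by ring]
  refine v.map_add_lt ?_ ?_
  · rw [map_mul]
    exact (mul_le_of_le_one_left' ha).trans_lt hbb
  · rw [map_mul]
    exact (mul_le_of_le_one_right' hb).trans_lt haa

namespace RatPlace

variable {K L : Type*} [Field K] [Field L] [Algebra K L] {P Q R : RatPlace K L}
  {v : Valuation K ℤᵐ⁰} {G : Set L}

variable (v G) in
/-- The algebra generated by `G` over the valuation ring of `v`. -/
def integralRing : Subring L :=
  Subring.closure (algebraMap K L '' {r | v r ≤ 1} ∪ G)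

variable (v G P) in
/-- The functions in `G` have no poles at `P` and their values are `v`-integral. -/
def IsIntegralAt : Prop := ∀ g ∈ G, g ∈ P.ring ∧ v (P.ev g) ≤ 1

variable (v G P) in
/-- The functions on the model with chart `G` which are regular at the reduction of `P`. -/
def localRing : Subring L where
  carrier := {a | ∃ s ∈ integralRing v G, v (P.ev s) = 1 ∧ s * a ∈ integralRing v G}
  one_mem' := ⟨1, one_mem _, by simp, by simp⟩
  zero_mem' := ⟨1, one_mem _, by simp, by simp⟩
  mul_mem' := by
    rintro a b ⟨s, hs, hs1, hsa⟩ ⟨t, ht, ht1, htb⟩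
    refine ⟨s * t, mul_mem hs ht, ?_, ?_⟩
    · rw [ev_mul (ev_ne_zero_mem _) (ev_ne_zero_mem _), map_mul, hs1, ht1, mul_one] <;>
      · intro h; simp_all
    · rw [mul_mul_mul_comm]
      exact mul_mem hsa htb
  add_mem' := by
    rintro a b ⟨s, hs, hs1, hsa⟩ ⟨t, ht, ht1, htb⟩
    refine ⟨s * t, mul_mem hs ht, ?_, ?_⟩
    · rw [ev_mul (ev_ne_zero_mem _) (ev_ne_zero_mem _), map_mul, hs1, ht1, mul_one] <;>
      · intro h; simp_all
    · rw [show s * t * (a + b) = t * (s * a) + s * (t * b) by ring]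
      exact add_mem (mul_mem ht hsa) (mul_mem hs htb)
  neg_mem' := by
    rintro a ⟨s, hs, hs1, hsa⟩
    exact ⟨s, hs, hs1, by rw [mul_neg]; exact neg_mem hsa⟩

theorem ne_zero_of_map_ev_eq_one {s : L} (hs : v (P.ev s) = 1) : P.ev s ≠ 0 := by
  intro h; simp [h] at hs

theorem map_ev_mul_eq_one {s t : L} (hs : v (P.ev s) = 1) (ht : v (P.ev t) = 1) :
    v (P.ev (s * t)) = 1 := by
  rw [ev_mul (ev_ne_zero_mem (ne_zero_of_map_ev_eq_one hs))
    (ev_ne_zero_mem (ne_zero_of_map_ev_eq_one ht)), map_mul, hs, ht, mul_one]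

theorem subset_integralRing : G ⊆ integralRing v G := fun _ hg ↦
  Subring.subset_closure (Or.inr hg)

theorem algebraMap_mem_integralRing {r : K} (hr : v r ≤ 1) :
    algebraMap K L r ∈ integralRing v G :=
  Subring.subset_closure (Or.inl ⟨r, hr, rfl⟩)

theorem integralRing_le {S : Subring L} (h : ∀ r, v r ≤ 1 → algebraMap K L r ∈ S) (hG : G ⊆ S) :
    integralRing v G ≤ S := by
  rw [integralRing, Subring.closure_le, Set.union_subset_iff]
  exact ⟨by rintro _ ⟨r, hr, rfl⟩; exact h r hr, hG⟩

theorem integralRing_le_localRing : integralRing v G ≤ P.localRing v G := fun a ha ↦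
  ⟨1, one_mem _, by simp, by simpa⟩

theorem integralRing_le_adjoin {a : L} (ha : a ∈ integralRing v G) : a ∈ Algebra.adjoin K G :=
  integralRing_le (S := (Algebra.adjoin K G).toSubring) (fun r _ ↦ Subalgebra.algebraMap_mem _ r)
    Algebra.subset_adjoin ha

theorem exists_algebraMap_mul_mem {a : L} (ha : a ∈ Algebra.adjoin K G) :
    ∃ c ≠ 0, v c ≤ 1 ∧ algebraMap K L c * a ∈ integralRing v G := by
  induction ha using Algebra.adjoin_induction with
  | mem x hx => exact ⟨1, one_ne_zero, by simp, by simpa using subset_integralRing hx⟩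
  | algebraMap r =>
    rcases le_total (v r) 1 with h | h
    · exact ⟨1, one_ne_zero, by simp, by simpa using algebraMap_mem_integralRing h⟩
    · have hr : r ≠ 0 := by rintro rfl; simp at h
      refine ⟨r⁻¹, inv_ne_zero hr, ?_, ?_⟩
      · rw [map_inv₀]; exact inv_le_one_of_one_le₀ h
      · rw [← map_mul, inv_mul_cancel₀ hr, map_one]; exact one_mem _
  | add x y _ _ hx hy =>
    obtain ⟨c, hc0, hc, hcx⟩ := hx
    obtain ⟨d, hd0, hd, hdy⟩ := hy
    refine ⟨c * d, mul_ne_zero hc0 hd0, by rw [map_mul]; exact mul_le_one' hc hd, ?_⟩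
    rw [map_mul, show algebraMap K L c * algebraMap K L d * (x + y) = algebraMap K L d *
      (algebraMap K L c * x) + algebraMap K L c * (algebraMap K L d * y) by ring]
    exact add_mem (mul_mem (algebraMap_mem_integralRing hd) hcx)
      (mul_mem (algebraMap_mem_integralRing hc) hdy)
  | mul x y _ _ hx hy =>
    obtain ⟨c, hc0, hc, hcx⟩ := hx
    obtain ⟨d, hd0, hd, hdy⟩ := hy
    refine ⟨c * d, mul_ne_zero hc0 hd0, by rw [map_mul]; exact mul_le_one' hc hd, ?_⟩
    rw [map_mul, mul_mul_mul_comm]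
    exact mul_mem hcx hdy

theorem IsIntegralAt.integralRing_le (h : P.IsIntegralAt v G) {a : L}
    (ha : a ∈ integralRing v G) : a ∈ P.ring ∧ v (P.ev a) ≤ 1 := by
  let S : Subring L :=
    { carrier := {a | a ∈ P.ring ∧ v (P.ev a) ≤ 1}
      one_mem' := ⟨one_mem _, by simp⟩
      zero_mem' := ⟨zero_mem _, by simp⟩
      mul_mem' := fun ⟨ha, ha'⟩ ⟨hb, hb'⟩ ↦
        ⟨mul_mem ha hb, by rw [ev_mul ha hb, map_mul]; exact mul_le_one' ha' hb'⟩
      add_mem' := fun ⟨ha, ha'⟩ ⟨hb, hb'⟩ ↦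
        ⟨add_mem ha hb, by rw [ev_add ha hb]; exact v.map_add_le ha' hb'⟩
      neg_mem' := fun ⟨ha, ha'⟩ ↦ ⟨neg_mem ha, by rwa [ev_neg ha, v.map_neg]⟩ }
  exact RatPlace.integralRing_le (S := S) (fun r hr ↦ ⟨P.algebraMap_mem r, by simpa using hr⟩) h ha

theorem IsIntegralAt.mem_ring (h : P.IsIntegralAt v G) {a : L}
    (ha : a ∈ Algebra.adjoin K G) : a ∈ P.ring := by
  induction ha using Algebra.adjoin_induction with
  | mem x hx => exact (h x hx).1
  | algebraMap r => exact P.algebraMap_mem r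
  | add x y _ _ hx hy => exact add_mem hx hy
  | mul x y _ _ hx hy => exact mul_mem hx hy

variable (v G P Q) in
/-- The reductions of `P` and `Q` lie in the chart `G` and agree. -/
structure SameReduction : Prop where
  left : P.IsIntegralAt v G
  right : Q.IsIntegralAt v G
  sub_lt : ∀ a ∈ integralRing v G, v (P.ev a - Q.ev a) < 1

theorem SameReduction.of_forall_mem (hP : P.IsIntegralAt v G) (hQ : Q.IsIntegralAt v G)
    (h : ∀ g ∈ G, v (P.ev g - Q.ev g) < 1) : SameReduction P Q v G := by
  refine ⟨hP, hQ, fun a ha ↦ ?_⟩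
  let S : Subring L :=
    { carrier := {a | (a ∈ P.ring ∧ v (P.ev a) ≤ 1) ∧ (a ∈ Q.ring ∧ v (Q.ev a) ≤ 1) ∧
        v (P.ev a - Q.ev a) < 1}
      one_mem' := ⟨⟨one_mem _, by simp⟩, ⟨one_mem _, by simp⟩, by simp⟩
      zero_mem' := ⟨⟨zero_mem _, by simp⟩, ⟨zero_mem _, by simp⟩, by simp⟩
      mul_mem' := fun ⟨ha, ha', ha''⟩ ⟨hb, hb', hb''⟩ ↦
        ⟨⟨mul_mem ha.1 hb.1, by rw [ev_mul ha.1 hb.1, map_mul]; exact mul_le_one' ha.2 hb.2⟩,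
          ⟨mul_mem ha'.1 hb'.1, by rw [ev_mul ha'.1 hb'.1, map_mul]; exact mul_le_one' ha'.2 hb'.2⟩,
          by
            rw [ev_mul ha.1 hb.1, ev_mul ha'.1 hb'.1]
            exact Valuation.map_mul_sub_mul_lt_one ha.2 hb'.2 ha'' hb''⟩
      add_mem' := fun ⟨ha, ha', ha''⟩ ⟨hb, hb', hb''⟩ ↦
        ⟨⟨add_mem ha.1 hb.1, by rw [ev_add ha.1 hb.1]; exact v.map_add_le ha.2 hb.2⟩,
          ⟨add_mem ha'.1 hb'.1, by rw [ev_add ha'.1 hb'.1]; exact v.map_add_le ha'.2 hb'.2⟩,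
          by
            rw [ev_add ha.1 hb.1, ev_add ha'.1 hb'.1, add_sub_add_comm]
            exact v.map_add_lt ha'' hb''⟩
      neg_mem' := fun ⟨ha, ha', ha''⟩ ↦
        ⟨⟨neg_mem ha.1, by rw [ev_neg ha.1, v.map_neg]; exact ha.2⟩,
          ⟨neg_mem ha'.1, by rw [ev_neg ha'.1, v.map_neg]; exact ha'.2⟩,
          by rw [ev_neg ha.1, ev_neg ha'.1, ← neg_sub', v.map_neg]; exact ha''⟩ }
  refine (RatPlace.integralRing_le (S := S) (fun r hr ↦ ?_) (fun g hg ↦ ?_) ha).2.2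
  · exact ⟨⟨P.algebraMap_mem r, by simpa using hr⟩, ⟨Q.algebraMap_mem r, by simpa using hr⟩,
      by simp⟩
  · exact ⟨hP g hg, hQ g hg, h g hg⟩

namespace SameReduction

theorem refl (h : P.IsIntegralAt v G) : SameReduction P P v G := ⟨h, h, by simp⟩

theorem symm (h : SameReduction P Q v G) : SameReduction Q P v G :=
  ⟨h.right, h.left, fun a ha ↦ by rw [v.map_sub_swap]; exact h.sub_lt a ha⟩

theorem trans (h : SameReduction P Q v G) (h' : SameReduction Q R v G) : SameReduction P R v G :=
  ⟨h.left, h'.right, fun a ha ↦ by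
    rw [← sub_add_sub_cancel _ (Q.ev a)]; exact v.map_add_lt (h.sub_lt a ha) (h'.sub_lt a ha)⟩

theorem localRing_le (h : SameReduction P Q v G) : P.localRing v G ≤ Q.localRing v G := by
  rintro a ⟨s, hs, hs1, hsa⟩
  exact ⟨s, hs, Valuation.map_eq_one_of_sub_lt hs1 (h.sub_lt s hs), hsa⟩

end SameReduction

theorem IsIntegralAt.of_mem_localRing (h : P.IsIntegralAt v G) {a : L}
    (ha : a ∈ P.localRing v G) : a ∈ P.ring ∧ v (P.ev a) ≤ 1 := by
  obtain ⟨s, hs, hs1, hsa⟩ := ha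
  have h1 := h.integralRing_le hsa
  have h0 := ne_zero_of_map_ev_eq_one hs1
  have haP : a ∈ P.ring := mem_of_mul_mem h0 (by rw [mul_comm]; exact h1.1)
  refine ⟨haP, ?_⟩
  have := h1.2
  rwa [ev_mul (ev_ne_zero_mem h0) haP, map_mul, hs1, one_mul] at this

theorem SameReduction.sub_lt_of_mem_localRing (h : SameReduction P Q v G) {a : L}
    (ha : a ∈ P.localRing v G) : v (P.ev a - Q.ev a) < 1 := by
  have haP := h.left.of_mem_localRing ha
  have haQ := h.right.of_mem_localRing (h.localRing_le ha)
  obtain ⟨s, hs, hs1, hsa⟩ := ha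
  have h1 := h.sub_lt _ hsa
  rw [ev_mul (h.left.integralRing_le hs).1 haP.1, ev_mul (h.right.integralRing_le hs).1 haQ.1] at h1
  have h2 := h.sub_lt _ hs
  have h3 : P.ev s * (P.ev a - Q.ev a) =
      (P.ev s * P.ev a - Q.ev s * Q.ev a) - (P.ev s - Q.ev s) * Q.ev a := by ring
  rw [show v (P.ev a - Q.ev a) = v (P.ev s * (P.ev a - Q.ev a)) by rw [map_mul, hs1, one_mul], h3]
  refine v.map_sub_lt h1 ?_
  rw [map_mul]
  exact (mul_le_of_le_one_right' haQ.2).trans_lt h2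

end RatPlace

end GoodReduction

section GoodReduction

open WithZero IsDedekindDomain
open scoped WithZero

namespace RatPlace

variable {K L : Type*} [Field K] [Field L] [Algebra K L] {P Q R : RatPlace K L}
  {v : Valuation K ℤᵐ⁰} {G : Set L}

/-- Near `P` the function `a` is a function of `z` with slope congruent to a constant. -/
def HasSlope (v : Valuation K ℤᵐ⁰) (G : Set L) (P : RatPlace K L) (z a : L) : Prop :=
  ∃ κ, v κ ≤ 1 ∧ ∀ Q Q', P.SameReduction Q v G → P.SameReduction Q' v G →
    ∃ r, v (r - κ) < 1 ∧ Q.ev a - Q'.ev a = r * (Q.ev z - Q'.ev z)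

namespace HasSlope

variable {z a b : L}

theorem of_const (k : K) : HasSlope v G P z (algebraMap K L k) :=
  ⟨0, by simp, fun Q Q' _ _ ↦ ⟨0, by simp, by simp⟩⟩

theorem add (ha : a ∈ P.localRing v G) (hb : b ∈ P.localRing v G) (h : HasSlope v G P z a)
    (h' : HasSlope v G P z b) : HasSlope v G P z (a + b) := by
  obtain ⟨κ, hκ, h⟩ := h
  obtain ⟨κ', hκ', h'⟩ := h'
  refine ⟨κ + κ', v.map_add_le hκ hκ', fun Q Q' hQ hQ' ↦ ?_⟩
  obtain ⟨r, hr, hr'⟩ := h Q Q' hQ hQ'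
  obtain ⟨s, hs, hs'⟩ := h' Q Q' hQ hQ'
  refine ⟨r + s, ?_, ?_⟩
  · rw [add_sub_add_comm]; exact v.map_add_lt hr hs
  · rw [ev_add (hQ.right.of_mem_localRing (hQ.localRing_le ha)).1
      (hQ.right.of_mem_localRing (hQ.localRing_le hb)).1,
      ev_add (hQ'.right.of_mem_localRing (hQ'.localRing_le ha)).1
      (hQ'.right.of_mem_localRing (hQ'.localRing_le hb)).1, add_sub_add_comm, hr', hs', add_mul]

theorem neg (ha : a ∈ P.localRing v G) (h : HasSlope v G P z a) : HasSlope v G P z (-a) := by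
  obtain ⟨κ, hκ, h⟩ := h
  refine ⟨-κ, by rwa [v.map_neg], fun Q Q' hQ hQ' ↦ ?_⟩
  obtain ⟨r, hr, hr'⟩ := h Q Q' hQ hQ'
  refine ⟨-r, ?_, ?_⟩
  · rwa [← neg_sub', v.map_neg]
  · rw [ev_neg (hQ.right.of_mem_localRing (hQ.localRing_le ha)).1,
      ev_neg (hQ'.right.of_mem_localRing (hQ'.localRing_le ha)).1, ← neg_sub', hr', neg_mul]

theorem mul (ha : a ∈ P.localRing v G) (hb : b ∈ P.localRing v G) (h : HasSlope v G P z a)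
    (h' : HasSlope v G P z b) : HasSlope v G P z (a * b) := by
  obtain ⟨κ, hκ, h⟩ := h
  obtain ⟨κ', hκ', h'⟩ := h'
  by_cases hP : P.IsIntegralAt v G
  swap
  · exact ⟨0, by simp, fun Q Q' hQ ↦ absurd hQ.left hP⟩
  have ha1 := (hP.of_mem_localRing ha).2
  have hb1 := (hP.of_mem_localRing hb).2
  refine ⟨P.ev a * κ' + P.ev b * κ, ?_, fun Q Q' hQ hQ' ↦ ?_⟩
  · refine v.map_add_le ?_ ?_ <;> rw [map_mul] <;> exact mul_le_one' ‹_› ‹_›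
  obtain ⟨r, hr, hr'⟩ := h Q Q' hQ hQ'
  obtain ⟨s, hs, hs'⟩ := h' Q Q' hQ hQ'
  have haQ := hQ.right.of_mem_localRing (hQ.localRing_le ha)
  have hbQ := hQ.right.of_mem_localRing (hQ.localRing_le hb)
  have haQ' := hQ'.right.of_mem_localRing (hQ'.localRing_le ha)
  have hbQ' := hQ'.right.of_mem_localRing (hQ'.localRing_le hb)
  refine ⟨Q.ev a * s + Q'.ev b * r, ?_, ?_⟩
  · rw [add_sub_add_comm]
    exact v.map_add_lt
      (Valuation.map_mul_sub_mul_lt_one haQ.2 hκ' (hQ.symm.sub_lt_of_mem_localRing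
        (hQ.localRing_le ha)) hs)
      (Valuation.map_mul_sub_mul_lt_one hbQ'.2 hκ (hQ'.symm.sub_lt_of_mem_localRing
        (hQ'.localRing_le hb)) hr)
  · rw [ev_mul haQ.1 hbQ.1, ev_mul haQ'.1 hbQ'.1]
    linear_combination Q.ev a * hs' + Q'.ev b * hr'

theorem div {s : L} (hs : s ∈ integralRing v G) (hs1 : v (P.ev s) = 1)
    (ha : a ∈ P.localRing v G) (h : HasSlope v G P z s) (h' : HasSlope v G P z (s * a)) :
    HasSlope v G P z a := by
  obtain ⟨κ, hκ, h⟩ := h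
  obtain ⟨κ', hκ', h'⟩ := h'
  by_cases hP : P.IsIntegralAt v G
  swap
  · exact ⟨0, by simp, fun Q Q' hQ ↦ absurd hQ.left hP⟩
  have ha1 := (hP.of_mem_localRing ha).2
  have hs0 := ne_zero_of_map_ev_eq_one hs1
  have hX : v (κ' - P.ev a * κ) ≤ 1 :=
    v.map_sub_le hκ' (by rw [map_mul]; exact mul_le_one' ha1 hκ)
  refine ⟨(κ' - P.ev a * κ) / P.ev s, by rwa [map_div₀, hs1, div_one], fun Q Q' hQ hQ' ↦ ?_⟩
  obtain ⟨r, hr, hr'⟩ := h Q Q' hQ hQ'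
  obtain ⟨r', hrr, hrr'⟩ := h' Q Q' hQ hQ'
  have haQ := hQ.right.of_mem_localRing (hQ.localRing_le ha)
  have haQ' := hQ'.right.of_mem_localRing (hQ'.localRing_le ha)
  have hsQ := hQ.right.integralRing_le hs
  have hsQ' := hQ'.right.integralRing_le hs
  have hsQ1 : v (Q.ev s) = 1 := Valuation.map_eq_one_of_sub_lt hs1 (hQ.sub_lt _ hs)
  have hsQ0 := ne_zero_of_map_ev_eq_one hsQ1
  refine ⟨(r' - Q'.ev a * r) / Q.ev s, ?_, ?_⟩
  · rw [div_sub_div _ _ hsQ0 hs0, map_div₀, map_mul, hsQ1, hs1, mul_one, div_one,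
      mul_comm _ (P.ev s)]
    refine Valuation.map_mul_sub_mul_lt_one hs1.le hX (hQ.sub_lt _ hs) ?_
    rw [sub_sub_sub_comm]
    refine v.map_sub_lt hrr (Valuation.map_mul_sub_mul_lt_one haQ'.2 hκ ?_ hr)
    exact hQ'.symm.sub_lt_of_mem_localRing (hQ'.localRing_le ha)
  · rw [ev_mul hsQ.1 haQ.1, ev_mul hsQ'.1 haQ'.1] at hrr'
    rw [div_mul_eq_mul_div, eq_div_iff hsQ0]
    linear_combination hrr' - Q'.ev a * hr'

theorem of_forall_mem (h : ∀ g ∈ G, HasSlope v G P z g) (ha : a ∈ P.localRing v G) :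
    HasSlope v G P z a := by
  let S : Subring L :=
    { carrier := {a | a ∈ P.localRing v G ∧ HasSlope v G P z a}
      one_mem' := ⟨one_mem _, by simpa using of_const (L := L) (1 : K)⟩
      zero_mem' := ⟨zero_mem _, by simpa using of_const (L := L) (0 : K)⟩
      mul_mem' := fun ha hb ↦ ⟨mul_mem ha.1 hb.1, ha.2.mul ha.1 hb.1 hb.2⟩
      add_mem' := fun ha hb ↦ ⟨add_mem ha.1 hb.1, ha.2.add ha.1 hb.1 hb.2⟩
      neg_mem' := fun ha ↦ ⟨neg_mem ha.1, ha.2.neg ha.1⟩ }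
  have hS : integralRing v G ≤ S := integralRing_le
    (fun r hr ↦ ⟨integralRing_le_localRing (algebraMap_mem_integralRing hr), of_const r⟩)
    fun g hg ↦ ⟨integralRing_le_localRing (subset_integralRing hg), h g hg⟩
  obtain ⟨s, hs, hs1, hsa⟩ := ha
  exact div hs hs1 ⟨s, hs, hs1, hsa⟩ (hS hs).2 (hS hsa).2

end HasSlope

theorem localRing_map {H : Set L} {P' : RatPlace K L} (φ : L →ₐ[K] L)
    (hφ : ∀ a, P'.ev a = P.ev (φ a)) (h : ∀ g ∈ H, φ g ∈ P.localRing v G) {a : L}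
    (ha : a ∈ P'.localRing v H) : φ a ∈ P.localRing v G := by
  have hle : integralRing v H ≤ (P.localRing v G).comap (φ : L →+* L) :=
    integralRing_le (fun r hr ↦ integralRing_le_localRing (by
      simpa using algebraMap_mem_integralRing hr)) h
  obtain ⟨s, hs, hs1, hsa⟩ := ha
  obtain ⟨t, ht, ht1, hts⟩ : φ s ∈ P.localRing v G := hle hs
  obtain ⟨u, hu, hu1, hus⟩ : φ (s * a) ∈ P.localRing v G := hle hsa
  rw [hφ] at hs1
  refine ⟨u * (t * φ s), mul_mem hu hts, map_ev_mul_eq_one hu1 (map_ev_mul_eq_one ht1 hs1), ?_⟩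
  rw [map_mul] at hus
  rw [show u * (t * φ s) * φ a = t * (u * (φ s * φ a)) by ring]
  exact mul_mem ht hus

theorem comap_pow (φ : L →ₐ[K] L) (n : ℕ) : P.comap (φ ^ n) = (comap φ)^[n] P := by
  induction n generalizing P with
  | zero => rfl
  | succ n ih => rw [Function.iterate_succ_apply, ← ih, pow_succ']; rfl

variable {ι : Type*}

/-- The curve with function field `L`, covered by the charts `G i`, and its self-map dual to `φ`
have good reduction at `v`. -/
structure IsGoodReduction (v : Valuation K ℤᵐ⁰) (G : ι → Set L) (φ : L →ₐ[K] L) : Prop where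
  cover (P : RatPlace K L) : ∃ i, P.IsIntegralAt v (G i)
  glue (i j : ι) (P : RatPlace K L) : P.IsIntegralAt v (G i) → P.IsIntegralAt v (G j) →
    ∀ g ∈ G j, g ∈ P.localRing v (G i)
  pull (i : ι) (P : RatPlace K L) : P.IsIntegralAt v (G i) →
    ∃ j, ∀ g ∈ G j, φ g ∈ P.localRing v (G i)
  smooth (i : ι) (P : RatPlace K L) : P.IsIntegralAt v (G i) →
    ∃ z ∈ integralRing v (G i), ∀ g ∈ G i, HasSlope v (G i) P z g

namespace IsGoodReduction

variable {G : ι → Set L} {φ ψ : L →ₐ[K] L} {i j : ι}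

theorem isIntegralAt_comap (hP : P.IsIntegralAt v (G i))
    (h : ∀ g ∈ G j, φ g ∈ P.localRing v (G i)) : (P.comap φ).IsIntegralAt v (G j) := fun g hg ↦ by
  rw [ev_comap, mem_comap_ring]
  exact hP.of_mem_localRing (h g hg)

theorem map_mem (h : IsGoodReduction v G φ) (hP : P.IsIntegralAt v (G i))
    (hP' : (P.comap φ).IsIntegralAt v (G j)) {a : L} (ha : a ∈ (P.comap φ).localRing v (G j)) :
    φ a ∈ P.localRing v (G i) := by
  obtain ⟨k, hk⟩ := h.pull i P hP
  refine localRing_map φ (fun a ↦ ev_comap) hk ?_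
  exact localRing_map (AlgHom.id K L) (fun a ↦ rfl)
    (h.glue k j _ (isIntegralAt_comap hP hk) hP') ha

theorem comp (h : IsGoodReduction v G φ) (h' : IsGoodReduction v G ψ) :
    IsGoodReduction v G (φ.comp ψ) where
  cover := h.cover
  glue := h.glue
  smooth := h.smooth
  pull i P hP := by
    obtain ⟨j, hj⟩ := h.cover (P.comap φ)
    obtain ⟨k, hk⟩ := h'.pull j _ hj
    exact ⟨k, fun g hg ↦ h.map_mem hP hj (hk g hg)⟩

theorem id (h : IsGoodReduction v G φ) : IsGoodReduction v G (AlgHom.id K L) where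
  cover := h.cover
  glue := h.glue
  smooth := h.smooth
  pull i _ _ := ⟨i, fun _ hg ↦ integralRing_le_localRing (subset_integralRing hg)⟩

theorem pow (h : IsGoodReduction v G φ) (n : ℕ) : IsGoodReduction v G (φ ^ n) := by
  induction n with
  | zero => exact h.id
  | succ n ih => rw [pow_succ]; exact ih.comp h

theorem sameReduction_comap (h : IsGoodReduction v G φ) (hPQ : P.SameReduction Q v (G i))
    (hP : (P.comap φ).IsIntegralAt v (G j)) : (P.comap φ).SameReduction (Q.comap φ) v (G j) := by
  have key : ∀ g ∈ G j, φ g ∈ P.localRing v (G i) := fun g hg ↦ h.map_mem hPQ.left hP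
    (integralRing_le_localRing (subset_integralRing hg))
  refine .of_forall_mem hP (isIntegralAt_comap hPQ.right fun g hg ↦
    hPQ.localRing_le (key g hg)) fun g hg ↦ ?_
  rw [ev_comap, ev_comap]
  exact hPQ.sub_lt_of_mem_localRing (key g hg)

theorem sameReduction (h : IsGoodReduction v G φ) (hPQ : P.SameReduction Q v (G i))
    (hP : P.IsIntegralAt v (G j)) : P.SameReduction Q v (G j) :=
  h.id.sameReduction_comap hPQ hP

/-- The equivalence relation of having the same reduction. -/
def setoid (h : IsGoodReduction v G φ) : Setoid (RatPlace K L) where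
  r P Q := ∃ i, P.SameReduction Q v (G i)
  iseqv :=
    { refl := fun P ↦ (h.cover P).imp fun _ hi ↦ .refl hi
      symm := fun ⟨i, hi⟩ ↦ ⟨i, hi.symm⟩
      trans := fun ⟨_, hi⟩ ⟨j, hj⟩ ↦ ⟨j, (h.sameReduction hi.symm hj.left).symm.trans hj⟩ }

end IsGoodReduction

end RatPlace

end GoodReduction

section GoodReduction

open WithZero IsDedekindDomain
open scoped WithZero

theorem Function.exists_pos_iterate_comp_iterate {α : Type*} [Finite α] (f : α → α) :
    ∃ m, 0 < m ∧ ∀ a, f^[m] (f^[m] a) = f^[m] a := by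
  obtain ⟨i, j, hij, h⟩ := Finite.exists_ne_map_eq_of_infinite fun n : ℕ ↦ f^[n]
  wlog hlt : i < j generalizing i j
  · exact this j i hij.symm h.symm (by omega)
  obtain ⟨d, rfl⟩ := Nat.exists_eq_add_of_lt hlt
  have h1 : ∀ t k, i ≤ k → f^[k + t * (d + 1)] = f^[k] := by
    intro t
    induction t with
    | zero => simp
    | succ t ih =>
      intro k hk
      obtain ⟨l, rfl⟩ := Nat.exists_eq_add_of_le' hk
      rw [Nat.succ_mul, ← add_assoc, show l + i + t * (d + 1) + (d + 1) =
        (l + (i + d + 1)) + t * (d + 1) by ring, ih _ (by omega), Function.iterate_add f l,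
        show f^[i + d + 1] = f^[i] from h.symm, ← Function.iterate_add]
  refine ⟨(i + 1) * (d + 1), by positivity, fun a ↦ ?_⟩
  rw [← Function.iterate_add_apply, h1 _ _ (by nlinarith)]

namespace RatPlace

variable {K L : Type*} [Field K] [Field L] [Algebra K L] {P Q R : RatPlace K L}
  {v : Valuation K ℤᵐ⁰} {ι : Type*} {G : ι → Set L} {φ : L →ₐ[K] L} {i : ι}

namespace IsGoodReduction

theorem finite_quotient_setoid [Finite ι] (h : IsGoodReduction v G φ) (hv : HasFiniteQuotients v)
    (hG : ∀ i, (G i).Finite) : Finite (Quotient h.setoid) := by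
  classical
  obtain ⟨S, _, r, hr⟩ := hv 1
  have _ (i : ι) : Finite (G i) := hG i
  let code (P : RatPlace K L) (i : ι) : Option (G i → S) :=
    if P.IsIntegralAt v (G i) then some fun g ↦ r (P.ev g) else none
  have hcode : ∀ P Q, code P = code Q → h.setoid P Q := by
    intro P Q hPQ
    obtain ⟨i, hi⟩ := h.cover P
    have h1 := congrFun hPQ i
    by_cases hi' : Q.IsIntegralAt v (G i)
    · simp only [code, if_pos hi, if_pos hi', Option.some.injEq] at h1
      refine ⟨i, .of_forall_mem hi hi' fun g hg ↦ ?_⟩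
      have := (hr _ _ (hi g hg).2 (hi' g hg).2).1 (congrFun h1 ⟨g, hg⟩)
      refine this.trans_lt ?_
      rw [← exp_zero, exp_lt_exp]
      simp
    · simp [code, if_pos hi, if_neg hi'] at h1
  have hfin : Finite (Set.range code) := Subtype.finite
  refine Finite.of_injective (β := Set.range code) (fun q ↦ ⟨code q.out, _, rfl⟩) fun q q' hq ↦ ?_
  rw [← q.out_eq, ← q'.out_eq]
  exact Quotient.sound (hcode _ _ (congrArg Subtype.val hq))

theorem exists_iterate_eq_of_sameReduction [CharZero K]
    [IsDedekindDomain (Algebra.adjoin K (G i))] [IsFractionRing (Algebra.adjoin K (G i)) L]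
    (h : IsGoodReduction v G φ) (hv : HasFiniteQuotients v) (hG : (G i).Finite)
    (hP : P.SameReduction (P.comap φ) v (G i)) :
    ∃ N, ∀ Q Q', P.SameReduction Q v (G i) → P.SameReduction Q' v (G i) →
      (∃ s, (comap φ)^[s] Q = (comap φ)^[s] Q') → (comap φ)^[N] Q = (comap φ)^[N] Q' := by
  set B := Algebra.adjoin K (G i) with hB
  have hft : Algebra.FiniteType K B :=
    B.fg_iff_finiteType.1 ⟨hG.toFinset, by simp [hB]⟩
  have hinv : ∀ Q, P.SameReduction Q v (G i) → P.SameReduction (Q.comap φ) v (G i) := fun Q hQ ↦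
    hP.trans (h.sameReduction_comap hQ hP.right)
  have hmap : ∀ a ∈ integralRing v (G i), φ a ∈ P.localRing v (G i) := fun a ha ↦
    h.map_mem hP.left hP.right (integralRing_le_localRing ha)
  let D := {Q // P.SameReduction Q v (G i)}
  let F : D → D := fun Q ↦ ⟨Q.1.comap φ, hinv _ Q.2⟩
  have hF : ∀ n (Q : D), (F^[n] Q).1 = (comap φ)^[n] Q.1 := by
    intro n
    induction n with
    | zero => simp
    | succ n ih => intro Q; rw [Function.iterate_succ_apply, ih]; rfl
  suffices ∃ N, ∀ Q Q' : D, (∃ s, F^[s] Q = F^[s] Q') → F^[N] Q = F^[N] Q' by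
    obtain ⟨N, hN⟩ := this
    refine ⟨N, fun Q Q' hQ hQ' ⟨s, hs⟩ ↦ ?_⟩
    have := hN ⟨Q, hQ⟩ ⟨Q', hQ'⟩ ⟨s, Subtype.ext (by rw [hF, hF]; exact hs)⟩
    simpa only [hF] using congrArg Subtype.val this
  obtain ⟨z, hz, hslope⟩ := h.smooth i P hP.left
  have hslope' {a : L} (ha : a ∈ P.localRing v (G i)) := HasSlope.of_forall_mem hslope ha
  let χ (Q : D) : B →ₐ[K] K := Q.1.evAlgHom B fun b hb ↦ Q.2.right.mem_ring hb
  have hbound : ∀ b ∈ B, ∃ C, ∀ Q Q' : D,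
      v (Q.1.ev b - Q'.1.ev b) ≤ C * v (Q.1.ev z - Q'.1.ev z) := by
    intro b hb
    obtain ⟨c, hc0, -, hcb⟩ := exists_algebraMap_mul_mem (v := v) hb
    obtain ⟨κ, hκ, hs⟩ := hslope' (integralRing_le_localRing hcb)
    refine ⟨(v c)⁻¹, fun Q Q' ↦ ?_⟩
    obtain ⟨r, hr, hr'⟩ := hs Q.1 Q'.1 Q.2 Q'.2
    have hr1 : v r ≤ 1 := by
      rw [← sub_add_cancel r κ]; exact v.map_add_le hr.le hκ
    rw [ev_mul (Q.1.algebraMap_mem c) (Q.2.right.mem_ring hb),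
      ev_mul (Q'.1.algebraMap_mem c) (Q'.2.right.mem_ring hb), ev_algebraMap, ev_algebraMap,
      ← mul_sub] at hr'
    rw [← map_inv₀, show Q.1.ev b - Q'.1.ev b = c⁻¹ * (r * (Q.1.ev z - Q'.1.ev z)) by
      rw [← hr', inv_mul_cancel_left₀ hc0], map_mul, map_mul]
    gcongr
    exact mul_le_of_le_one_left' hr1
  have hinj : ∀ Q Q' : D, Q.1.ev z = Q'.1.ev z → Q = Q' := by
    intro Q Q' hQ
    refine Subtype.ext (ext_of_isDedekindDomain B (fun b hb ↦ Q.2.right.mem_ring hb)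
      (fun b hb ↦ Q'.2.right.mem_ring hb) fun b hb ↦ ?_)
    obtain ⟨C, hC⟩ := hbound b hb
    have := hC Q Q'
    rw [hQ, sub_self, map_zero, mul_zero] at this
    exact sub_eq_zero.1 ((map_eq_zero v).1 (le_antisymm this zero_le))
  obtain ⟨κ, hκ, hs⟩ := hslope' (hmap z hz)
  by_cases hκ1 : v κ = 1
  · have hFinj : Function.Injective F := by
      intro Q Q' hQ
      refine hinj _ _ ?_
      obtain ⟨r, hr, hr'⟩ := hs Q.1 Q'.1 Q.2 Q'.2
      have hr1 : v r = 1 := Valuation.map_eq_one_of_sub_lt hκ1 (by rwa [v.map_sub_swap])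
      have hr0 : r ≠ 0 := by rintro rfl; simp at hr1
      have h0 : Q.1.ev (φ z) = Q'.1.ev (φ z) := by
        rw [← ev_comap, ← ev_comap]
        exact congrArg (fun R : D ↦ R.1.ev z) hQ
      rw [h0, sub_self] at hr'
      exact sub_eq_zero.1 ((mul_eq_zero.1 hr'.symm).resolve_left hr0)
    exact ⟨0, fun Q Q' ⟨s, hs⟩ ↦ hFinj.iterate s hs⟩
  · have hfam : IsContractingFamily v χ F ⟨z, integralRing_le_adjoin hz⟩ :=
      { sub_le_one := fun Q Q' ↦ (Q.2.symm.trans Q'.2).sub_lt z hz |>.le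
        lipschitz := fun b ↦ hbound b b.2
        contract := fun Q Q' ↦ by
          obtain ⟨r, hr, hr'⟩ := hs Q.1 Q'.1 Q.2 Q'.2
          have hr1 : v r < 1 := by
            rw [← sub_add_cancel r κ]; exact v.map_add_lt hr (lt_of_le_of_ne hκ hκ1)
          change v ((Q.1.comap φ).ev z - (Q'.1.comap φ).ev z) ≤
            exp (-1) * v (Q.1.ev z - Q'.1.ev z)
          rw [ev_comap, ev_comap, hr', map_mul]
          gcongr
          exact le_exp_neg_one_of_lt_one hr1
        inj := hinj
        pullback := fun b ↦ by
          obtain ⟨c, hc0, -, hcb⟩ := exists_algebraMap_mul_mem (v := v) b.2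
          obtain ⟨s, hs, hs1, hsb⟩ := hmap _ hcb
          refine ⟨c⁻¹ • ⟨_, integralRing_le_adjoin hsb⟩, ⟨s, integralRing_le_adjoin hs⟩,
            fun Q ↦ ⟨Valuation.map_eq_one_of_sub_lt hs1 (Q.2.sub_lt s hs), ?_⟩⟩
          rw [map_smul, smul_eq_mul]
          change (Q.1.comap φ).ev b * Q.1.ev s = c⁻¹ * Q.1.ev (s * φ (algebraMap K L c * b))
          have hφb : φ b ∈ Q.1.ring := (hinv _ Q.2).right.mem_ring b.2
          have hsQ := (Q.2.right.integralRing_le hs).1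
          rw [ev_comap, map_mul, AlgHom.commutes, ev_mul hsQ (mul_mem (Q.1.algebraMap_mem c) hφb),
            ev_mul (Q.1.algebraMap_mem c) hφb, ev_algebraMap]
          field_simp }
    exact hfam.exists_iterate_eq hv

theorem exists_iterate_eq [CharZero K] [Finite ι]
    [∀ i, IsDedekindDomain (Algebra.adjoin K (G i))]
    [∀ i, IsFractionRing (Algebra.adjoin K (G i)) L]
    (h : IsGoodReduction v G φ) (hv : HasFiniteQuotients v) (hG : ∀ i, (G i).Finite) :
    ∃ N, ∀ Q Q', (∃ s, (comap φ)^[s] Q = (comap φ)^[s] Q') →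
      (comap φ)^[N] Q = (comap φ)^[N] Q' := by
  have hfin := h.finite_quotient_setoid hv hG
  have hmapq : ∀ P Q, h.setoid P Q → h.setoid (P.comap φ) (Q.comap φ) := by
    rintro P Q ⟨i, hi⟩
    obtain ⟨j, hj⟩ := h.cover (P.comap φ)
    exact ⟨j, h.sameReduction_comap hi hj⟩
  let f : Quotient h.setoid → Quotient h.setoid := Quotient.map (comap φ) hmapq
  have hf : ∀ n P, f^[n] (Quotient.mk _ P) = Quotient.mk _ ((comap φ)^[n] P) := by
    intro n
    induction n with
    | zero => intro P; rfl
    | succ n ih => intro P; rw [Function.iterate_succ_apply, Function.iterate_succ_apply, ← ih]; rfl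
  obtain ⟨m, hm, hidem⟩ := Function.exists_pos_iterate_comp_iterate f
  set F := (comap (K := K) (L := L) φ)^[m] with hFdef
  have hψ : comap (φ ^ m) = F := by ext1 P; exact comap_pow φ m
  have hg := h.pow m
  have hFF : ∀ P, h.setoid (F (F P)) (F P) := by
    intro P
    have := hidem (Quotient.mk _ P)
    rw [hf, hf] at this
    exact Quotient.exact this
  have hN : ∀ q : Quotient h.setoid, ∃ N, ∀ Q Q', Quotient.mk _ (F Q) = q →
      Quotient.mk _ (F Q') = q → (∃ s, F^[s] (F Q) = F^[s] (F Q')) →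
        F^[N] (F Q) = F^[N] (F Q') := by
    intro q
    by_cases hq : ∃ P, Quotient.mk _ (F P) = q
    swap
    · exact ⟨0, fun Q Q' hQ ↦ absurd ⟨Q, hQ⟩ hq⟩
    obtain ⟨P, rfl⟩ := hq
    obtain ⟨i, hi⟩ := hFF P
    obtain ⟨N, hN⟩ := hg.exists_iterate_eq_of_sameReduction (P := F P) (i := i) hv (hG i)
      (by rw [hψ]; exact hi.symm)
    rw [hψ] at hN
    have hsame : ∀ Q, Quotient.mk h.setoid (F Q) = Quotient.mk _ (F P) →
        (F P).SameReduction (F Q) v (G i) := by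
      intro Q hQ
      obtain ⟨j, hj⟩ := Quotient.exact hQ
      exact h.sameReduction hj.symm hi.right
    exact ⟨N, fun Q Q' hQ hQ' ↦ hN _ _ (hsame Q hQ) (hsame Q' hQ')⟩
  choose N hN using hN
  have _ := Fintype.ofFinite (Quotient h.setoid)
  refine ⟨m * (Finset.univ.sup N + 1), fun Q Q' ⟨s, hs⟩ ↦ ?_⟩
  rw [Function.iterate_mul, ← hFdef]
  have hFs : F^[s] Q = F^[s] Q' := by
    rw [hFdef, ← Function.iterate_mul]
    obtain ⟨k, rfl⟩ := Nat.exists_eq_add_of_lt hm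
    rw [show (0 + k + 1) * s = k * s + s by ring, Function.iterate_add_apply,
      Function.iterate_add_apply, hs]
  have hFs' : F^[s] (F Q) = F^[s] (F Q') := by
    rw [← Function.iterate_succ_apply, Function.iterate_succ_apply', hFs,
      ← Function.iterate_succ_apply' F, Function.iterate_succ_apply]
  have hcl : ∀ n R, Quotient.mk h.setoid (F^[n] (F R)) = Quotient.mk _ (F R) := by
    intro n R
    induction n with
    | zero => rfl
    | succ n ih =>
      rw [← ih, ← Function.iterate_succ_apply, Function.iterate_succ_apply',
        Function.iterate_succ_apply', ← Function.iterate_succ_apply F, Function.iterate_succ_apply']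
      exact Quotient.sound (hFF _)
  have hcls : Quotient.mk h.setoid (F Q') = Quotient.mk _ (F Q) := by
    rw [← hcl s Q, ← hcl s Q', hFs']
  have := hN (Quotient.mk _ (F Q)) Q Q' rfl hcls ⟨s, hFs'⟩
  obtain ⟨k, hk⟩ := Nat.exists_eq_add_of_le' (Finset.le_sup (f := N) (Finset.mem_univ
    (Quotient.mk h.setoid (F Q))))
  rw [hk, Function.iterate_succ_apply, Function.iterate_succ_apply, Function.iterate_add_apply,
    Function.iterate_add_apply, this]

end IsGoodReduction

end RatPlace

end GoodReduction

section Charts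

open WithZero IsDedekindDomain Polynomial
open scoped WithZero

theorem Polynomial.Monic.mem_range_of_eval_eq_zero {A L : Type*} [CommRing A] [CommRing L]
    [Algebra A L] [IsIntegrallyClosedIn A L] {p : L[X]} (hp : p.Monic)
    (hc : ∀ n, p.coeff n ∈ Set.range (algebraMap A L)) {g : L} (hg : p.eval g = 0) :
    g ∈ Set.range (algebraMap A L) := by
  obtain ⟨q, rfl, -, hq⟩ := lifts_and_natDegree_eq_and_monic ((lifts_iff_coeff_lifts p).2 hc) hp
  exact IsIntegrallyClosedIn.algebraMap_eq_of_integral ⟨q, hq, by rwa [← Polynomial.eval_map]⟩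

theorem ValuationSubring.mem_of_monic_of_eval_eq_zero {L : Type*} [Field L]
    (V : ValuationSubring L) {p : L[X]} (hp : p.Monic) (hc : ∀ n, p.coeff n ∈ V) {g : L}
    (hg : p.eval g = 0) : g ∈ V := by
  have : IsIntegrallyClosedIn V L :=
    (isIntegrallyClosed_iff_isIntegrallyClosedIn L).1 inferInstance
  obtain ⟨x, rfl⟩ := hp.mem_range_of_eval_eq_zero (A := V) (fun n ↦ ⟨⟨_, hc n⟩, rfl⟩) hg
  exact x.2

variable {K L : Type*} [Field K] [Field L] [Algebra K L]

theorem exists_monic_of_isIntegral {A : Subalgebra K L} {g : L} (hg : IsIntegral A g) :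
    ∃ p : L[X], p.Monic ∧ (∀ n, p.coeff n ∈ A) ∧ p.eval g = 0 := by
  obtain ⟨p, hp, h0⟩ := hg
  exact ⟨p.map (algebraMap A L), hp.map _, fun n ↦ by rw [coeff_map]; exact (p.coeff n).2,
    by rwa [Polynomial.eval_map]⟩

/-- The affine charts of a smooth projective curve at finite and infinite values of a function. -/
structure IsChartPair (K : Type*) {L : Type*} [Field K] [Field L] [Algebra K L] (τ : Bool → L)
    (G : Bool → Set L) : Prop where
  mul_eq_one (i : Bool) : τ i * τ (!i) = 1
  finite (i : Bool) : (G i).Finite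
  mem (i : Bool) : τ i ∈ G i
  isIntegral (i : Bool) : ∀ g ∈ G i, IsIntegral (Algebra.adjoin K {τ i}) g
  isDedekindDomain (i : Bool) : IsDedekindDomain (Algebra.adjoin K (G i))
  isFractionRing (i : Bool) : IsFractionRing (Algebra.adjoin K (G i)) L
  not_isField (i : Bool) : ¬ IsField (Algebra.adjoin K (G i))

namespace IsChartPair

variable {τ : Bool → L} {G : Bool → Set L}

theorem exists_pow_mul_mem (h : IsChartPair K τ G) (i : Bool) :
    ∀ g ∈ G (!i), ∃ N, τ i ^ N * g ∈ Algebra.adjoin K (G i) := by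
  intro g hg
  set B := Algebra.adjoin K (G i)
  have hτ : τ i ∈ B := Algebra.subset_adjoin (h.mem i)
  obtain ⟨p, hp, hc, h0⟩ := exists_monic_of_isIntegral (h.isIntegral (!i) g hg)
  have key : ∀ c ∈ Algebra.adjoin K {τ (!i)}, ∃ N, ∀ n ≥ N, τ i ^ n * c ∈ B := by
    suffices ∀ c ∈ Algebra.adjoin K {τ (!i)}, ∃ N, τ i ^ N * c ∈ B by
      intro c hc
      obtain ⟨N, hN⟩ := this c hc
      refine ⟨N, fun n hn ↦ ?_⟩
      obtain ⟨k, rfl⟩ := Nat.exists_eq_add_of_le' hn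
      rw [pow_add, mul_assoc]
      exact mul_mem (pow_mem hτ _) hN
    intro c hc
    induction hc using Algebra.adjoin_induction with
    | mem x hx =>
      obtain rfl := hx
      exact ⟨1, by rw [pow_one, h.mul_eq_one]; exact one_mem _⟩
    | algebraMap r => exact ⟨0, by simp⟩
    | add x y _ _ hx hy =>
      obtain ⟨n, hn⟩ := hx
      obtain ⟨m, hm⟩ := hy
      refine ⟨n + m, ?_⟩
      rw [show τ i ^ (n + m) * (x + y) = τ i ^ m * (τ i ^ n * x) + τ i ^ n * (τ i ^ m * y) by ring]
      exact add_mem (mul_mem (pow_mem hτ _) hn) (mul_mem (pow_mem hτ _) hm)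
    | mul x y _ _ hx hy =>
      obtain ⟨n, hn⟩ := hx
      obtain ⟨m, hm⟩ := hy
      refine ⟨n + m, ?_⟩
      rw [pow_add, mul_mul_mul_comm]
      exact mul_mem hn hm
  choose N hN using fun n ↦ key _ (hc n)
  set M := (Finset.range (p.natDegree + 1)).sup N + 1
  refine ⟨M, ?_⟩
  have := h.isDedekindDomain i
  have := h.isFractionRing i
  have : IsIntegrallyClosedIn B L :=
    (isIntegrallyClosed_iff_isIntegrallyClosedIn L).1 inferInstance
  have hz : (p.scaleRoots (τ i ^ M)).eval (τ i ^ M * g) = 0 := by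
    simpa using scaleRoots_aeval_eq_zero (R := L) (A := L) (r := τ i ^ M) (p := p) (a := g)
      (by simpa using h0)
  suffices hB : ∀ n, p.coeff n * (τ i ^ M) ^ (p.natDegree - n) ∈ B by
    obtain ⟨x, hx⟩ := ((monic_scaleRoots_iff _).2 hp).mem_range_of_eval_eq_zero (A := B)
      (fun n ↦ by rw [coeff_scaleRoots]; exact ⟨⟨_, hB n⟩, rfl⟩) hz
    exact hx ▸ x.2
  intro n
  rcases lt_trichotomy n p.natDegree with hn | rfl | hn
  · rw [← pow_mul, mul_comm]
    refine hN n _ ?_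
    have h1 : N n ≤ (Finset.range (p.natDegree + 1)).sup N :=
      Finset.le_sup (f := N) (Finset.mem_range.2 (by omega))
    calc N n ≤ M * 1 := by omega
      _ ≤ _ := Nat.mul_le_mul_left _ (by omega)
  · rw [hp.coeff_natDegree, Nat.sub_self, pow_zero, one_mul]; exact one_mem _
  · rw [coeff_eq_zero_of_natDegree_lt hn, zero_mul]; exact zero_mem _

theorem exists_add_eq_one (h : IsChartPair K τ G) (φ : L →ₐ[K] L) (i : Bool) :
    ∃ b : Bool → L, (∀ j, b j ∈ Algebra.adjoin K (G i)) ∧ b true + b false = 1 ∧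
      ∀ j, ∀ g ∈ G j, b j * φ g ∈ Algebra.adjoin K (G i) := by
  set B := Algebra.adjoin K (G i)
  have := h.isDedekindDomain i
  have := h.isFractionRing i
  let I (j : Bool) : Ideal B :=
    { carrier := {b | ∀ g ∈ G j, b * φ g ∈ B}
      zero_mem' := fun g _ ↦ by simp
      add_mem' := fun {a b} ha hb g hg ↦ by
        rw [Subalgebra.coe_add, add_mul]
        exact add_mem (ha g hg) (hb g hg)
      smul_mem' := fun c b hb g hg ↦ by
        rw [smul_eq_mul, Subalgebra.coe_mul, mul_assoc]
        exact mul_mem c.2 (hb g hg) }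
  have htop : I true ⊔ I false = ⊤ := by
    by_contra hne
    obtain ⟨m, hm, hle⟩ := Ideal.exists_le_maximal _ hne
    let p : HeightOneSpectrum B := ⟨m, hm.isPrime, fun h0 ↦
      h.not_isField i (Ring.isField_iff_maximal_bot.2 (h0 ▸ hm))⟩
    have hleI : ∀ j, I j ≤ m := by
      rintro (_ | _)
      exacts [le_sup_right.trans hle, le_sup_left.trans hle]
    let V := (p.valuation L).valuationSubring
    obtain ⟨j, hj⟩ : ∃ j, φ (τ j) ∈ V := by
      rcases V.mem_or_inv_mem (φ (τ true)) with h1 | h1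
      · exact ⟨_, h1⟩
      · refine ⟨false, ?_⟩
        rwa [← map_inv₀, inv_eq_of_mul_eq_one_right (h.mul_eq_one true)] at h1
    have hK : ∀ k, algebraMap K L k ∈ V := fun k ↦
      p.valuation_le_one (algebraMap K B k)
    have hGV : ∀ g ∈ G j, φ g ∈ V := by
      intro g hg
      obtain ⟨q, hq, hc, h0⟩ := exists_monic_of_isIntegral (h.isIntegral j g hg)
      refine V.mem_of_monic_of_eval_eq_zero (p := q.map (φ : L →+* L)) (hq.map _) (fun n ↦ ?_) ?_
      · rw [coeff_map]
        refine (?_ : ∀ c ∈ Algebra.adjoin K {τ j}, φ c ∈ V) _ (hc n)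
        intro c hc
        induction hc using Algebra.adjoin_induction with
        | mem x hx => obtain rfl := hx; exact hj
        | algebraMap r => rw [AlgHom.commutes]; exact hK r
        | add x y _ _ hx hy => rw [map_add]; exact add_mem hx hy
        | mul x y _ _ hx hy => rw [map_mul]; exact mul_mem hx hy
      · have := congrArg φ h0
        rwa [map_zero, ← AlgHom.coe_toRingHom, ← Polynomial.eval_map_apply] at this
    have hd : ∀ S : Set L, S.Finite → S ⊆ G j → ∃ d : B, d ∉ m ∧ ∀ g ∈ S, d * φ g ∈ B := by
      intro S hS
      induction S, hS using Set.Finite.induction_on with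
      | empty => exact fun _ ↦ ⟨1, fun h1 ↦ hm.ne_top ((Ideal.eq_top_iff_one _).2 h1), by simp⟩
      | @insert a S _ _ ih =>
        intro hsub
        obtain ⟨d, hd, hdS⟩ := ih ((Set.subset_insert _ _).trans hsub)
        obtain ⟨n, e, he⟩ := p.exists_primeCompl_mul_eq_of_integer (φ a)
          (hGV a (hsub (Set.mem_insert _ _)))
        have he' : φ a * (e : B) = n := he
        refine ⟨d * e, fun hde ↦ (hm.isPrime.mem_or_mem hde).elim hd e.2, ?_⟩
        rintro g (rfl | hg)
        · rw [Subalgebra.coe_mul, mul_assoc, mul_comm _ (φ g), he']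
          exact mul_mem d.2 n.2
        · rw [Subalgebra.coe_mul, mul_right_comm]
          exact mul_mem (hdS g hg) (e : B).2
    obtain ⟨d, hd, hdG⟩ := hd _ (h.finite j) subset_rfl
    exact hd (hleI j hdG)
  obtain ⟨a, ha, b, hb, hab⟩ := Submodule.mem_sup.1 ((Ideal.eq_top_iff_one _).1 htop)
  refine ⟨fun j ↦ if j then a else b, ?_, ?_, ?_⟩
  · rintro (_ | _) <;> simp
  · simpa using congrArg Subtype.val hab
  · rintro (_ | _)
    exacts [by simpa using! hb, by simpa using! ha]

end IsChartPair

end Charts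

section AlmostAllPlaces

open WithZero IsDedekindDomain Polynomial NumberField Filter TensorProduct
open scoped WithZero

namespace RatPlace

section

variable {K L : Type*} [Field K] [Field L] [Algebra K L] {P Q R : RatPlace K L}
  {v : Valuation K ℤᵐ⁰} {G : Set L}

variable (P v) in
/-- The functions which are regular at `P` with `v`-integral value. -/
def compositeRing : ValuationSubring L where
  carrier := {a | a ∈ P.ring ∧ v (P.ev a) ≤ 1}
  one_mem' := ⟨one_mem _, by simp⟩
  zero_mem' := ⟨zero_mem _, by simp⟩
  mul_mem' := fun ⟨ha, ha'⟩ ⟨hb, hb'⟩ ↦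
    ⟨mul_mem ha hb, by rw [ev_mul ha hb, map_mul]; exact mul_le_one' ha' hb'⟩
  add_mem' := fun ⟨ha, ha'⟩ ⟨hb, hb'⟩ ↦
    ⟨add_mem ha hb, by rw [ev_add ha hb]; exact v.map_add_le ha' hb'⟩
  neg_mem' := fun ⟨ha, ha'⟩ ↦ ⟨neg_mem ha, by rwa [ev_neg ha, v.map_neg]⟩
  mem_or_inv_mem' a := by
    by_cases ha : a ∈ P.ring
    · rcases le_total (v (P.ev a)) 1 with h | h
      · exact Or.inl ⟨ha, h⟩
      · have h0 : P.ev a ≠ 0 := by intro h0; simp [h0] at h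
        exact Or.inr ⟨inv_mem h0, by rw [ev_inv h0, map_inv₀]; exact inv_le_one_of_one_le₀ h⟩
    · have h1 := P.ring.mem_nonunits_iff_or.2 (Or.inr (by rwa [inv_inv]) : a⁻¹ = 0 ∨ _)
      exact Or.inr ⟨mem_ring_of_mem_nonunits h1,
        by rw [(ev_eq_zero_iff (mem_ring_of_mem_nonunits h1)).2 h1]; simp⟩

/-- A tensor, viewed as a function of two points, is `v`-integral and continuous on pairs of points
with the same reduction. -/
def IsIntegralTensor (v : Valuation K ℤᵐ⁰) (G : Set L)
    (u : Algebra.adjoin K G ⊗[K] Algebra.adjoin K G) : Prop :=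
  ∀ (P Q Q' : RatPlace K L) (hQ : P.SameReduction Q v G) (hQ' : P.SameReduction Q' v G),
    v (P.ev (Algebra.TensorProduct.lmul' K u : Algebra.adjoin K G)) ≤ 1 ∧
    v (Algebra.TensorProduct.productMap (Q.evAlgHom _ fun _ ↦ hQ.right.mem_ring)
      (Q'.evAlgHom _ fun _ ↦ hQ'.right.mem_ring) u -
        P.ev (Algebra.TensorProduct.lmul' K u : Algebra.adjoin K G)) < 1

end

variable {K L : Type*} [Field K] [NumberField K] [Field L] [Algebra K L]

theorem eventually_mem_integralRing {G : Set L} {a : L} (ha : a ∈ Algebra.adjoin K G) :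
    ∀ᶠ v : HeightOneSpectrum (𝓞 K) in cofinite, a ∈ integralRing (v.valuation K) G := by
  induction ha using Algebra.adjoin_induction with
  | mem x hx => exact .of_forall fun _ ↦ subset_integralRing hx
  | algebraMap r =>
    filter_upwards [eventually_valuation_le_one r] with v hv using algebraMap_mem_integralRing hv
  | add x y _ _ hx hy => filter_upwards [hx, hy] with v hx hy using add_mem hx hy
  | mul x y _ _ hx hy => filter_upwards [hx, hy] with v hx hy using mul_mem hx hy

theorem eventually_isIntegralTensor {G : Set L}
    (u : Algebra.adjoin K G ⊗[K] Algebra.adjoin K G) :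
    ∀ᶠ v : HeightOneSpectrum (𝓞 K) in cofinite, IsIntegralTensor (v.valuation K) G u := by
  induction u with
  | zero => exact .of_forall fun v P Q Q' hQ hQ' ↦ by simp
  | tmul a b =>
    filter_upwards [eventually_mem_integralRing a.2, eventually_mem_integralRing b.2]
      with v ha hb P Q Q' hQ hQ'
    have haP := hQ.left.integralRing_le ha
    have hbP := hQ.left.integralRing_le hb
    rw [Algebra.TensorProduct.lmul'_apply_tmul, Subalgebra.coe_mul, ev_mul haP.1 hbP.1,
      Algebra.TensorProduct.productMap_apply_tmul, evAlgHom_apply, evAlgHom_apply]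
    refine ⟨by rw [map_mul]; exact mul_le_one' haP.2 hbP.2, ?_⟩
    exact Valuation.map_mul_sub_mul_lt_one (hQ.right.integralRing_le ha).2 hbP.2
      (hQ.symm.sub_lt _ ha) (hQ'.symm.sub_lt _ hb)
  | add u w hu hw =>
    filter_upwards [hu, hw] with v hu hw P Q Q' hQ hQ'
    rw [map_add, map_add, Subalgebra.coe_add, ev_add (hQ.left.mem_ring (Subtype.prop _))
      (hQ.left.mem_ring (Subtype.prop _)), add_sub_add_comm]
    exact ⟨Valuation.map_add_le _ (hu P Q Q' hQ hQ').1 (hw P Q Q' hQ hQ').1,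
      Valuation.map_add_lt _ (hu P Q Q' hQ hQ').2 (hw P Q Q' hQ hQ').2⟩

theorem eventually_smooth {G : Set L} (hG : G.Finite) [IsDedekindDomain (Algebra.adjoin K G)]
    (hB : ¬ IsField (Algebra.adjoin K G)) :
    ∀ᶠ v : HeightOneSpectrum (𝓞 K) in cofinite, ∀ P : RatPlace K L,
      P.IsIntegralAt (v.valuation K) G → ∃ z ∈ integralRing (v.valuation K) G,
        ∀ g ∈ G, HasSlope (v.valuation K) G P z g := by
  have : Algebra.FiniteType K (Algebra.adjoin K G) :=
    (Algebra.adjoin K G).fg_iff_finiteType.1 ⟨hG.toFinset, by simp⟩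
  obtain ⟨ι, _, c, z, u, hcu, hu⟩ := exists_finite_family_lmul'_eq_one K hB
  choose w hw using hu
  have _ : Finite G := hG
  have h1 : ∀ᶠ v : HeightOneSpectrum (𝓞 K) in cofinite, ∀ j,
      (c j : L) ∈ integralRing (v.valuation K) G :=
    eventually_all.2 fun j ↦ eventually_mem_integralRing (c j).2
  have h2 : ∀ᶠ v : HeightOneSpectrum (𝓞 K) in cofinite, ∀ j,
      (z j : L) ∈ integralRing (v.valuation K) G :=
    eventually_all.2 fun j ↦ eventually_mem_integralRing (z j).2
  have h3 : ∀ᶠ v : HeightOneSpectrum (𝓞 K) in cofinite, ∀ j,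
      IsIntegralTensor (v.valuation K) G (u j) :=
    eventually_all.2 fun j ↦ eventually_isIntegralTensor (u j)
  have h4 : ∀ᶠ v : HeightOneSpectrum (𝓞 K) in cofinite, ∀ j, ∀ g : G,
      IsIntegralTensor (v.valuation K) G (w j ⟨g, Algebra.subset_adjoin g.2⟩) :=
    eventually_all.2 fun j ↦ eventually_all.2 fun g ↦ eventually_isIntegralTensor _
  filter_upwards [h1, h2, h3, h4] with v hc hz hu hw' P hP
  set μ := Algebra.TensorProduct.lmul' K (S := Algebra.adjoin K G)
  have hPP := SameReduction.refl hP
  obtain ⟨j, hj⟩ : ∃ j, v.valuation K (P.ev (μ (u j) : Algebra.adjoin K G)) = 1 := by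
    by_contra! hne
    have hlt : ∀ j, v.valuation K (P.ev (μ (u j) : Algebra.adjoin K G)) < 1 := fun j ↦
      lt_of_le_of_ne (hu j P P P hPP hPP).1 (hne j)
    have h1 := congrArg (P.evAlgHom _ fun _ ↦ hP.mem_ring) hcu
    rw [map_sum, map_one] at h1
    have h2 : v.valuation K (∑ j, P.evAlgHom _ (fun _ ↦ hP.mem_ring) (c j * μ (u j))) < 1 := by
      refine Valuation.map_sum_lt _ one_ne_zero fun j _ ↦ ?_
      rw [map_mul, map_mul]
      exact (mul_le_of_le_one_left' (hP.integralRing_le (hc j)).2).trans_lt (hlt j)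
    rw [h1, map_one] at h2
    exact h2.ne rfl
  refine ⟨z j, hz j, fun g hg ↦ ?_⟩
  set b : Algebra.adjoin K G := ⟨g, Algebra.subset_adjoin hg⟩ with hb
  have hwg := hw' j ⟨g, hg⟩
  refine ⟨P.ev (μ (w j b) : Algebra.adjoin K G) / P.ev (μ (u j) : Algebra.adjoin K G), ?_,
    fun Q Q' hQ hQ' ↦ ?_⟩
  · rw [map_div₀, hj, div_one]
    exact (hwg P P P hPP hPP).1
  set χ := Algebra.TensorProduct.productMap (Q'.evAlgHom (Algebra.adjoin K G)
    fun _ ↦ hQ'.right.mem_ring) (Q.evAlgHom _ fun _ ↦ hQ.right.mem_ring)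
  have hU := hu j P Q' Q hQ' hQ
  have hW := hwg P Q' Q hQ' hQ
  have hU1 : v.valuation K (χ (u j)) = 1 :=
    Valuation.map_eq_one_of_sub_lt hj (by rw [Valuation.map_sub_swap]; exact hU.2)
  have hU0 : χ (u j) ≠ 0 := by intro h0; simp [h0] at hU1
  have hP0 := ne_zero_of_map_ev_eq_one hj
  refine ⟨χ (w j b) / χ (u j), ?_, ?_⟩
  · rw [div_sub_div _ _ hU0 hP0, map_div₀, map_mul, hU1, hj, mul_one, div_one,
      mul_comm _ (P.ev (μ (u j) : Algebra.adjoin K G)), mul_comm]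
    rw [mul_comm (χ (w j b))]
    refine Valuation.map_mul_sub_mul_lt_one hj.le hW.1 ?_ hW.2
    rw [Valuation.map_sub_swap]; exact hU.2
  · have := congrArg χ (hw j b)
    simp only [map_mul, map_sub, χ, Algebra.TensorProduct.productMap_apply_tmul, map_one, one_mul,
      mul_one, evAlgHom_apply] at this
    rw [div_mul_eq_mul_div, eq_div_iff hU0, mul_comm]
    exact this

end RatPlace

open RatPlace

namespace IsChartPair

variable {K L : Type*} [Field K] [NumberField K] [Field L] [Algebra K L]
  {τ : Bool → L} {G : Bool → Set L}

theorem eventually_isIntegralAt (h : IsChartPair K τ G) :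
    ∀ᶠ v : HeightOneSpectrum (𝓞 K) in cofinite, ∀ (P : RatPlace K L) (i : Bool),
      τ i ∈ P.compositeRing (v.valuation K) → P.IsIntegralAt (v.valuation K) (G i) := by
  have key : ∀ i, ∀ g : G i, ∀ᶠ v : HeightOneSpectrum (𝓞 K) in cofinite, ∀ P : RatPlace K L,
      τ i ∈ P.compositeRing (v.valuation K) → (g : L) ∈ P.compositeRing (v.valuation K) := by
    intro i g
    obtain ⟨p, hp, hc, h0⟩ := exists_monic_of_isIntegral (h.isIntegral i g g.2)
    have hcoeff : ∀ᶠ v : HeightOneSpectrum (𝓞 K) in cofinite, ∀ n ∈ p.support,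
        p.coeff n ∈ integralRing (v.valuation K) {τ i} :=
      (eventually_all_finset _).2 fun n _ ↦ eventually_mem_integralRing (hc n)
    filter_upwards [hcoeff] with v hv P hP
    refine ValuationSubring.mem_of_monic_of_eval_eq_zero _ hp (fun n ↦ ?_) h0
    by_cases hn : n ∈ p.support
    · exact integralRing_le (S := (P.compositeRing (v.valuation K)).toSubring)
        (fun r hr ↦ ⟨P.algebraMap_mem r, by simpa using hr⟩) (by simpa using hP) (hv n hn)
    · rw [notMem_support_iff.1 hn]; exact zero_mem _
  have hfin (i : Bool) : Finite (G i) := h.finite i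
  filter_upwards [eventually_all.2 fun i ↦ eventually_all.2 (key i)] with v hv P i hP g hg
  exact hv i ⟨g, hg⟩ P hP

theorem eventually_isGoodReduction (h : IsChartPair K τ G) (φ : L →ₐ[K] L) :
    ∀ᶠ v : HeightOneSpectrum (𝓞 K) in cofinite, IsGoodReduction (v.valuation K) G φ := by
  have hfin (i : Bool) : Finite (G i) := h.finite i
  have hsm := eventually_all.2 fun i ↦
    have := h.isDedekindDomain i
    eventually_smooth (h.finite i) (h.not_isField i)
  choose N hN using h.exists_pow_mul_mem
  have hgl := eventually_all.2 fun i ↦ eventually_all.2 fun g : G (!i) ↦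
    eventually_mem_integralRing (hN i g g.2)
  choose b hb hb1 hbφ using h.exists_add_eq_one φ
  have hbI := eventually_all.2 fun i ↦ eventually_all.2 fun j ↦
    eventually_mem_integralRing (hb i j)
  have hbφI := eventually_all.2 fun i ↦ eventually_all.2 fun j ↦ eventually_all.2 fun g : G j ↦
    eventually_mem_integralRing (hbφ i j g g.2)
  filter_upwards [h.eventually_isIntegralAt, hsm, hgl, hbI, hbφI] with v hint hsm hgl hbI hbφI
  refine ⟨fun P ↦ ?_, fun i j P hi hj g hg ↦ ?_, fun i P hP ↦ ?_, hsm⟩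
  · rcases (P.compositeRing (v.valuation K)).mem_or_inv_mem (τ true) with h1 | h1
    · exact ⟨_, hint P _ h1⟩
    · rw [inv_eq_of_mul_eq_one_right (h.mul_eq_one true)] at h1
      exact ⟨_, hint P _ h1⟩
  · obtain rfl | rfl : j = i ∨ j = !i := by cases i <;> cases j <;> simp
    · exact integralRing_le_localRing (subset_integralRing hg)
    · have hi1 := hi _ (h.mem i)
      have hj1 := hj _ (h.mem _)
      have h1 : v.valuation K (P.ev (τ i)) = 1 := by
        refine le_antisymm hi1.2 ?_
        have h2 := congrArg (fun a ↦ v.valuation K (P.ev a)) (h.mul_eq_one i)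
        simp only [ev_mul hi1.1 hj1.1, map_mul, ev_one, map_one] at h2
        rw [← h2]
        exact mul_le_of_le_one_right' hj1.2
      refine ⟨_, pow_mem (subset_integralRing (h.mem i)) _, ?_, hgl i ⟨g, hg⟩⟩
      generalize N i g hg = n
      induction n with
      | zero => simp
      | succ n ih => rw [pow_succ]; exact map_ev_mul_eq_one ih h1
  · have hbP := fun j ↦ hP.integralRing_le (hbI i j)
    obtain ⟨j, hj⟩ : ∃ j, v.valuation K (P.ev (b i j)) = 1 := by
      by_contra! hne
      have h1 := congrArg (fun a ↦ v.valuation K (P.ev a)) (hb1 i)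
      simp only [ev_add (hbP _).1 (hbP _).1, ev_one, map_one] at h1
      exact (Valuation.map_add_lt _ (lt_of_le_of_ne (hbP true).2 (hne _))
        (lt_of_le_of_ne (hbP false).2 (hne _))).ne h1
    exact ⟨j, fun g hg ↦ ⟨_, hbI i j, hj, hbφI i j ⟨g, hg⟩⟩⟩

theorem exists_iterate_eq {K : Type} {L : Type*} [Field K] [NumberField K] [Field L] [Algebra K L]
    {τ : Bool → L} {G : Bool → Set L} (h : IsChartPair K τ G) (φ : L →ₐ[K] L) :
    ∃ N, ∀ Q Q' : RatPlace K L, (∃ s, (RatPlace.comap φ)^[s] Q = (RatPlace.comap φ)^[s] Q') →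
      (RatPlace.comap φ)^[N] Q = (RatPlace.comap φ)^[N] Q' := by
  obtain ⟨v, hv⟩ := (h.eventually_isGoodReduction φ).exists
  have := h.isDedekindDomain
  have := h.isFractionRing
  exact hv.exists_iterate_eq (hasFiniteQuotients_valuation v) h.finite

end IsChartPair

end AlmostAllPlaces

section ExistsCharts

open Polynomial
open scoped IntermediateField.algebraAdjoinAdjoin

variable {K L : Type*} [Field K] [Field L] [Algebra K L]

theorem exists_finite_chart [CharZero K] {t : L} (ht : Transcendental K t)
    [FiniteDimensional (IntermediateField.adjoin K {t}) L] :
    ∃ G : Set L, G.Finite ∧ t ∈ G ∧ (∀ g ∈ G, IsIntegral (Algebra.adjoin K {t}) g) ∧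
      IsDedekindDomain (Algebra.adjoin K G) ∧ IsFractionRing (Algebra.adjoin K G) L ∧
      ¬ IsField (Algebra.adjoin K G) := by
  let A := Algebra.adjoin K {t}
  let F := IntermediateField.adjoin K {t}
  have hinj := transcendental_iff_injective.1 ht
  let e : K[X] ≃ₐ[K] A := (AlgEquiv.ofInjective _ hinj).trans
    (Subalgebra.equivOfEq _ _ (Algebra.adjoin_singleton_eq_range_aeval K t).symm)
  have : IsPrincipalIdealRing A :=
    IsPrincipalIdealRing.of_surjective (e : K[X] →+* A) e.surjective
  have : IsDedekindDomain A := inferInstance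
  have hC := integralClosure.isDedekindDomain A F L
  have hfr := integralClosure.isFractionRing_of_finite_extension (A := A) F L
  have hfin : Module.Finite A (integralClosure A L) := IsIntegralClosure.finite A F L _
  let B : Subalgebra K L := (integralClosure A L).restrictScalars K
  have hA : Algebra.FiniteType K A := (Subalgebra.fg_iff_finiteType _).1 ⟨{t}, by simp [A]⟩
  have hB : B.FG := by
    refine (Subalgebra.fg_iff_finiteType _).2 ?_
    have : IsScalarTower K A (integralClosure A L) := IsScalarTower.of_algebraMap_eq fun _ ↦ rfl
    have : Algebra.FiniteType K (integralClosure A L) :=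
      Algebra.FiniteType.trans (S := A) hA inferInstance
    exact this
  obtain ⟨S, hS⟩ := hB
  have htB : t ∈ B := isIntegral_algebraMap (R := A) (x := ⟨t, Algebra.subset_adjoin rfl⟩)
  have hSB : Algebra.adjoin K (insert t (S : Set L)) = B := by
    refine le_antisymm (Algebra.adjoin_le (Set.insert_subset htB ?_)) ?_
    · exact Algebra.subset_adjoin.trans hS.le
    · exact hS.ge.trans (Algebra.adjoin_mono (Set.subset_insert _ _))
  refine ⟨insert t S, S.finite_toSet.insert t, Set.mem_insert _ _, fun g hg ↦ ?_, ?_⟩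
  · exact (hSB.le (Algebra.subset_adjoin hg) : g ∈ B)
  rw [hSB]
  refine ⟨hC, hfr, fun hf ↦ ?_⟩
  have : IsField A := isField_of_isIntegral_of_isField (S := integralClosure A L)
    (fun _ _ h ↦ Subtype.ext (congrArg (Subtype.val (p := (· ∈ integralClosure A L))) h)) hf
  exact Polynomial.not_isField K (e.toMulEquiv.isField this)

theorem exists_isChartPair [CharZero K] {t : L} (ht : Transcendental K t)
    [FiniteDimensional (IntermediateField.adjoin K {t}) L] :
    ∃ (τ : Bool → L) (G : Bool → Set L), IsChartPair K τ G := by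
  have h0 : t ≠ 0 := fun h ↦ ht (h ▸ isAlgebraic_zero)
  have ht' : Transcendental K t⁻¹ := fun h ↦ ht (IsAlgebraic.inv_iff.1 h)
  have he : IntermediateField.adjoin K {t⁻¹} = IntermediateField.adjoin K {t} := by
    refine le_antisymm ?_ ?_ <;> rw [IntermediateField.adjoin_simple_le_iff]
    · exact inv_mem (IntermediateField.mem_adjoin_simple_self K t)
    · simpa using inv_mem (IntermediateField.mem_adjoin_simple_self K t⁻¹)
  have : FiniteDimensional (IntermediateField.adjoin K {t⁻¹}) L := by rw [he]; infer_instance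
  obtain ⟨G, hG⟩ := exists_finite_chart ht
  obtain ⟨G', hG'⟩ := exists_finite_chart ht'
  refine ⟨fun i ↦ if i then t else t⁻¹, fun i ↦ if i then G else G', ?_, ?_, ?_, ?_, ?_, ?_, ?_⟩
  · rintro (_ | _) <;> simp [h0]
  · exact Bool.forall_bool.2 ⟨hG'.1, hG.1⟩
  · exact Bool.forall_bool.2 ⟨hG'.2.1, hG.2.1⟩
  · exact Bool.forall_bool.2 ⟨hG'.2.2.1, hG.2.2.1⟩
  · exact Bool.forall_bool.2 ⟨hG'.2.2.2.1, hG.2.2.2.1⟩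
  · exact Bool.forall_bool.2 ⟨hG'.2.2.2.2.1, hG.2.2.2.2.1⟩
  · exact Bool.forall_bool.2 ⟨hG'.2.2.2.2.2, hG.2.2.2.2.2⟩

end ExistsCharts

section Iterates

namespace Function

theorem iterate_eq_of_le {α : Type*} {f : α → α} {x y : α} {m n : ℕ} (hmn : m ≤ n)
    (h : f^[m] x = f^[m] y) : f^[n] x = f^[n] y := by
  obtain ⟨k, rfl⟩ := Nat.exists_eq_add_of_le' hmn
  rw [iterate_add_apply, h, ← iterate_add_apply]

theorem exists_iterate_eq_of_finite {α : Type*} (f : α → α) {E : Set α} (hE : E.Finite) :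
    ∃ N, ∀ x ∈ E, ∀ y ∈ E, (∃ s, f^[s] x = f^[s] y) → f^[N] x = f^[N] y := by
  have key : ∀ z : α × α, ∃ N, (∃ s, f^[s] z.1 = f^[s] z.2) → f^[N] z.1 = f^[N] z.2 := fun z ↦ by
    by_cases h : ∃ s, f^[s] z.1 = f^[s] z.2
    · exact ⟨h.choose, fun _ ↦ h.choose_spec⟩
    · exact ⟨0, fun h' ↦ absurd h' h⟩
  choose N hN using key
  obtain ⟨B, hB⟩ := ((hE.prod hE).image N).bddAbove
  exact ⟨B, fun x hx y hy h ↦ iterate_eq_of_le (hB ⟨(x, y), ⟨hx, hy⟩, rfl⟩) (hN (x, y) h)⟩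

theorem exists_iterate_mem_of_finite {α : Type*} (f : α → α) {S : Set α} (hS : Set.MapsTo f S S)
    (hE : Sᶜ.Finite) : ∃ N, ∀ x, (∃ s, f^[s] x ∈ S) → f^[N] x ∈ S := by
  have key : ∀ x : α, ∃ N, (∃ s, f^[s] x ∈ S) → f^[N] x ∈ S := fun x ↦ by
    by_cases h : ∃ s, f^[s] x ∈ S
    · exact ⟨h.choose, fun _ ↦ h.choose_spec⟩
    · exact ⟨0, fun h' ↦ absurd h' h⟩
  choose N hN using key
  obtain ⟨B, hB⟩ := (hE.image N).bddAbove
  refine ⟨B, fun x h ↦ ?_⟩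
  by_cases hx : x ∈ S
  · exact hS.iterate B hx
  · obtain ⟨k, hk⟩ := Nat.exists_eq_add_of_le' (hB ⟨x, hx, rfl⟩)
    rw [hk, iterate_add_apply]
    exact hS.iterate k (hN x h)

variable {α β : Type*} {F : α → α} {f : β → β} {π : α → β}

theorem Semiconj.iterate_eq_of_finite (hπ : Semiconj π F f)
    (hD : {z : α × α | z.1 ≠ z.2 ∧ π z.1 = π z.2}.Finite) {N : ℕ}
    (hN : ∀ P Q, (∃ s, F^[s] P = F^[s] Q) → F^[N] P = F^[N] Q) {P Q : α}
    (h : ∃ s, f^[s] (π P) = f^[s] (π Q)) : f^[N] (π P) = f^[N] (π Q) := by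
  by_cases hm : ∃ n, F^[n] P = F^[n] Q
  · rw [← (hπ.iterate_right N).eq, hN P Q hm, (hπ.iterate_right N).eq]
  push Not at hm
  obtain ⟨s, hs⟩ := h
  have hπs (n : ℕ) (hn : s ≤ n) : π (F^[n] P) = π (F^[n] Q) := by
    rw [(hπ.iterate_right n).eq, (hπ.iterate_right n).eq, iterate_eq_of_le hn hs]
  obtain ⟨m, n, hmn, he⟩ : ∃ m n : ℕ, m < n ∧
      (F^[s + m] P, F^[s + m] Q) = (F^[s + n] P, F^[s + n] Q) := by
    have hmaps : Set.MapsTo (fun n ↦ (F^[s + n] P, F^[s + n] Q)) Set.univ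
        {z : α × α | z.1 ≠ z.2 ∧ π z.1 = π z.2} := fun n _ ↦ ⟨hm _, hπs _ (by omega)⟩
    obtain ⟨m, -, n, -, hmn, he⟩ := Set.infinite_univ.exists_lt_map_eq_of_mapsTo hmaps hD
    exact ⟨m, n, hmn, he⟩
  obtain ⟨k, rfl⟩ := Nat.exists_eq_add_of_lt hmn
  have key (R : α) (hR : F^[s + m] R = F^[s + (m + k + 1)] R) :
      F^[N] R = F^[N + s * (k + 1)] R := by
    have hper : IsPeriodicPt F (k + 1) (F^[s + m] R) := by
      rw [IsPeriodicPt, IsFixedPt, ← iterate_add_apply, hR,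
        show k + 1 + (s + m) = s + (m + k + 1) by omega]
    rw [iterate_add_apply]
    refine hN _ _ ⟨s + m, ?_⟩
    rw [← iterate_add_apply, add_comm (s + m) (s * (k + 1)), iterate_add_apply F (s * (k + 1)),
      mul_comm]
    exact (hper.mul_const s).symm
  rw [Prod.mk.injEq] at he
  have hle : s ≤ N + s * (k + 1) := by nlinarith
  rw [← (hπ.iterate_right N).eq, ← (hπ.iterate_right N).eq, key P he.1, key Q he.2, hπs _ hle]

theorem Semiconj.exists_iterate_eq_of_finite (hπ : Semiconj π F f) (hE : (Set.range π)ᶜ.Finite)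
    (hD : {z : α × α | z.1 ≠ z.2 ∧ π z.1 = π z.2}.Finite)
    (hF : ∃ N, ∀ P Q, (∃ s, F^[s] P = F^[s] Q) → F^[N] P = F^[N] Q) :
    ∃ N, ∀ x y, (∃ s, f^[s] x = f^[s] y) → f^[N] x = f^[N] y := by
  obtain ⟨N, hN⟩ := hF
  have hS : Set.MapsTo f (Set.range π) (Set.range π) := by
    rintro _ ⟨P, rfl⟩
    exact ⟨F P, hπ.eq P⟩
  obtain ⟨e, he⟩ := exists_iterate_mem_of_finite f hS hE
  obtain ⟨M, hM⟩ := Function.exists_iterate_eq_of_finite f hE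
  refine ⟨max (N + e) M, fun x y ⟨s, hs⟩ ↦ ?_⟩
  by_cases hx : ∃ n, f^[n] x ∈ Set.range π
  · have hx' := he x hx
    have hy' : f^[e] y ∈ Set.range π := by
      refine he y ⟨s + e, ?_⟩
      rw [← iterate_eq_of_le (Nat.le_add_right s e) hs, iterate_add_apply]
      exact hS.iterate s hx'
    obtain ⟨P, hP⟩ := hx'
    obtain ⟨Q, hQ⟩ := hy'
    refine iterate_eq_of_le (le_max_left _ _) ?_
    rw [iterate_add_apply, iterate_add_apply, ← hP, ← hQ]
    refine hπ.iterate_eq_of_finite hD hN ⟨s, ?_⟩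
    rw [hP, hQ, ← iterate_add_apply, ← iterate_add_apply]
    exact iterate_eq_of_le (Nat.le_add_right s e) hs
  · have hy : y ∉ Set.range π := fun hy ↦ hx ⟨s, hs ▸ hS.iterate s hy⟩
    exact iterate_eq_of_le (le_max_right _ _) (hM x (fun h ↦ hx ⟨0, h⟩) y hy ⟨s, hs⟩)

end Function

end Iterates

section AffineCharts

open RatPlace

theorem Ideal.finite_setOf_isPrime_mem {A : Type*} [CommRing A] [IsDomain A] [IsNoetherianRing A]
    [Ring.KrullDimLE 1 A] {s : A} (hs : s ≠ 0) : {I : Ideal A | I.IsPrime ∧ s ∈ I}.Finite := by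
  refine (Ideal.finite_minimalPrimes_of_isNoetherianRing A (Ideal.span {s})).subset ?_
  rintro I ⟨hI, hsI⟩
  obtain ⟨q, hq, hqI⟩ := Ideal.exists_minimalPrimes_le ((Ideal.span_singleton_le_iff_mem I).2 hsI)
  have hsq : s ∈ q := hq.1.2 (Ideal.mem_span_singleton_self s)
  have hqm := hq.1.1.isMaximal_of_ne_bot fun h ↦ hs (by simpa [h] using hsq)
  rwa [← hqm.eq_of_le hI.ne_top hqI]

theorem AlgHom.ker_injective {K A : Type*} [Field K] [CommRing A] [Algebra K A] :
    Function.Injective fun χ : A →ₐ[K] K ↦ RingHom.ker χ := by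
  intro χ ψ h
  ext a
  have h' : RingHom.ker χ = RingHom.ker ψ := h
  have ha : a - algebraMap K A (χ a) ∈ RingHom.ker ψ := by
    rw [← h', RingHom.mem_ker]; simp
  rw [RingHom.mem_ker] at ha
  rw [map_sub, AlgHom.commutes, sub_eq_zero] at ha
  exact ha.symm

theorem AlgHom.subsingleton_of_isAlgebraic {K A : Type*} [Field K] [CommRing A] [IsDomain A]
    [Algebra K A] [Algebra.IsAlgebraic K A] : Subsingleton (A →ₐ[K] K) := by
  refine ⟨fun χ ψ ↦ AlgHom.ker_injective ?_⟩
  have hA : IsField A := Algebra.IsIntegral.isField_iff_isField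
    (FaithfulSMul.algebraMap_injective K A) |>.1 (Field.toIsField K)
  let := hA.toField
  have key (χ : A →ₐ[K] K) : RingHom.ker χ = ⊥ :=
    (RingHom.injective_iff_ker_eq_bot _).1 (χ : A →+* K).injective
  exact (key χ).trans (key ψ).symm

theorem Ring.KrullDimLE.of_isIntegral {R A : Type*} [CommRing R] [CommRing A] [IsDomain A]
    [IsDomain R] [Algebra R A] [FaithfulSMul R A] [Algebra.IsIntegral R A]
    [Ring.KrullDimLE 1 A] : Ring.KrullDimLE 1 R := by
  refine Ring.krullDimLE_one_iff_of_noZeroDivisors.2 fun I hI hIp ↦ ?_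
  obtain ⟨Q, hQ, hQI⟩ := Ideal.exists_ideal_over_prime_of_isIntegral_of_isDomain (S := A) I
    (by rw [(RingHom.injective_iff_ker_eq_bot _).1 (FaithfulSMul.algebraMap_injective R A)]
        exact bot_le)
  have := hQ.isMaximal_of_ne_bot fun h ↦ hI (by
    rw [← hQI, h]
    exact (RingHom.injective_iff_ker_eq_bot _).1 (FaithfulSMul.algebraMap_injective R A))
  rw [← hQI]
  exact Ideal.isMaximal_comap_of_isIntegral_of_isMaximal Q

variable {K L A : Type*} [Field K] [Field L] [Algebra K L] [CommRing A] [IsDomain A] [Algebra K A]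
  [Algebra A L] [IsScalarTower K A L] [IsFractionRing A L]

theorem exists_isChartPair_of_finiteType [CharZero K] [Algebra.FiniteType K A]
    [Ring.KrullDimLE 1 A] (hKA : ¬ Algebra.IsAlgebraic K A) :
    ∃ (τ : Bool → L) (G : Bool → Set L), IsChartPair K τ G := by
  obtain ⟨d, g, hg, hint⟩ := exists_integral_inj_algHom_of_fg K A
  let := g.toRingHom.toAlgebra
  have : IsScalarTower K (MvPolynomial (Fin d) K) A := IsScalarTower.of_algHom g
  have : FaithfulSMul (MvPolynomial (Fin d) K) A := (faithfulSMul_iff_algebraMap_injective _ _).2 hg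
  have : Algebra.IsIntegral (MvPolynomial (Fin d) K) A := ⟨hint⟩
  have hdim : Ring.KrullDimLE 1 (MvPolynomial (Fin d) K) := Ring.KrullDimLE.of_isIntegral (A := A)
  have hd : d ≤ 1 := by
    have h1 : ringKrullDim (MvPolynomial (Fin d) K) ≤ (1 : ℕ) := (Order.krullDimLE_iff _ _).1 hdim
    rw [MvPolynomial.ringKrullDim_of_isNoetherianRing, ringKrullDim_eq_zero_of_field, zero_add,
      Nat.card_fin] at h1
    exact_mod_cast h1
  obtain rfl | rfl : d = 0 ∨ d = 1 := by omega
  · refine absurd ?_ hKA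
    have : Algebra.IsIntegral K (MvPolynomial (Fin 0) K) :=
      ⟨(RingHom.isIntegral_of_surjective _ (MvPolynomial.C_surjective _))⟩
    have : Algebra.IsIntegral K A := Algebra.IsIntegral.trans (MvPolynomial (Fin 0) K)
    infer_instance
  set t : L := algebraMap A L (g (MvPolynomial.X 0)) with ht
  have hcomp (q : MvPolynomial (Fin 1) K) :
      algebraMap A L (g q) ∈ IntermediateField.adjoin K {t} := by
    induction q using MvPolynomial.induction_on with
    | C a =>
      rw [← MvPolynomial.algebraMap_eq, AlgHom.commutes, ← IsScalarTower.algebraMap_apply]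
      exact IntermediateField.algebraMap_mem _ _
    | add p q hp hq => rw [map_add, map_add]; exact add_mem hp hq
    | mul_X p n hp =>
      rw [map_mul, map_mul, Subsingleton.elim n 0]
      exact mul_mem hp (IntermediateField.mem_adjoin_simple_self K t)
  have htr : Transcendental K t := by
    have h1 : Transcendental K (MvPolynomial.X 0 : MvPolynomial (Fin 1) K) :=
      MvPolynomial.transcendental_X K 0
    rw [ht, transcendental_algebraMap_iff (FaithfulSMul.algebraMap_injective A L)]
    exact (transcendental_algebraMap_iff (R := K) (S := MvPolynomial (Fin 1) K) (A := A) hg).2 h1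
  have hintA (a : A) : IsIntegral (IntermediateField.adjoin K {t}) (algebraMap A L a) := by
    obtain ⟨q, hq, h0⟩ := hint a
    let c : MvPolynomial (Fin 1) K →+* IntermediateField.adjoin K {t} :=
      ((algebraMap A L).comp g.toRingHom).codRestrict _ hcomp
    refine ⟨q.map c, hq.map c, ?_⟩
    rw [Polynomial.eval₂_map]
    have : (algebraMap (IntermediateField.adjoin K {t}) L).comp c =
      (algebraMap A L).comp g.toRingHom := rfl
    rw [this, ← Polynomial.hom_eval₂, h0, map_zero]
  obtain ⟨S, hS⟩ := (Algebra.FiniteType.out : (⊤ : Subalgebra K A).FG)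
  have hfin : FiniteDimensional (IntermediateField.adjoin K {t}) L := by
    have h1 := IntermediateField.finiteDimensional_adjoin (K := IntermediateField.adjoin K {t})
      (L := L) (S := algebraMap A L '' S) (by rintro _ ⟨a, -, rfl⟩; exact hintA a)
    have htop : IntermediateField.adjoin (IntermediateField.adjoin K {t}) (algebraMap A L '' S) =
        ⊤ := by
      have hA (a : A) : algebraMap A L a ∈
          IntermediateField.adjoin (IntermediateField.adjoin K {t}) (algebraMap A L '' S) := by
        have ha : a ∈ Algebra.adjoin K (S : Set A) := hS ▸ Algebra.mem_top
        induction ha using Algebra.adjoin_induction with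
        | mem a ha => exact IntermediateField.subset_adjoin _ _ ⟨a, ha, rfl⟩
        | algebraMap k =>
          rw [← IsScalarTower.algebraMap_apply,
            IsScalarTower.algebraMap_apply K (IntermediateField.adjoin K {t})]
          exact IntermediateField.algebraMap_mem _ _
        | add a b _ _ ha hb => rw [map_add]; exact add_mem ha hb
        | mul a b _ _ ha hb => rw [map_mul]; exact mul_mem ha hb
      refine eq_top_iff.2 fun x _ ↦ ?_
      obtain ⟨a, b, -, rfl⟩ := IsFractionRing.div_surjective (A := A) x
      exact div_mem (hA a) (hA b)
    rw [htop] at h1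
    exact Module.Finite.equiv IntermediateField.topEquiv.toLinearEquiv
  exact exists_isChartPair htr

end AffineCharts

section AffinePoints

open RatPlace IsDedekindDomain

variable {K L : Type*} [Field K] [Field L] [Algebra K L]

theorem RatPlace.isUnit_of_not_mem_nonunits {V : ValuationSubring L} {d : L}
    (hd : d ∉ V.nonunits) : d⁻¹ ∈ V := by
  rw [ValuationSubring.mem_nonunits_iff_or] at hd
  push Not at hd
  exact hd.2

namespace IsChartPair

variable {τ : Bool → L} {G : Bool → Set L}

theorem exists_adjoin_le (h : IsChartPair K τ G) (P : RatPlace K L) :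
    ∃ i, ∀ b ∈ Algebra.adjoin K (G i), b ∈ P.ring := by
  have key (i : Bool) (hi : τ i ∈ P.ring) : ∀ b ∈ Algebra.adjoin K (G i), b ∈ P.ring := by
    have hle (S : Set L) (hS : ∀ g ∈ S, g ∈ P.ring) : ∀ b ∈ Algebra.adjoin K S, b ∈ P.ring := by
      intro b hb
      induction hb using Algebra.adjoin_induction with
      | mem a ha => exact hS a ha
      | algebraMap k => exact P.algebraMap_mem k
      | add a b _ _ ha hb => exact add_mem ha hb
      | mul a b _ _ ha hb => exact mul_mem ha hb
    refine hle _ fun g hg ↦ ?_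
    obtain ⟨p, hp, hc, h0⟩ := exists_monic_of_isIntegral (h.isIntegral i g hg)
    exact ValuationSubring.mem_of_monic_of_eval_eq_zero _ hp
      (fun n ↦ hle {τ i} (by simpa using hi) _ (hc n)) h0
  rcases P.ring.mem_or_inv_mem (τ true) with h1 | h1
  · exact ⟨_, key _ h1⟩
  · rw [inv_eq_of_mul_eq_one_right (h.mul_eq_one true)] at h1
    exact ⟨_, key _ h1⟩

/-- A nonzero function has finitely many rational zeros. -/
theorem finite_setOf_mem_nonunits (h : IsChartPair K τ G) {a : L} (ha : a ≠ 0) :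
    {P : RatPlace K L | a ∈ P.ring.nonunits}.Finite := by
  have key (i : Bool) : {P : RatPlace K L | a ∈ P.ring.nonunits ∧
      ∀ b ∈ Algebra.adjoin K (G i), b ∈ P.ring}.Finite := by
    have := h.isDedekindDomain i
    have := h.isFractionRing i
    obtain ⟨n, d, hd, hnd⟩ := IsFractionRing.div_surjective (A := Algebra.adjoin K (G i)) a
    have hd0 : (d : L) ≠ 0 := by simpa using nonZeroDivisors.ne_zero hd
    have hn : n = a * d := by rw [← hnd]; exact (div_mul_cancel₀ _ hd0).symm
    have hn0 : n ≠ 0 := fun h0 ↦ by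
      rw [h0] at hn
      exact (mul_ne_zero ha hd0) hn.symm
    refine Set.Finite.of_finite_image (f := fun P : RatPlace K L ↦
      ({b | (b : L) ∈ P.ring.nonunits} : Set (Algebra.adjoin K (G i)))) ?_ ?_
    · refine ((Ideal.finite_setOf_isPrime_mem hn0).image
        (fun I : Ideal (Algebra.adjoin K (G i)) ↦ (I : Set (Algebra.adjoin K (G i))))).subset ?_
      rintro _ ⟨P, ⟨hP, hB⟩, rfl⟩
      refine ⟨RingHom.ker (P.evAlgHom _ hB), ⟨RingHom.ker_isPrime _, ?_⟩, ?_⟩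
      · rw [RingHom.mem_ker, evAlgHom_apply, ev_eq_zero_iff (hB _ n.2), hn, mul_comm]
        exact mul_mem_nonunits (hB _ d.2) hP
      · ext b
        simp [RingHom.mem_ker, ev_eq_zero_iff (hB _ b.2)]
    · rintro P ⟨-, hP⟩ Q ⟨-, hQ⟩ hPQ
      refine ext_of_isDedekindDomain _ hP hQ fun b hb ↦ ?_
      have hk : b - algebraMap K L (P.ev b) ∈ Q.ring.nonunits := by
        have h1 := sub_ev_mem (hP b hb)
        have h2 := Set.ext_iff.1 hPQ (⟨b, hb⟩ - algebraMap K _ (P.ev b))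
        exact h2.1 h1
      exact (ev_eq_of_sub_mem hk).symm
  refine ((key true).union (key false)).subset fun P hP ↦ ?_
  obtain ⟨i, hi⟩ := h.exists_adjoin_le P
  cases i
  · exact .inr ⟨hP, hi⟩
  · exact .inl ⟨hP, hi⟩

variable {A : Type*} [CommRing A] [Algebra K A] [Algebra A L]
  [IsScalarTower K A L] [IsFractionRing A L]

theorem exists_mul_pow_eq [IsDomain A] (h : IsChartPair K τ G) (i : Bool) : ∃ s : A, s ≠ 0 ∧
    ∀ b ∈ Algebra.adjoin K (G i), ∃ (n : ℕ) (c : A),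
      b * algebraMap A L s ^ n = algebraMap A L c := by
  obtain ⟨⟨s, hs⟩, hsG⟩ := IsLocalization.exist_integer_multiples_of_finset (nonZeroDivisors A)
    (h.finite i).toFinset
  refine ⟨s, nonZeroDivisors.ne_zero hs, fun b hb ↦ ?_⟩
  induction hb using Algebra.adjoin_induction with
  | mem g hg =>
    obtain ⟨c, hc⟩ := hsG g (by simpa using hg)
    exact ⟨1, c, by rw [hc, pow_one, Algebra.smul_def, mul_comm]⟩
  | algebraMap k => exact ⟨0, algebraMap K A k, by
      rw [pow_zero, mul_one, ← IsScalarTower.algebraMap_apply]⟩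
  | add a b _ _ ha hb =>
    obtain ⟨m, c, hc⟩ := ha
    obtain ⟨n, d, hd⟩ := hb
    refine ⟨m + n, c * s ^ n + d * s ^ m, ?_⟩
    simp only [map_add, map_mul, map_pow, ← hc, ← hd]
    ring
  | mul a b _ _ ha hb =>
    obtain ⟨m, c, hc⟩ := ha
    obtain ⟨n, d, hd⟩ := hb
    refine ⟨m + n, c * d, ?_⟩
    simp only [map_mul, ← hc, ← hd]
    ring

theorem exists_ratPlace (h : IsChartPair K τ G) (i : Bool) {s : A}
    (hs : ∀ b ∈ Algebra.adjoin K (G i), ∃ (n : ℕ) (c : A),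
      b * algebraMap A L s ^ n = algebraMap A L c) (χ : A →ₐ[K] K) (hχ : χ s ≠ 0) :
    ∃ P : RatPlace K L, ∀ a, algebraMap A L a ∈ P.ring ∧ P.ev (algebraMap A L a) = χ a := by
  have := h.isDedekindDomain i
  have := h.isFractionRing i
  let e : A ≃+* (algebraMap A L).range := RingEquiv.ofBijective (algebraMap A L).rangeRestrict
    ⟨fun a b hab ↦ FaithfulSMul.algebraMap_injective A L (congrArg Subtype.val hab),
      (algebraMap A L).rangeRestrict_surjective⟩
  obtain ⟨V, hAV, hIV⟩ := Ideal.image_subset_nonunits_valuationSubring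
    (RingHom.ker ((χ : A →+* K).comp (e.symm : (algebraMap A L).range →+* A)))
    (RingHom.ker_ne_top _)
  have hA (a : A) : algebraMap A L a ∈ V := hAV ⟨a, rfl⟩
  have hker (a : A) (ha : χ a = 0) : algebraMap A L a ∈ V.nonunits :=
    hIV ⟨e a, by simpa [RingHom.mem_ker] using ha, rfl⟩
  have hK (k : K) : algebraMap K L k ∈ V := by
    rw [IsScalarTower.algebraMap_apply K A L]; exact hA _
  have hK0 (k : K) (hk : algebraMap K L k ∈ V.nonunits) : k = 0 := by
    by_contra hk0
    rw [ValuationSubring.mem_nonunits_iff_or] at hk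
    rcases hk with hk | hk
    · exact hk0 (by simpa using hk)
    · exact hk (by rw [← map_inv₀]; exact hK _)
  have hsub (a : A) : algebraMap A L a - algebraMap K L (χ a) ∈ V.nonunits := by
    rw [IsScalarTower.algebraMap_apply K A L, ← map_sub]
    exact hker _ (by simp)
  have hmul {a b : L} (ha : a ∈ V) (hb : b ∈ V.nonunits) : a * b ∈ V.nonunits := by
    rw [ValuationSubring.mem_nonunits_iff] at hb ⊢
    rw [map_mul]
    exact mul_lt_one_of_nonneg_of_lt_one_right ((V.valuation_le_one_iff a).2 ha) zero_le hb
  have hunit (a : A) (ha : χ a ≠ 0) : (algebraMap A L a)⁻¹ ∈ V :=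
    isUnit_of_not_mem_nonunits fun h0 ↦ ha (hK0 _ (by simpa using sub_mem h0 (hsub a)))
  have hs0 : algebraMap A L s ≠ 0 := fun h0 ↦ hχ (by
    rw [(map_eq_zero_iff _ (FaithfulSMul.algebraMap_injective A L)).1 h0, map_zero])
  have hB (b : L) (hb : b ∈ Algebra.adjoin K (G i)) :
      ∃ k : K, b - algebraMap K L k ∈ V.nonunits := by
    obtain ⟨n, c, hc⟩ := hs b hb
    refine ⟨χ c / χ s ^ n, ?_⟩
    have hkc : χ (c - algebraMap K A (χ c / χ s ^ n) * s ^ n) = 0 := by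
      rw [map_sub, map_mul, AlgHom.commutes, map_pow, Algebra.algebraMap_self, RingHom.id_apply,
        div_mul_cancel₀ _ (pow_ne_zero _ hχ), sub_self]
    have h1 := hmul (pow_mem (hunit s hχ) n) (hker _ hkc)
    rw [map_sub, map_mul, ← IsScalarTower.algebraMap_apply, ← hc, map_pow, ← sub_mul, mul_comm,
      mul_assoc, ← mul_pow, mul_inv_cancel₀ hs0, one_pow, mul_one] at h1
    exact h1
  have hBV (b : L) (hb : b ∈ Algebra.adjoin K (G i)) : b ∈ V := by
    obtain ⟨k, hk⟩ := hB b hb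
    rw [← sub_add_cancel b (algebraMap K L k)]
    exact add_mem (V.nonunits_subset hk) (hK k)
  let I : Ideal (Algebra.adjoin K (G i)) := (IsLocalRing.maximalIdeal V).comap
    (Subring.inclusion (R := L) (S := (Algebra.adjoin K (G i)).toSubring) (T := V.toSubring) hBV)
  have hmemI (b : Algebra.adjoin K (G i)) : b ∈ I ↔ (b : L) ∈ V.nonunits :=
    (V.coe_mem_nonunits_iff (a := ⟨b, hBV b b.2⟩)).symm
  have hI0 : I ≠ ⊥ := by
    intro h0
    refine h.not_isField i ?_
    have hbij : Function.Bijective (algebraMap K (Algebra.adjoin K (G i))) := by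
      refine ⟨(algebraMap K _).injective, fun b ↦ ?_⟩
      obtain ⟨k, hk⟩ := hB b b.2
      refine ⟨k, ?_⟩
      have : b - algebraMap K _ k ∈ I := (hmemI _).2 hk
      rw [h0, Ideal.mem_bot, sub_eq_zero] at this
      exact this.symm
    exact (RingEquiv.ofBijective _ hbij).symm.toMulEquiv.isField (Field.toIsField K)
  have hIp : I.IsPrime := Ideal.comap_isPrime _ _
  let q : HeightOneSpectrum (Algebra.adjoin K (G i)) := ⟨I, hIp, hI0⟩
  have hdu (d : q.asIdeal.primeCompl) : (d : L)⁻¹ ∈ V :=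
    isUnit_of_not_mem_nonunits fun h0 ↦ d.2 ((hmemI _).2 h0)
  have hdn (d : q.asIdeal.primeCompl) : ((d : Algebra.adjoin K (G i)) : L) ≠ 0 := fun h0 ↦
    d.2 ((hmemI _).2 (by rw [h0]; exact V.nonunits.zero_mem))
  have hres (a : L) (ha : a ∈ V) : ∃ k : K, a - algebraMap K L k ∈ V.nonunits := by
    have hdiv : ∃ (n : Algebra.adjoin K (G i)) (d : q.asIdeal.primeCompl),
        a * ((d : Algebra.adjoin K (G i)) : L) = n := by
      obtain ⟨n, d, h1 | h1⟩ := q.exists_primeCompl_mul_eq_or_mul_eq a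
      · exact ⟨n, d, h1⟩
      · have hn : n ∈ q.asIdeal.primeCompl := fun h0 ↦
          d.2 ((hmemI _).2 (by rw [show ((d : Algebra.adjoin K (G i)) : L) = a * n from h1.symm]
                               exact hmul ha ((hmemI _).1 h0)))
        exact ⟨d, ⟨n, hn⟩, h1⟩
    obtain ⟨n, d, hnd⟩ := hdiv
    obtain ⟨kn, hn⟩ := hB n n.2
    obtain ⟨kd, hd⟩ := hB _ d.1.2
    have hkd : kd ≠ 0 := by
      rintro rfl
      exact d.2 ((hmemI _).2 (by simpa using hd))
    have hkd' : algebraMap K L kd ≠ 0 := by simpa using hkd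
    refine ⟨kn / kd, ?_⟩
    have h1 := hmul (hdu d) (sub_mem hn (hmul (hK (kn / kd)) hd))
    convert h1 using 1
    rw [← hnd, map_div₀]
    have := hdn d
    field_simp
    ring
  refine ⟨⟨V, hK, hres⟩, fun a ↦ ⟨hA a, ev_eq_of_sub_mem (hsub a)⟩⟩

theorem finite_setOf_not_exists_ratPlace [IsDomain A] [IsNoetherianRing A] [Ring.KrullDimLE 1 A]
    (h : IsChartPair K τ G) : {χ : A →ₐ[K] K | ¬ ∃ P : RatPlace K L, ∀ a,
      algebraMap A L a ∈ P.ring ∧ P.ev (algebraMap A L a) = χ a}.Finite := by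
  obtain ⟨s, hs0, hs⟩ := h.exists_mul_pow_eq true (A := A)
  refine Set.Finite.of_finite_image ((Ideal.finite_setOf_isPrime_mem hs0).subset ?_)
    AlgHom.ker_injective.injOn
  rintro _ ⟨χ, hχ, rfl⟩
  refine ⟨RingHom.ker_isPrime _, ?_⟩
  by_contra h0
  exact hχ (h.exists_ratPlace true hs χ h0)

theorem finite_setOf_ne_and_ev_eq [IsDomain A] (h : IsChartPair K τ G) :
    {z : RatPlace K L × RatPlace K L | z.1 ≠ z.2 ∧ ∀ a : A, algebraMap A L a ∈ z.1.ring ∧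
      algebraMap A L a ∈ z.2.ring ∧
      z.1.ev (algebraMap A L a) = z.2.ev (algebraMap A L a)}.Finite := by
  have := h.isDedekindDomain true
  have := h.isFractionRing true
  obtain ⟨s, hs0, hs⟩ := h.exists_mul_pow_eq true (A := A)
  have hsL : algebraMap A L s ≠ 0 := fun h0 ↦
    hs0 ((map_eq_zero_iff _ (FaithfulSMul.algebraMap_injective A L)).1 h0)
  refine ((h.finite_setOf_mem_nonunits hsL).prod (h.finite_setOf_mem_nonunits hsL)).subset ?_
  rintro ⟨P, Q⟩ ⟨hne, hPQ⟩
  by_cases hP : P.ev (algebraMap A L s) = 0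
  · exact ⟨(ev_eq_zero_iff (hPQ s).1).1 hP, (ev_eq_zero_iff (hPQ s).2.1).1 ((hPQ s).2.2 ▸ hP)⟩
  have hQ : Q.ev (algebraMap A L s) ≠ 0 := (hPQ s).2.2 ▸ hP
  have hev (R : RatPlace K L) (hR : ∀ a, algebraMap A L a ∈ R.ring)
      (hR0 : R.ev (algebraMap A L s) ≠ 0) {b : L} {n : ℕ} {c : A}
      (hc : b * algebraMap A L s ^ n = algebraMap A L c) :
      b ∈ R.ring ∧ R.ev b = R.ev (algebraMap A L c) / R.ev (algebraMap A L (s ^ n)) := by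
    have hpow (n : ℕ) : R.ev (algebraMap A L (s ^ n)) ≠ 0 := by
      induction n with
      | zero => simp
      | succ n ih => rw [pow_succ, map_mul, ev_mul (hR _) (hR _)]; exact mul_ne_zero ih hR0
    rw [← map_pow] at hc
    have hb : b ∈ R.ring := mem_of_mul_mem (hpow n) (hc ▸ hR c)
    refine ⟨hb, ?_⟩
    rw [eq_div_iff (hpow n), ← ev_mul hb (hR _), hc]
  refine absurd (ext_of_isDedekindDomain (Algebra.adjoin K (G true)) (fun b hb ↦ ?_)
    (fun b hb ↦ ?_) fun b hb ↦ ?_) hne <;> obtain ⟨n, c, hc⟩ := hs b hb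
  · exact (hev P (fun a ↦ (hPQ a).1) hP hc).1
  · exact (hev Q (fun a ↦ (hPQ a).2.1) hQ hc).1
  · rw [(hev P (fun a ↦ (hPQ a).1) hP hc).2, (hev Q (fun a ↦ (hPQ a).2.1) hQ hc).2, (hPQ _).2.2,
      (hPQ _).2.2]

end IsChartPair

end AffinePoints

section Properness

theorem MvPolynomial.algebraMap_homogeneousSubmodule_zero_surjective (σ : Type*) :
    Function.Surjective (algebraMap ℤ (homogeneousSubmodule σ ℤ 0)) := by
  rintro ⟨p, hp⟩
  have h0 := (totalDegree_zero_iff_isHomogeneous _).2 ((mem_homogeneousSubmodule 0 p).1 hp)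
  exact ⟨p.coeff 0, Subtype.ext (totalDegree_eq_zero_iff_eq_C.1 h0).symm⟩

theorem exists_isProper_ProjZ (n : ℕ) : ∃ q : ProjZ n ⟶ Spec (CommRingCat.of ℤ), IsProper q := by
  have : Algebra.FiniteType (MvPolynomial.homogeneousSubmodule (Fin (n + 1)) ℤ 0)
      (MvPolynomial (Fin (n + 1)) ℤ) := by
    refine ⟨Finset.univ.image MvPolynomial.X, eq_top_iff.2 fun a _ ↦ ?_⟩
    induction a using MvPolynomial.induction_on with
    | C c =>
      let c' : MvPolynomial.homogeneousSubmodule (Fin (n + 1)) ℤ 0 :=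
        ⟨MvPolynomial.C c, MvPolynomial.isHomogeneous_C _ c⟩
      exact Subalgebra.algebraMap_mem (Algebra.adjoin _ _) c'
    | add a b ha hb => exact add_mem (ha trivial) (hb trivial)
    | mul_X a i ha => exact mul_mem (ha trivial) (Algebra.subset_adjoin (by simp))
  have : IsClosedImmersion (Spec.map (CommRingCat.ofHom (algebraMap ℤ
      (MvPolynomial.homogeneousSubmodule (Fin (n + 1)) ℤ 0)))) :=
    IsClosedImmersion.spec_of_surjective _
      (MvPolynomial.algebraMap_homogeneousSubmodule_zero_surjective _)
  refine ⟨Proj.toSpecZero _ ≫ Spec.map (CommRingCat.ofHom (algebraMap ℤ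
      (MvPolynomial.homogeneousSubmodule (Fin (n + 1)) ℤ 0))), ?_⟩
  have h : IsProper (Proj.toSpecZero (MvPolynomial.homogeneousSubmodule (Fin (n + 1)) ℤ)) :=
    AlgebraicGeometry.Proj.instIsProperToSpecZeroOfFiniteTypeSubtypeMemOfNatNat _
  exact MorphismProperty.comp_mem _ _ _ h inferInstance

theorem isProper_ProjOver_structMap (n : ℕ) (R : Type) [CommRing R] :
    IsProper (ProjOver.structMap n R) := by
  obtain ⟨q, hq⟩ := exists_isProper_ProjZ n
  obtain rfl : q = specZIsTerminal.from _ := specZIsTerminal.hom_ext _ _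
  have h : IsPullback (prod.fst : ProjOver n R ⟶ _) (ProjOver.structMap n R)
      (specZIsTerminal.from (ProjZ n)) (specZIsTerminal.from _) :=
    IsPullback.of_is_product' (prodIsProd _ _) specZIsTerminal
  exact MorphismProperty.of_isPullback h hq

theorem IsProjectiveOver.isProper {X : Scheme} {R : Type} [CommRing R]
    {p : X ⟶ Spec (CommRingCat.of R)} (hp : IsProjectiveOver p) : IsProper p := by
  obtain ⟨n, ι, hι, rfl⟩ := hp
  have := isProper_ProjOver_structMap n R
  exact MorphismProperty.comp_mem _ _ _ inferInstance inferInstance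

end Properness

section Centers

namespace RatPlace

section RingHoms

variable {K L : Type*} [Field K] [Field L] [Algebra K L] (P : RatPlace K L)

/-- Evaluation at a rational place, as a ring homomorphism on its valuation ring. -/
def evHom : P.ring →+* K where
  toFun a := P.ev a
  map_one' := ev_one
  map_mul' a b := ev_mul a.2 b.2
  map_zero' := ev_zero
  map_add' a b := ev_add a.2 b.2

/-- The inclusion of the ground field in the valuation ring of a rational place. -/
def ofField : K →+* P.ring := (algebraMap K L).codRestrict P.ring P.algebraMap_mem

theorem evHom_comp_ofField : P.evHom.comp P.ofField = RingHom.id K :=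
  RingHom.ext fun k ↦ ev_algebraMap (P := P) k

theorem evHom_surjective : Function.Surjective P.evHom :=
  fun k ↦ ⟨P.ofField k, DFunLike.congr_fun P.evHom_comp_ofField k⟩

theorem subtype_comp_ofField : P.ring.subtype.comp P.ofField = algebraMap K L := rfl

/-- The map of valuation rings induced by pulling back a rational place. -/
def comapHom (φ : L →ₐ[K] L) : (comap φ P).ring →+* P.ring :=
  (φ.toRingHom.comp (comap φ P).ring.subtype).codRestrict P.ring fun a ↦ a.2

theorem subtype_comp_comapHom (φ : L →ₐ[K] L) :
    P.ring.subtype.comp (P.comapHom φ) = φ.toRingHom.comp (comap φ P).ring.subtype := rfl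

theorem comapHom_comp_ofField (φ : L →ₐ[K] L) :
    (P.comapHom φ).comp (comap φ P).ofField = P.ofField :=
  RingHom.ext fun k ↦ Subtype.ext (φ.commutes k)

theorem evHom_comp_comapHom (φ : L →ₐ[K] L) :
    P.evHom.comp (P.comapHom φ) = (comap φ P).evHom :=
  RingHom.ext fun _ ↦ (ev_comap ..).symm

end RingHoms

variable {K L : Type} [Field K] [Field L] [Algebra K L] {X : Scheme.{0}}
  {η : Spec (.of L) ⟶ X} {p : X ⟶ Spec (.of K)} {P : RatPlace K L}

/-- A model of the spectrum of the valuation ring of a rational place in a scheme with a point `η`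
over the function field. -/
structure IsLift (η : Spec (.of L) ⟶ X) (p : X ⟶ Spec (.of K)) (P : RatPlace K L)
    (l : Spec (.of P.ring) ⟶ X) : Prop where
  generic : Spec.map (CommRingCat.ofHom P.ring.subtype) ≫ l = η
  structMap : l ≫ p = Spec.map (CommRingCat.ofHom P.ofField)

theorem lift_ext [IsSeparated p] {l l' : Spec (.of P.ring) ⟶ X}
    (h : Spec.map (CommRingCat.ofHom P.ring.subtype) ≫ l =
      Spec.map (CommRingCat.ofHom P.ring.subtype) ≫ l') (hp : l ≫ p = l' ≫ p) : l = l' := by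
  let S : ValuativeCommSq p :=
    { R := P.ring
      K := L
      i₁ := Spec.map (CommRingCat.ofHom P.ring.subtype) ≫ l'
      i₂ := l' ≫ p
      commSq := ⟨by rw [Category.assoc]; rfl⟩ }
  have := IsSeparated.valuativeCriterion p S
  exact congrArg CommSq.LiftStruct.l (Subsingleton.elim (α := S.commSq.LiftStruct)
    ⟨l, h, hp⟩ ⟨l', rfl, rfl⟩)

theorem exists_isLift [UniversallyClosed p]
    (hη : η ≫ p = Spec.map (CommRingCat.ofHom (algebraMap K L))) (P : RatPlace K L) :
    ∃ l, IsLift η p P l := by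
  have hp : ValuativeCriterion.Existence p := by
    have h : UniversallyClosed p := inferInstance
    rw [UniversallyClosed.eq_valuativeCriterion] at h
    exact h.1
  let S : ValuativeCommSq p :=
    { R := P.ring
      K := L
      i₁ := η
      i₂ := Spec.map (CommRingCat.ofHom P.ofField)
      commSq := ⟨by
        rw [hη, ← P.subtype_comp_ofField, CommRingCat.ofHom_comp, Spec.map_comp]
        rfl⟩ }
  obtain ⟨⟨l, h, h'⟩⟩ := (hp S).exists_lift
  exact ⟨l, h, h'⟩

theorem IsLift.evHom_comp_structMap {l : Spec (.of P.ring) ⟶ X} (h : IsLift η p P l) :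
    (Spec.map (CommRingCat.ofHom P.evHom) ≫ l) ≫ p = 𝟙 _ := by
  rw [Category.assoc, h.structMap, ← Spec.map_comp, ← CommRingCat.ofHom_comp,
    P.evHom_comp_ofField]
  exact Spec.map_id _

theorem IsLift.evHom_comp_map [IsSeparated p] {f : X ⟶ X} (hf : f ≫ p = p) {φ : L →ₐ[K] L}
    (hφ : η ≫ f = Spec.map (CommRingCat.ofHom φ.toRingHom) ≫ η)
    {l : Spec (.of P.ring) ⟶ X} (h : IsLift η p P l)
    {l' : Spec (.of (comap φ P).ring) ⟶ X} (h' : IsLift η p (comap φ P) l') :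
    Spec.map (CommRingCat.ofHom (comap φ P).evHom) ≫ l' =
      (Spec.map (CommRingCat.ofHom P.evHom) ≫ l) ≫ f := by
  have key : Spec.map (CommRingCat.ofHom (P.comapHom φ)) ≫ l' = l ≫ f := by
    refine lift_ext (p := p) ?_ ?_
    · rw [← Spec.map_comp_assoc, ← CommRingCat.ofHom_comp, subtype_comp_comapHom,
        CommRingCat.ofHom_comp, Spec.map_comp_assoc, h'.generic, ← hφ, ← h.generic,
        Category.assoc]
    · rw [Category.assoc, h'.structMap, Category.assoc, hf, h.structMap, ← Spec.map_comp,
        ← CommRingCat.ofHom_comp, comapHom_comp_ofField]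
  rw [Category.assoc, ← key, ← Spec.map_comp_assoc, ← CommRingCat.ofHom_comp,
    evHom_comp_comapHom]

variable {A : Type} [CommRing A] [Algebra A L] {u : Spec (.of A) ⟶ X}
  [IsOpenImmersion u]

theorem IsLift.evHom_comp_eq_iff [IsSeparated p] [Algebra K A] [IsScalarTower K A L]
    (hu : Spec.map (CommRingCat.ofHom (algebraMap A L)) ≫ u = η)
    (hup : u ≫ p = Spec.map (CommRingCat.ofHom (algebraMap K A)))
    {l : Spec (.of P.ring) ⟶ X} (h : IsLift η p P l) (χ : A →+* K) :
    Spec.map (CommRingCat.ofHom P.evHom) ≫ l = Spec.map (CommRingCat.ofHom χ) ≫ u ↔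
      ∀ a, algebraMap A L a ∈ P.ring ∧ P.ev (algebraMap A L a) = χ a := by
  constructor
  · intro hx
    have hloc : IsLocalHom P.evHom := P.evHom_surjective.isLocalHom
    have hcl : Spec.map (CommRingCat.ofHom P.evHom) (IsLocalRing.closedPoint K) =
        IsLocalRing.closedPoint P.ring := IsLocalRing.comap_closedPoint P.evHom
    have hl : Set.range l ⊆ Set.range u := by
      rintro _ ⟨z, rfl⟩
      refine ((IsLocalRing.specializes_closedPoint z).map l.continuous).mem_open
        u.isOpenEmbedding.isOpen_range ?_
      have hlc : (Spec.map (CommRingCat.ofHom P.evHom) ≫ l) (IsLocalRing.closedPoint K) =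
          l (IsLocalRing.closedPoint P.ring) :=
        (Scheme.Hom.comp_apply _ _ _).trans (congrArg l hcl)
      rw [← hlc, hx]
      exact ⟨_, (Scheme.Hom.comp_apply _ _ _).symm⟩
    let l' := IsOpenImmersion.lift u l hl
    have hl' : l' ≫ u = l := IsOpenImmersion.lift_fac u l hl
    obtain ⟨g, hg⟩ : ∃ g : A →+* P.ring, Spec.map (CommRingCat.ofHom g) = l' :=
      ⟨(Spec.preimage l').hom, Spec.map_preimage l'⟩
    have h1 : P.ring.subtype.comp g = algebraMap A L := by
      have : Spec.map (CommRingCat.ofHom (P.ring.subtype.comp g)) =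
          Spec.map (CommRingCat.ofHom (algebraMap A L)) := by
        rw [← cancel_mono u, hu, CommRingCat.ofHom_comp, Spec.map_comp, hg, Category.assoc, hl',
          h.generic]
      exact congrArg CommRingCat.Hom.hom (Spec.map_injective this)
    have h2 : P.evHom.comp g = χ := by
      have : Spec.map (CommRingCat.ofHom (P.evHom.comp g)) =
          Spec.map (CommRingCat.ofHom χ) := by
        rw [← cancel_mono u, CommRingCat.ofHom_comp, Spec.map_comp, hg, Category.assoc, hl', hx]
      exact congrArg CommRingCat.Hom.hom (Spec.map_injective this)
    intro a
    rw [← h1, ← h2]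
    exact ⟨(g a).2, rfl⟩
  · intro hP
    let g : A →+* P.ring := (algebraMap A L).codRestrict P.ring fun a ↦ (hP a).1
    have hg : l = Spec.map (CommRingCat.ofHom g) ≫ u := by
      refine lift_ext (p := p) ?_ ?_
      · rw [h.generic, ← Spec.map_comp_assoc, ← CommRingCat.ofHom_comp]
        exact hu.symm
      · rw [h.structMap, Category.assoc, hup, ← Spec.map_comp, ← CommRingCat.ofHom_comp]
        congr 2
        ext k
        exact IsScalarTower.algebraMap_apply K A L k
    rw [hg, ← Spec.map_comp_assoc, ← CommRingCat.ofHom_comp]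
    congr 3
    ext a
    exact (hP a).2

end RatPlace

variable {K A : Type} [Field K] [CommRing A] [Algebra K A] {X : Scheme.{0}}
  {p : X ⟶ Spec (.of K)} {u : Spec (.of A) ⟶ X} [IsOpenImmersion u]

theorem exists_algHom_map_comp_eq
    (hup : u ≫ p = Spec.map (CommRingCat.ofHom (algebraMap K A)))
    {x : Spec (.of K) ⟶ X} (hx : x ≫ p = 𝟙 _)
    (hxu : x (IsLocalRing.closedPoint K) ∈ Set.range u) :
    ∃ χ : A →ₐ[K] K, Spec.map (CommRingCat.ofHom χ.toRingHom) ≫ u = x := by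
  have hl : Set.range x ⊆ Set.range u := by
    rintro _ ⟨z, rfl⟩
    exact ((IsLocalRing.specializes_closedPoint z).map x.continuous).mem_open
      u.isOpenEmbedding.isOpen_range hxu
  obtain ⟨χ, hχ⟩ : ∃ χ : A →+* K, Spec.map (CommRingCat.ofHom χ) = IsOpenImmersion.lift u x hl :=
    ⟨(Spec.preimage (IsOpenImmersion.lift u x hl)).hom, Spec.map_preimage _⟩
  have hχx : Spec.map (CommRingCat.ofHom χ) ≫ u = x := by
    rw [hχ, IsOpenImmersion.lift_fac]
  have h : χ.comp (algebraMap K A) = RingHom.id K := by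
    have : Spec.map (CommRingCat.ofHom (χ.comp (algebraMap K A))) =
        Spec.map (CommRingCat.ofHom (RingHom.id K)) := by
      rw [CommRingCat.ofHom_comp, Spec.map_comp, ← hup, ← Category.assoc, hχx, hx]
      exact (Spec.map_id _).symm
    exact congrArg CommRingCat.Hom.hom (Spec.map_injective this)
  exact ⟨{ χ with commutes' := DFunLike.congr_fun h }, hχx⟩

theorem Algebra.IsAlgebraic.of_isFractionRing (K A L : Type*) [Field K] [Field L] [CommRing A]
    [IsDomain A] [Algebra K A] [Algebra A L] [Algebra K L] [IsScalarTower K A L]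
    [IsFractionRing A L] [Algebra.IsAlgebraic K A] : Algebra.IsAlgebraic K L :=
  have : Algebra.IsAlgebraic A L := IsLocalization.isAlgebraic L (nonZeroDivisors A)
  Algebra.IsAlgebraic.trans K A L

end Centers

section KPoints

/-- The rational points of a scheme over a field. -/
def KPoint {K : Type} [Field K] {X : Scheme.{0}} (p : X ⟶ Spec (.of K)) : Type :=
  {x : Spec (.of K) ⟶ X // x ≫ p = 𝟙 _}

/-- The action of an endomorphism on rational points. -/
def KPoint.map {K : Type} [Field K] {X : Scheme.{0}} {p : X ⟶ Spec (.of K)} {f : X ⟶ X}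
    (hf : f ≫ p = p) (x : KPoint p) : KPoint p :=
  ⟨x.1 ≫ f, by rw [Category.assoc, hf, x.2]⟩

theorem KPoint.exists_iterate_map_eq {K L : Type} [Field K] [NumberField K] [Field L] [Algebra K L]
    {X : Scheme.{0}} {p : X ⟶ Spec (.of K)} [IsProper p] {η : Spec (.of L) ⟶ X}
    (hη : η ≫ p = Spec.map (CommRingCat.ofHom (algebraMap K L)))
    {f : X ⟶ X} (hf : f ≫ p = p) {φ : L →ₐ[K] L}
    (hφ : η ≫ f = Spec.map (CommRingCat.ofHom φ.toRingHom) ≫ η)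
    {ι : Type*} [Finite ι] (A : ι → Type) [∀ i, CommRing (A i)] [∀ i, IsDomain (A i)]
    [∀ i, Algebra K (A i)] [∀ i, Algebra (A i) L] [∀ i, IsScalarTower K (A i) L]
    [∀ i, IsFractionRing (A i) L] [∀ i, Algebra.FiniteType K (A i)]
    [∀ i, Ring.KrullDimLE 1 (A i)]
    (u : ∀ i, Spec (.of (A i)) ⟶ X) [∀ i, IsOpenImmersion (u i)]
    (hu : ∀ i, Spec.map (CommRingCat.ofHom (algebraMap (A i) L)) ≫ u i = η)
    (hup : ∀ i, u i ≫ p = Spec.map (CommRingCat.ofHom (algebraMap K (A i))))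
    (hcover : ∀ z : X, ∃ i, z ∈ Set.range (u i)) :
    ∃ N, ∀ x y : KPoint p, (∃ s, (KPoint.map hf)^[s] x = (KPoint.map hf)^[s] y) →
      (KPoint.map hf)^[N] x = (KPoint.map hf)^[N] y := by
  have hpt (x : KPoint p) : ∃ i, ∃ χ : A i →ₐ[K] K,
      Spec.map (CommRingCat.ofHom χ.toRingHom) ≫ u i = x.1 := by
    obtain ⟨i, hi⟩ := hcover (x.1 (IsLocalRing.closedPoint K))
    exact ⟨i, exists_algHom_map_comp_eq (hup i) x.2 hi⟩
  by_cases halg : Algebra.IsAlgebraic K L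
  · have hsub (i : ι) : Subsingleton (A i →ₐ[K] K) := by
      have : Algebra.IsAlgebraic K (A i) := Algebra.IsAlgebraic.of_injective
        (IsScalarTower.toAlgHom K (A i) L) (IsFractionRing.injective (A i) L)
      exact AlgHom.subsingleton_of_isAlgebraic
    have hfin : Finite (KPoint p) := by
      choose i hi using hpt
      refine Finite.of_injective i fun x y hxy ↦ Subtype.ext ?_
      obtain ⟨χ, hχ⟩ := hi x
      obtain ⟨χ', hχ'⟩ := hi y
      rw [← hχ, ← hχ']
      generalize i x = j at *
      subst hxy
      rw [Subsingleton.elim χ χ']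
    obtain ⟨N, hN⟩ := Function.exists_iterate_eq_of_finite (KPoint.map hf) Set.finite_univ
    exact ⟨N, fun x y ↦ hN x trivial y trivial⟩
  have hA (i : ι) : ¬ Algebra.IsAlgebraic K (A i) := fun h ↦
    halg (Algebra.IsAlgebraic.of_isFractionRing K (A i) L)
  have hnoeth (i : ι) : IsNoetherianRing (A i) := Algebra.FiniteType.isNoetherianRing K _
  obtain ⟨i₀, -⟩ := hcover (η (IsLocalRing.closedPoint L))
  obtain ⟨τ, G, h⟩ := exists_isChartPair_of_finiteType (L := L) (hA i₀)
  choose l hl using RatPlace.exists_isLift hη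
  let π (P : RatPlace K L) : KPoint p :=
    ⟨Spec.map (CommRingCat.ofHom P.evHom) ≫ l P, (hl P).evHom_comp_structMap⟩
  have hπ : Function.Semiconj π (RatPlace.comap φ) (KPoint.map hf) := fun P ↦
    Subtype.ext ((hl P).evHom_comp_map hf hφ (hl _))
  have hchart (i : ι) (P : RatPlace K L) (χ : A i →ₐ[K] K) :=
    (hl P).evHom_comp_eq_iff (hu i) (hup i) χ.toRingHom
  refine hπ.exists_iterate_eq_of_finite ?_ ?_ (h.exists_iterate_eq φ)
  · let S (i : ι) : Set (Spec (.of K) ⟶ X) :=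
      (fun χ : A i →ₐ[K] K ↦ Spec.map (CommRingCat.ofHom χ.toRingHom) ≫ u i) ''
        {χ | ¬ ∃ P : RatPlace K L, ∀ a, algebraMap (A i) L a ∈ P.ring ∧
          P.ev (algebraMap (A i) L a) = χ a}
    have hS : (⋃ i, S i).Finite :=
      Set.finite_iUnion fun i ↦ (h.finite_setOf_not_exists_ratPlace (A := A i)).image _
    refine (hS.preimage (f := fun x : KPoint p ↦ x.1)
      Subtype.val_injective.injOn).subset fun x hx ↦ ?_
    obtain ⟨i, χ, hχ⟩ := hpt x
    refine Set.mem_iUnion.2 ⟨i, χ, fun ⟨P, hP⟩ ↦ hx ⟨P, Subtype.ext ?_⟩, hχ⟩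
    exact ((hchart i P χ).2 hP).trans hχ
  · refine (Set.finite_iUnion fun i ↦ h.finite_setOf_ne_and_ev_eq (A := A i)).subset ?_
    rintro ⟨P, Q⟩ ⟨hne, hPQ⟩
    obtain ⟨i, χ, hχ⟩ := hpt (π P)
    have hP := (hchart i P χ).1 hχ.symm
    have hQ := (hchart i Q χ).1 ((congrArg Subtype.val hPQ).symm.trans hχ.symm)
    exact Set.mem_iUnion.2 ⟨i, hne, fun a ↦ ⟨(hP a).1, (hQ a).1, (hP a).2.trans (hQ a).2.symm⟩⟩

end KPoints

section FunctionField

theorem AlgebraicGeometry.Scheme.map_genericPoint {X Y : Scheme} [IrreducibleSpace X]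
    [IrreducibleSpace Y] (f : X ⟶ Y) [Surjective f] : f (genericPoint X) = genericPoint Y := by
  refine ((genericPoint_spec Y).eq ?_).symm
  have h := (genericPoint_spec X).image f.continuous
  rwa [Set.image_univ, f.surjective.range_eq, closure_univ] at h

theorem AlgebraicGeometry.Scheme.exists_functionField_map {X : Scheme} [IrreducibleSpace X]
    (f : X ⟶ X) [Surjective f] : ∃ ψ : X.functionField ⟶ X.functionField,
      X.fromSpecStalk (genericPoint X) ≫ f = Spec.map ψ ≫ X.fromSpecStalk (genericPoint X) := by
  have h : genericPoint X ⤳ f (genericPoint X) :=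
    (specializes_of_eq (Scheme.map_genericPoint f).symm)
  have h' : f (genericPoint X) ⤳ genericPoint X :=
    (specializes_of_eq (Scheme.map_genericPoint f))
  refine ⟨X.presheaf.stalkSpecializes h' ≫ f.stalkMap (genericPoint X), ?_⟩
  rw [Spec.map_comp, Category.assoc, Scheme.SpecMap_stalkSpecializes_fromSpecStalk,
    Scheme.SpecMap_stalkMap_fromSpecStalk]

theorem AlgebraicGeometry.Scheme.exists_finite_affineOpens (X : Scheme) [CompactSpace X] :
    ∃ (t : Finset X) (U : t → X.Opens), (∀ i, IsAffineOpen (U i)) ∧ (∀ i, Nonempty (U i)) ∧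
      ∀ z : X, ∃ i, z ∈ U i := by
  choose U hU hz _ using fun z : X ↦
    exists_isAffineOpen_mem_and_subset (X := X) (x := z) (U := ⊤) trivial
  obtain ⟨t, -, ht⟩ := isCompact_univ.elim_nhds_subcover (fun z ↦ (U z : Set X))
    fun z _ ↦ (U z).isOpen.mem_nhds (hz z)
  refine ⟨t, fun i ↦ U i, fun i ↦ hU i, fun i ↦ ⟨i, hz i⟩, fun z ↦ ?_⟩
  obtain ⟨i, hi, hzi⟩ := Set.mem_iUnion₂.1 (ht (Set.mem_univ z))
  exact ⟨⟨i, hi⟩, hzi⟩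

theorem AlgebraicGeometry.IsAffineOpen.krullDimLE {X : Scheme} {U : X.Opens} (hU : IsAffineOpen U)
    {n : ℕ} (h : topologicalKrullDim X ≤ n) : Ring.KrullDimLE n Γ(X, U) := by
  rw [Ring.krullDimLE_iff, ← PrimeSpectrum.topologicalKrullDim_eq_ringKrullDim]
  exact hU.fromSpec.isOpenEmbedding.isInducing.topologicalKrullDim_le.trans h

theorem KPoint.exists_iterate_map_eq_of_isIntegral {K : Type} [Field K] [NumberField K]
    {X : Scheme.{0}} [IsIntegral X] (hdim : topologicalKrullDim X ≤ 1)
    {p : X ⟶ Spec (.of K)} [IsProper p] {f : X ⟶ X} [Surjective f] (hf : f ≫ p = p) :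
    ∃ N, ∀ x y : KPoint p, (∃ s, (KPoint.map hf)^[s] x = (KPoint.map hf)^[s] y) →
      (KPoint.map hf)^[N] x = (KPoint.map hf)^[N] y := by
  have : CompactSpace X := QuasiCompact.compactSpace_of_compactSpace p
  obtain ⟨t, U, hU, hUne, hcover⟩ := X.exists_finite_affineOpens
  obtain ⟨ψ, hψ⟩ := Scheme.exists_functionField_map f
  let η : Spec (.of X.functionField) ⟶ X := X.fromSpecStalk (genericPoint X)
  let algL : Algebra K X.functionField := (Spec.preimage (η ≫ p)).hom.toAlgebra
  have hη : η ≫ p = Spec.map (CommRingCat.ofHom (algebraMap K X.functionField)) :=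
    (Spec.map_preimage (η ≫ p)).symm
  let algA (i : t) : Algebra K Γ(X, U i) := (Spec.preimage ((hU i).fromSpec ≫ p)).hom.toAlgebra
  have hup (i : t) : (hU i).fromSpec ≫ p =
      Spec.map (CommRingCat.ofHom (algebraMap K Γ(X, U i))) :=
    (Spec.map_preimage ((hU i).fromSpec ≫ p)).symm
  have hu (i : t) : Spec.map (CommRingCat.ofHom (algebraMap Γ(X, U i) X.functionField)) ≫
      (hU i).fromSpec = η :=
    (hU i).fromSpecStalk_eq_fromSpecStalk _
  have (i : t) : IsScalarTower K Γ(X, U i) X.functionField := by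
    refine .of_algebraMap_eq' ?_
    have h : Spec.map (CommRingCat.ofHom (algebraMap K X.functionField)) =
        Spec.map (CommRingCat.ofHom ((algebraMap Γ(X, U i) X.functionField).comp
          (algebraMap K Γ(X, U i)))) := by
      rw [← hη, ← hu i, Category.assoc, hup, ← Spec.map_comp, ← CommRingCat.ofHom_comp]
    exact congrArg CommRingCat.Hom.hom (Spec.map_injective h)
  have (i : t) : IsFractionRing Γ(X, U i) X.functionField :=
    functionField_isFractionRing_of_isAffineOpen X _ (hU i)
  have (i : t) : Algebra.FiniteType K Γ(X, U i) := by
    have h : LocallyOfFiniteType ((hU i).fromSpec ≫ p) := inferInstance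
    rw [hup, HasRingHomProperty.Spec_iff (P := @LocallyOfFiniteType)] at h
    exact h
  have (i : t) : Ring.KrullDimLE 1 Γ(X, U i) := (hU i).krullDimLE hdim
  let φ : X.functionField →ₐ[K] X.functionField :=
    { ψ.hom with
      commutes' := by
        have h : Spec.map (CommRingCat.ofHom (ψ.hom.comp (algebraMap K X.functionField))) =
            Spec.map (CommRingCat.ofHom (algebraMap K X.functionField)) := by
          rw [CommRingCat.ofHom_comp, Spec.map_comp, ← hη, ← Category.assoc]
          exact (congrArg (· ≫ p) hψ).symm.trans (by rw [Category.assoc, hf])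
        exact DFunLike.congr_fun (congrArg CommRingCat.Hom.hom (Spec.map_injective h)) }
  exact KPoint.exists_iterate_map_eq hη hf (φ := φ) hψ (fun i ↦ Γ(X, U i))
    (fun i ↦ (hU i).fromSpec) hu hup fun z ↦ by simpa [(hU _).range_fromSpec] using hcover z

theorem KPoint.iterate_map {K : Type} [Field K] {X : Scheme.{0}} {p : X ⟶ Spec (.of K)}
    {f : X ⟶ X} (hf : f ≫ p = p) (x : KPoint p) (s : ℕ) :
    ((KPoint.map hf)^[s] x).1 = x.1 ≫ Scheme.iter f s := by
  induction s with
  | zero => exact (Category.comp_id _).symm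
  | succ s ih =>
    rw [Function.iterate_succ_apply']
    exact (congrArg (· ≫ f) ih).trans (Category.assoc _ _ _)

end FunctionField

theorem cancellation_for_projective_curves
    (K : Type) [Field K] [NumberField K]
    (X : Scheme) [IrreducibleSpace X] [IsReduced X]
    (hdim : topologicalKrullDim X = 1)
    (p : X ⟶ Spec (CommRingCat.of K)) (hproj : IsProjectiveOver p)
    (f : X ⟶ X) (hfp : f ≫ p = p) [AlgebraicGeometry.Surjective f] :
    ∃ s₀ : ℕ, ∀ x y : Spec (CommRingCat.of K) ⟶ X,
      x ≫ p = 𝟙 _ → y ≫ p = 𝟙 _ →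
      (∃ s : ℕ, x ≫ Scheme.iter f s = y ≫ Scheme.iter f s) →
      x ≫ Scheme.iter f s₀ = y ≫ Scheme.iter f s₀ := by
  have := hproj.isProper
  have := isIntegral_of_irreducibleSpace_of_isReduced X
  obtain ⟨N, hN⟩ := KPoint.exists_iterate_map_eq_of_isIntegral hdim.le hfp
  refine ⟨N, fun x y hx hy ⟨s, hs⟩ ↦ ?_⟩
  have h := hN ⟨x, hx⟩ ⟨y, hy⟩ ⟨s, Subtype.ext
    ((KPoint.iterate_map hfp ⟨x, hx⟩ s).trans (hs.trans (KPoint.iterate_map hfp ⟨y, hy⟩ s).symm))⟩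
  exact (KPoint.iterate_map hfp _ N).symm.trans
    ((congrArg Subtype.val h).trans (KPoint.iterate_map hfp _ N))

end
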